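/- Let n ≥ 2. The set of automorphisms f ∈ Aut_{ω₀}(ℂⁿ) admitting a hyperbolic fixed point p whose stable manifold Σ_f(p) is dense in ℂⁿ is comeagre in Aut_{ω₀}(ℂⁿ). -/

import Mathlib

open Topology Filter Metric Set Function

noncomputable section

/-- ℂⁿ with the Euclidean norm. -/
abbrev En (n : ℕ) : Type := EuclideanSpace ℂ (Fin n)

/-- A holomorphic automorphism of ℂⁿ: a bijection that is holomorphic with holomorphic inverse. -/
def IsHoloAut {n : ℕ} (f : En n → En n) : Prop :=
  Differentiable ℂ f ∧ ∃ g : En n → En n, Differentiable ℂ g ∧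
    Function.LeftInverse g f ∧ Function.RightInverse g f

/-- Volume-preserving with respect to ω₀ = dz₁∧⋯∧dzₙ: det Df(z) = 1 for all z. -/
def IsVolPres {n : ℕ} (f : En n → En n) : Prop :=
  ∀ z : En n, (fderiv ℂ f z).det = 1

/-- Aut(ℂⁿ) as a subset of C(ℂⁿ, ℂⁿ) with the compact-open topology. -/
def AutCN (n : ℕ) : Set C(En n, En n) := {f | IsHoloAut ⇑f}

/-- Aut_{ω₀}(ℂⁿ) as a subset of C(ℂⁿ, ℂⁿ) with the compact-open topology. -/
def AutOmega (n : ℕ) : Set C(En n, En n) := {f | IsHoloAut ⇑f ∧ IsVolPres ⇑f}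

/-- A continuous self-map is chaotic if it has a dense forward orbit and its set of
periodic points is dense. -/
def Chaotic {α : Type*} [TopologicalSpace α] (f : α → α) : Prop :=
  (∃ x : α, Dense (Set.range fun k : ℕ => f^[k] x)) ∧
  Dense {x : α | ∃ k : ℕ, 0 < k ∧ f^[k] x = x}

/-- Expelling: the set of points with unbounded forward orbit is dense. -/
def Expelling {n : ℕ} (f : En n → En n) : Prop :=
  Dense {x : En n | ¬ Bornology.IsBounded (Set.range fun k : ℕ => f^[k] x)}

/-- p is a hyperbolic fixed point of f: f(p) = p and no eigenvalue of Df(p) has modulus 1. -/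
def HypFixedPt {n : ℕ} (f : En n → En n) (p : En n) : Prop :=
  f p = p ∧ ∀ μ : ℂ, Module.End.HasEigenvalue
    ((fderiv ℂ f p : En n →ₗ[ℂ] En n) : Module.End ℂ (En n)) μ → ‖μ‖ ≠ 1

/-- The stable manifold of a fixed point p of f: points whose forward orbit tends to p. -/
def StableSet {n : ℕ} (f : En n → En n) (p : En n) : Set (En n) :=
  {x : En n | Tendsto (fun k : ℕ => f^[k] x) atTop (𝓝 p)}

section basics
variable {E F : Type*} [NormedAddCommGroup E] [NormedSpace ℂ E] [NormedAddCommGroup F] [NormedSpace ℂ F]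

theorem cauchy_fderiv {f : E → F} (hf : Differentiable ℂ f) {c : E} {R M : ℝ} (hR : 0 < R)
    (hM : ∀ z ∈ ball c R, ‖f z‖ ≤ M) : ‖fderiv ℂ f c‖ ≤ 2 * M / R := by
  apply Complex.norm_fderiv_le_div_of_mapsTo_ball hf.differentiableOn _ hR
  intro z hz
  rw [mem_closedBall, dist_eq_norm]
  have h1 := hM z hz
  have h2 := hM c (mem_ball_self hR)
  have := norm_sub_le (f z) (f c)
  linarith

theorem cauchy_fderiv' {f : E → F} (hf : Differentiable ℂ f) {x0 : E} {R M d : ℝ} (hd : 0 < d)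
    (hM : ∀ z ∈ closedBall x0 R, ‖f z‖ ≤ M) {z : E} (hz : z ∈ closedBall x0 (R - d)) :
    ‖fderiv ℂ f z‖ ≤ 2 * M / d := by
  apply cauchy_fderiv hf hd
  intro w hw
  apply hM
  rw [mem_closedBall] at *
  rw [mem_ball] at hw
  have := dist_triangle w z x0
  linarith

theorem cauchy_lip {f : E → F} (hf : Differentiable ℂ f) {x0 : E} {R M d : ℝ} (hd : 0 < d)
    (hM : ∀ z ∈ closedBall x0 R, ‖f z‖ ≤ M) {z w : E} (hz : z ∈ closedBall x0 (R - d))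
    (hw : w ∈ closedBall x0 (R - d)) :
    ‖f w - f z‖ ≤ 2 * M / d * ‖w - z‖ := by
  let _ : NormedSpace ℝ E := NormedSpace.restrictScalars ℝ ℂ E
  apply Convex.norm_image_sub_le_of_norm_fderiv_le (𝕜 := ℂ) (s := closedBall x0 (R - d)) _ _
    (convex_closedBall x0 (R-d)) hz hw
  · intro x _
    exact hf x
  · intro x hx
    exact cauchy_fderiv' hf hd hM hx

theorem cauchy_fderiv_lip {f : E → F} (hf : Differentiable ℂ f) {x0 : E} {R M d : ℝ} (hd : 0 < d)
    (hM : ∀ z ∈ closedBall x0 R, ‖f z‖ ≤ M) {z w : E} (hz : z ∈ closedBall x0 (R - d))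
    (hw : w ∈ closedBall x0 (R - d)) :
    ‖fderiv ℂ f w - fderiv ℂ f z‖ ≤ 16 * M / d ^ 2 * ‖w - z‖ := by
  have hg : Differentiable ℂ (fun u => f (u + w) - f (u + z)) := by fun_prop
  have h1 : fderiv ℂ (fun u => f (u + w) - f (u + z)) 0 = fderiv ℂ f w - fderiv ℂ f z := by
    rw [fderiv_fun_sub (by fun_prop) (by fun_prop)]
    rw [fderiv_comp_add_right, fderiv_comp_add_right, zero_add, zero_add]
  rw [← h1]
  have h2 : (2:ℝ) * (2 * M / (d/2) * ‖w - z‖) / (d/2) = 16 * M / d ^ 2 * ‖w - z‖ := by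
    field_simp; ring
  rw [← h2]
  apply cauchy_fderiv hg (by linarith)
  intro u hu
  have := cauchy_lip (x0 := x0) (R := R) (M := M) (z := u + z) (w := u + w) hf (half_pos hd) hM ?_ ?_
  · simpa using this
  · rw [mem_closedBall, dist_eq_norm] at *
    rw [mem_ball, dist_zero_right] at hu
    calc ‖u + z - x0‖ = ‖u + (z - x0)‖ := by congr 1; abel
      _ ≤ _ := norm_add_le _ _
      _ ≤ _ := by linarith
  · rw [mem_closedBall, dist_eq_norm] at *
    rw [mem_ball, dist_zero_right] at hu
    calc ‖u + w - x0‖ = ‖u + (w - x0)‖ := by congr 1; abel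
      _ ≤ _ := norm_add_le _ _
      _ ≤ _ := by linarith

theorem cauchy_taylor {f : E → F} (hf : Differentiable ℂ f) {x0 : E} {R M d : ℝ} (hd : 0 < d)
    (hM : ∀ z ∈ closedBall x0 R, ‖f z‖ ≤ M) {z w : E} (hz : z ∈ closedBall x0 (R - d))
    (hw : w ∈ closedBall x0 (R - d)) :
    ‖f w - f z - fderiv ℂ f z (w - z)‖ ≤ 16 * M / d ^ 2 * ‖w - z‖ ^ 2 := by
  let _ : NormedSpace ℝ E := NormedSpace.restrictScalars ℝ ℂ E
  have hM0 : 0 ≤ M := by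
    have := hM z (closedBall_subset_closedBall (by linarith) hz)
    exact (norm_nonneg _).trans this
  have hseg : segment ℝ z w ⊆ closedBall x0 (R - d) := (convex_closedBall x0 (R-d)).segment_subset hz hw
  rw [pow_two ‖w - z‖, ← mul_assoc]
  apply Convex.norm_image_sub_le_of_norm_fderiv_le' (𝕜 := ℂ) (s := segment ℝ z w) _ _
    (convex_segment z w) (left_mem_segment ℝ z w) (right_mem_segment ℝ z w)
  · intro x _
    exact hf x
  · intro x hx
    have h1 := cauchy_fderiv_lip hf hd hM hz (hseg hx)
    have h2 : ‖x - z‖ ≤ ‖w - z‖ := by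
      obtain ⟨t, ht, rfl⟩ := (segment_eq_image' ℝ z w) ▸ hx
      simp only [add_sub_cancel_left, norm_smul, Real.norm_eq_abs, abs_of_nonneg ht.1]
      exact mul_le_of_le_one_left (norm_nonneg _) ht.2
    refine h1.trans ?_
    gcongr

end basics

section aut
variable {n : ℕ}

/-- volume preserving automorphism, as a predicate on functions -/
def VA (f : En n → En n) : Prop := IsHoloAut f ∧ IsVolPres f

theorem VA.diff {f : En n → En n} (hf : VA f) : Differentiable ℂ f := hf.1.1
theorem VA.cont {f : En n → En n} (hf : VA f) : Continuous f := hf.1.1.continuous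
theorem VA.inj {f : En n → En n} (hf : VA f) : Injective f := by
  obtain ⟨-, g, -, h1, h2⟩ := hf.1
  exact h1.injective
theorem VA.surj {f : En n → En n} (hf : VA f) : Surjective f := by
  obtain ⟨-, g, -, h1, h2⟩ := hf.1
  exact h2.surjective

theorem VA.id : VA (id : En n → En n) :=
  ⟨⟨differentiable_id, _root_.id, differentiable_id, fun _ => rfl, fun _ => rfl⟩, fun z => by
    rw [fderiv_id]; simp [ContinuousLinearMap.det]⟩

theorem VA.comp {f g : En n → En n} (hf : VA f) (hg : VA g) : VA (f ∘ g) := by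
  obtain ⟨⟨hf1, f', hf', hf2, hf3⟩, hf4⟩ := hf
  obtain ⟨⟨hg1, g', hg', hg2, hg3⟩, hg4⟩ := hg
  refine ⟨⟨hf1.comp hg1, g' ∘ f', hg'.comp hf', hf2.comp hg2, hf3.comp hg3⟩, fun z => ?_⟩
  rw [fderiv_comp z (hf1 _) (hg1 _)]
  have := hf4 (g z)
  have h2 := hg4 z
  simp only [ContinuousLinearMap.det, ContinuousLinearMap.toLinearMap_comp, LinearMap.det_comp] at *
  rw [this, h2, one_mul]

theorem VA.iter {f : En n → En n} (hf : VA f) (k : ℕ) : VA (f^[k]) := by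
  induction k with
  | zero => exact VA.id
  | succ k ih => rw [iterate_succ]; exact ih.comp hf

theorem VA.shear {F : ℂ → ℂ} (hF : Differentiable ℂ F) (l : En n →L[ℂ] ℂ) (v : En n) (h : l v = 0) :
    VA (fun z => z + F (l z) • v) := by
  have hd : ∀ F : ℂ → ℂ, Differentiable ℂ F → Differentiable ℂ (fun z : En n => z + F (l z) • v) := by
    intro F hF
    exact differentiable_id.add ((hF.comp l.differentiable).smul_const v)
  refine ⟨⟨hd F hF, fun z => z + (- F (l z)) • v, hd (fun w => - F w) hF.neg, ?_, ?_⟩, ?_⟩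
  · intro z; simp [h]
  · intro z; simp [h]
  · intro z
    have h1 : HasFDerivAt (fun z : En n => z + F (l z) • v)
        (ContinuousLinearMap.id ℂ _ + ((deriv F (l z)) • l).smulRight v) z := by
      apply (hasFDerivAt_id z).add
      have := (hF (l z)).hasDerivAt.comp_hasFDerivAt z l.hasFDerivAt
      exact this.smul_const v
    rw [h1.fderiv]
    have h2 : ((ContinuousLinearMap.id ℂ (En n) + ((deriv F (l z)) • l).smulRight v : En n →L[ℂ] En n) :
      En n →ₗ[ℂ] En n) = LinearMap.transvection (deriv F (l z) • l).toLinearMap v := by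
      ext x i; simp [LinearMap.transvection]
    rw [ContinuousLinearMap.det, h2, LinearMap.transvection.det]
    simp [h]

theorem det_isUnit (T : En n →L[ℂ] En n) (h : T.det = 1) : IsUnit T := by
  have h1 : IsUnit (LinearMap.det (T : En n →ₗ[ℂ] En n)) := by
    rw [show LinearMap.det (T : En n →ₗ[ℂ] En n) = 1 from h]; exact isUnit_one
  have h2 := (LinearMap.isUnit_iff_isUnit_det _).2 h1
  have hb := (Module.End.isUnit_iff _).1 h2
  let e := LinearEquiv.ofBijective (T : En n →ₗ[ℂ] En n) hb
  let e' := e.toContinuousLinearEquiv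
  refine ⟨⟨T, (e'.symm : En n →L[ℂ] En n), ?_, ?_⟩, rfl⟩
  · ext1 x; exact e.apply_symm_apply x
  · ext1 x; exact e.symm_apply_apply x

theorem inv_bound (n : ℕ) (C : ℝ) : ∃ K : ℝ, 0 < K ∧ ∀ S T : En n →L[ℂ] En n, T.det = 1 → ‖T‖ ≤ C →
    S * T = 1 → ‖S‖ ≤ K := by
  have hc : IsCompact {T : En n →L[ℂ] En n | ‖T‖ ≤ C ∧ T.det = 1} := by
    have : ProperSpace (En n →L[ℂ] En n) := FiniteDimensional.proper ℂ _
    have h1 : IsCompact (closedBall (0 : En n →L[ℂ] En n) C) := isCompact_closedBall 0 C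
    have h2 : IsClosed {T : En n →L[ℂ] En n | T.det = 1} :=
      isClosed_eq ContinuousLinearMap.continuous_det continuous_const
    convert h1.inter_right h2 using 1
    ext T; simp
  have hco : ContinuousOn (fun T : En n →L[ℂ] En n => Ring.inverse T)
      {T : En n →L[ℂ] En n | ‖T‖ ≤ C ∧ T.det = 1} := by
    intro T hT
    obtain ⟨u, hu⟩ := det_isUnit T hT.2
    rw [← hu]
    exact (NormedRing.inverse_continuousAt u).continuousWithinAt
  obtain ⟨K, hK⟩ := hc.exists_bound_of_continuousOn hco
  refine ⟨max K 1, by positivity, fun S T hT hT' hST => ?_⟩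
  have := hK T ⟨hT', hT⟩
  have h2 : Ring.inverse T = S := by
    obtain ⟨u, hu⟩ := det_isUnit T hT
    rw [← hu, Ring.inverse_unit]
    rw [← hu] at hST
    exact (Units.mul_eq_one_iff_eq_inv.1 hST).symm
  rw [h2] at this
  exact this.trans (le_max_left _ _)

/-- standard basis vector -/
abbrev eb (i : Fin n) : En n := EuclideanSpace.single i 1

theorem trace_bound (n : ℕ) : ∃ K : ℝ, 0 < K ∧ ∀ M : En n →L[ℂ] En n, (1 + M).det = 1 → ‖M‖ ≤ 1 / 2 →
    ‖∑ i, (M (eb i)) i‖ ≤ K * ‖M‖ ^ 2 := by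
  have : ProperSpace (En n →L[ℂ] En n) := FiniteDimensional.proper ℂ _
  obtain ⟨K, hK⟩ := (isCompact_closedBall (0 : En n →L[ℂ] En n) 2).exists_bound_of_continuousOn
    (f := fun T => T.det) ContinuousLinearMap.continuous_det.continuousOn
  refine ⟨max (16 * K / (1/2) ^ 2) 1, by positivity, fun M hM hM2 => ?_⟩
  by_cases hM0 : M = 0
  · simp [hM0]
  have hMp : 0 < ‖M‖ := norm_pos_iff.2 hM0
  let N : En n →L[ℂ] En n := ((‖M‖ : ℂ)⁻¹) • M
  have hN : ‖N‖ = 1 := by simp [N, norm_smul, hMp.ne']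
  have hMN : M = (‖M‖ : ℂ) • N := by simp [N, smul_smul, hM0]
  let b := (EuclideanSpace.basisFun (Fin n) ℂ).toBasis
  let A := LinearMap.toMatrix b b (N : En n →ₗ[ℂ] En n)
  let φ : ℂ → ℂ := fun r => (1 + r • N).det
  have hφ : ∀ r, φ r = 1 + A.trace * r +
      (Matrix.det (1 + (Polynomial.X : Polynomial ℂ) • A.map Polynomial.C)).divX.divX.eval r * r ^ 2 := by
    intro r
    rw [← Matrix.det_one_add_smul]
    simp only [φ, ContinuousLinearMap.det]
    rw [← LinearMap.det_toMatrix b]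
    congr 1
    ext i j
    simp [A, LinearMap.toMatrix_apply, Matrix.one_apply, b]
  have hφd : Differentiable ℂ φ := by
    rw [show φ = _ from funext hφ]
    have := Polynomial.differentiable (Matrix.det (1 + (Polynomial.X : Polynomial ℂ) • A.map Polynomial.C)).divX.divX
    fun_prop
  have hφ' : fderiv ℂ φ 0 (‖M‖ : ℂ) = A.trace * ‖M‖ := by
    have : HasDerivAt φ A.trace 0 := by
      rw [show φ = _ from funext hφ]
      have h3 := (Matrix.det (1 + (Polynomial.X : Polynomial ℂ) • A.map Polynomial.C)).divX.divX.hasDerivAt 0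
      have h4 := (((hasDerivAt_id (0:ℂ)).const_mul A.trace).const_add 1).add
        (h3.mul ((hasDerivAt_id (0:ℂ)).pow 2))
      refine HasDerivAt.congr_deriv h4 ?_
      simp
    rw [this.hasFDerivAt.fderiv]; simp [mul_comm]
  have htr : (∑ i, (M (eb i)) i) = A.trace * ‖M‖ := by
    rw [Matrix.trace, Finset.sum_mul]
    refine Finset.sum_congr rfl fun i _ => ?_
    conv_lhs => rw [hMN]
    simp [A, LinearMap.toMatrix_apply, b, mul_comm]
  have hφM : φ ‖M‖ = 1 := by
    simp only [φ]; rw [← hMN, hM]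
  have hφ0 : φ 0 = 1 := by rw [hφ]; simp
  have := cauchy_taylor hφd (x0 := 0) (R := 1) (M := K) (d := 1/2) (by norm_num) ?_ (z := 0) (w := ‖M‖) ?_ ?_
  · rw [hφM, hφ0, sub_zero, hφ', ← htr] at this
    simp only [sub_self, zero_sub, norm_neg, Complex.norm_real, norm_norm] at this
    exact this.trans (by gcongr; exact le_max_left _ _)
  · intro z hz
    apply hK
    rw [mem_closedBall, dist_zero_right] at *
    calc ‖1 + z • N‖ ≤ ‖(1 : En n →L[ℂ] En n)‖ + ‖z • N‖ := norm_add_le _ _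
      _ ≤ 1 + 1 := by
        rw [norm_smul, hN, mul_one]
        gcongr
        exact ContinuousLinearMap.norm_id_le
      _ = 2 := by norm_num
  · simp; norm_num
  · simp; linarith
end aut

section top
variable {n : ℕ}

theorem nhds_of_unif (f : AutOmega n) (U : Set (AutOmega n)) (hU : U ∈ 𝓝 f) :
    ∃ R ε : ℝ, 0 < R ∧ 0 < ε ∧ ∀ g : AutOmega n, (∀ z ∈ closedBall (0 : En n) R, ‖g.1 z - f.1 z‖ ≤ ε) → g ∈ U := by
  rw [nhds_induced, mem_comap] at hU
  obtain ⟨V, hV, hVU⟩ := hU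
  rw [UniformSpace.mem_nhds_iff] at hV
  obtain ⟨X, hX, hXV⟩ := hV
  obtain ⟨K, V', hK, hV', h⟩ := (ContinuousMap.mem_compactConvergence_entourage_iff X).1 hX
  obtain ⟨ε, hε, hε'⟩ := Metric.mem_uniformity_dist.1 hV'
  obtain ⟨R, hR⟩ := hK.isBounded.subset_closedBall 0
  refine ⟨max R 1, ε / 2, by positivity, by positivity, fun g hg => ?_⟩
  apply hVU
  apply hXV
  apply h
  intro x hx
  apply hε'
  rw [dist_comm, dist_eq_norm]
  have := hg x (closedBall_subset_closedBall (le_max_left _ _) (hR hx))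
  linarith

theorem unif_isOpen (F : En n → En n) (hF : Continuous F) (K : Set (En n)) (hK : IsCompact K) (ε : ℝ) :
    IsOpen {g : AutOmega n | ∀ z ∈ K, ‖g.1 z - F z‖ < ε} := by
  rw [isOpen_iff_mem_nhds]
  intro g hg
  rcases K.eq_empty_or_nonempty with rfl | hne
  · simp
  obtain ⟨z0, hz0, hmax⟩ := hK.exists_isMaxOn hne (f := fun z => ‖g.1 z - F z‖)
    (by have := g.1.continuous; fun_prop)
  have h1 := hg z0 hz0
  have h2 := (ContinuousMap.tendsto_iff_forall_isCompact_tendstoUniformlyOn (f := g.1) (p := 𝓝 g)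
    (F := fun g : AutOmega n => g.1)).1 continuous_subtype_val.continuousAt K hK
  rw [Metric.tendstoUniformlyOn_iff] at h2
  filter_upwards [h2 (ε - ‖g.1 z0 - F z0‖) (by linarith)] with g' hg' z hz
  have h3 := hg' z hz
  have h4 : ‖g.1 z - F z‖ ≤ ‖g.1 z0 - F z0‖ := hmax hz
  rw [dist_comm, dist_eq_norm] at h3
  calc ‖g'.1 z - F z‖ = ‖(g'.1 z - g.1 z) + (g.1 z - F z)‖ := by congr 1; abel
    _ ≤ _ := norm_add_le _ _
    _ < _ := by linarith

def VA.toAut {f : En n → En n} (hf : VA f) : AutOmega n := ⟨⟨f, hf.cont⟩, hf⟩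
theorem AutVA (f : AutOmega n) : VA (f.1 : En n → En n) := f.2

end top

section interp

/-- roots of unity interpolation -/
def interpM (M : ℕ) (ρ : ℝ) (q : ℂ → ℂ) (w : ℂ) : ℂ :=
  ∑ j ∈ Finset.range M, (w / ρ) ^ j * ((M : ℂ)⁻¹ * ∑ i ∈ Finset.range M,
    ((Complex.exp (2 * Real.pi * Complex.I / M))⁻¹) ^ (i * j) * q (ρ * (Complex.exp (2 * Real.pi * Complex.I / M)) ^ i))

theorem interp_pow (M : ℕ) (hM : 0 < M) (ρ : ℝ) (hρ : 0 < ρ) (k : ℕ) (w : ℂ) :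
    interpM M ρ (fun z => z ^ k) w = (w / ρ) ^ (k % M) * ρ ^ k := by
  have hprim := Complex.isPrimitiveRoot_exp M hM.ne'
  unfold interpM
  set ω := Complex.exp (2 * Real.pi * Complex.I / M) with hω
  have hω0 : ω ≠ 0 := Complex.exp_ne_zero _
  have hM0 : (M : ℂ) ≠ 0 := by exact_mod_cast hM.ne'
  rw [Finset.sum_eq_single (k % M)]
  · congr 1
    have : ∀ i ∈ Finset.range M, (ω⁻¹) ^ (i * (k % M)) * ((ρ : ℂ) * ω ^ i) ^ k = ρ ^ k := by
      intro i _
      have h1 : ω ^ (k % M) = ω ^ k := by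
        conv_rhs => rw [← Nat.div_add_mod k M, pow_add, pow_mul, hprim.pow_eq_one, one_pow, one_mul]
      rw [mul_comm i, pow_mul, inv_pow, h1, mul_pow, ← pow_mul, inv_pow, ← pow_mul, mul_comm i k]
      field_simp
    rw [Finset.sum_congr rfl this]
    simp
    field_simp
  · intro j hj hjk
    have hx : ∀ i ∈ Finset.range M, (ω⁻¹) ^ (i * j) * ((ρ : ℂ) * ω ^ i) ^ k = ρ ^ k * (ω ^ k * (ω⁻¹) ^ j) ^ i := by
      intro i _
      rw [mul_pow, mul_pow, ← pow_mul, ← pow_mul, ← pow_mul, mul_comm i j, mul_comm i k]; ring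
    rw [Finset.sum_congr rfl hx, ← Finset.mul_sum]
    have hx1 : ω ^ k * (ω⁻¹) ^ j ≠ 1 := by
      intro h
      apply hjk
      rw [inv_pow] at h
      have h2 : ω ^ k = ω ^ j := by
        rw [mul_inv_eq_one₀ (pow_ne_zero _ hω0)] at h; exact h
      have h1 : ω ^ (k % M) = ω ^ k := by
        conv_rhs => rw [← Nat.div_add_mod k M, pow_add, pow_mul, hprim.pow_eq_one, one_pow, one_mul]
      exact hprim.pow_inj (Finset.mem_range.1 hj) (Nat.mod_lt k hM) (by rw [h1, h2])
    have hxM : (ω ^ k * (ω⁻¹) ^ j) ^ M = 1 := by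
      rw [mul_pow, ← pow_mul, ← pow_mul, mul_comm k, mul_comm j, pow_mul, pow_mul, inv_pow, hprim.pow_eq_one]
      simp
    have h4 := geom_sum_eq hx1 M
    rw [hxM] at h4
    rw [h4]; simp
  · intro h
    exact absurd (Finset.mem_range.2 (Nat.mod_lt k hM)) h

theorem interp_err (M : ℕ) (hM : 0 < M) (ρ : ℝ) (hρ : 0 < ρ) (q : ℂ → ℂ) (hq : Differentiable ℂ q) (S : ℝ)
    (hS : ∀ w, ‖w‖ ≤ 2 * ρ → ‖q w‖ ≤ S) (w : ℂ) (hw : ‖w‖ ≤ ρ) :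
    ‖q w - interpM M ρ q w‖ ≤ 4 * S * (1/2) ^ M := by
  let b : ℕ → ℂ := fun k => (k.factorial : ℂ)⁻¹ * iteratedDeriv k q 0
  have hsum : ∀ z, HasSum (fun k => b k * z ^ k) (q z) := by
    intro z
    have := Complex.hasSum_taylorSeries_of_entire hq 0 z
    simpa [b, mul_comm, mul_assoc, mul_left_comm] using this
  have hb : ∀ k, ‖b k‖ ≤ S / (2 * ρ) ^ k := by
    intro k
    have := Complex.norm_iteratedDeriv_le_of_forall_mem_sphere_norm_le (c := 0) (R := 2 * ρ) (C := S) (f := q) k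
      (by positivity) hq.diffContOnCl (by
        intro z hz
        apply hS
        rw [mem_sphere, dist_zero_right] at hz; exact hz.le)
    simp only [b, norm_mul, norm_inv, Complex.norm_natCast]
    rw [inv_mul_le_iff₀ (by positivity)]
    calc _ ≤ _ := this
      _ = _ := by ring
  have hS0 : 0 ≤ S := (norm_nonneg _).trans (hS 0 (by simp; positivity))
  have hI : HasSum (fun k => b k * interpM M ρ (fun z => z ^ k) w) (interpM M ρ q w) := by
    unfold interpM
    have : (fun k => b k * ∑ j ∈ Finset.range M, (w / ρ) ^ j * ((M : ℂ)⁻¹ * ∑ i ∈ Finset.range M,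
    ((Complex.exp (2 * Real.pi * Complex.I / M))⁻¹) ^ (i * j) * (ρ * (Complex.exp (2 * Real.pi * Complex.I / M)) ^ i) ^ k))
     = (fun k => ∑ j ∈ Finset.range M, (w / ρ) ^ j * ((M : ℂ)⁻¹ * ∑ i ∈ Finset.range M,
    ((Complex.exp (2 * Real.pi * Complex.I / M))⁻¹) ^ (i * j) * (b k * (ρ * (Complex.exp (2 * Real.pi * Complex.I / M)) ^ i) ^ k))) := by
      ext k
      simp only [Finset.mul_sum]
      refine Finset.sum_congr rfl fun j _ => Finset.sum_congr rfl fun i _ => by ring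
    rw [this]
    apply hasSum_sum
    intro j _
    apply HasSum.mul_left
    apply HasSum.mul_left
    apply hasSum_sum
    intro i _
    apply HasSum.mul_left
    exact hsum _
  have hD := (hsum w).sub hI
  have hbd : ∀ k, ‖b k * w ^ k - b k * interpM M ρ (fun z => z ^ k) w‖ ≤ if k < M then 0 else 2 * S * (1/2) ^ k := by
    intro k
    rw [interp_pow M hM ρ hρ, ← mul_sub, norm_mul]
    have hρ' : (ρ : ℂ) ≠ 0 := by exact_mod_cast hρ.ne'
    split_ifs with h
    · rw [Nat.mod_eq_of_lt h, div_pow, div_mul_cancel₀ _ (pow_ne_zero _ hρ')]; simp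
    · have h1 : ‖w ^ k - (w / ρ) ^ (k % M) * ρ ^ k‖ ≤ 2 * ρ ^ k := by
        have h2 : ‖w ^ k‖ ≤ ρ ^ k := by rw [norm_pow]; gcongr
        have h3 : ‖(w / ρ) ^ (k % M) * (ρ:ℂ) ^ k‖ ≤ ρ ^ k := by
          rw [norm_mul, norm_pow, norm_pow, norm_div, Complex.norm_real, Real.norm_eq_abs, abs_of_pos hρ]
          have : (‖w‖ / ρ) ^ (k % M) ≤ 1 := pow_le_one₀ (by positivity) ((div_le_one hρ).2 hw)
          exact mul_le_of_le_one_left (by positivity) this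
        calc _ ≤ _ := norm_sub_le _ _
          _ ≤ _ := by linarith
      calc _ ≤ (S / (2 * ρ) ^ k) * (2 * ρ ^ k) := by
            gcongr; exact hb k
        _ = _ := by rw [mul_pow, one_div, inv_pow]; field_simp
  have hg : HasSum (fun k => if k < M then 0 else 2 * S * (1/2 : ℝ) ^ k) (4 * S * (1/2) ^ M) := by
    rw [← hasSum_nat_add_iff' M]
    have h0 : ∑ i ∈ Finset.range M, (if i < M then (0:ℝ) else 2 * S * (1/2 : ℝ) ^ i) = 0 := by
      apply Finset.sum_eq_zero
      intro i hi
      simp [Finset.mem_range.1 hi]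
    rw [h0, sub_zero]
    have := (hasSum_geometric_two).mul_left (2 * S * (1/2:ℝ) ^ M)
    have e : (fun k => if k + M < M then 0 else 2 * S * (1/2 : ℝ) ^ (k + M)) =
        fun i => 2 * S * (1/2:ℝ) ^ M * (1/2) ^ i := by
      ext k
      rw [if_neg (by omega), pow_add]; ring
    rw [e, show 4 * S * (1/2) ^ M = 2 * S * (1/2:ℝ) ^ M * 2 by ring]
    exact this
  rw [← hD.tsum_eq]
  exact tsum_of_norm_bounded hg hbd

end interp

section dens
variable {n : ℕ}

def expo (l : En n →L[ℂ] ℂ) : C(En n, ℂ) := ⟨fun z => Complex.exp (l z), by fun_prop⟩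

def expAlg (n : ℕ) : Subalgebra ℂ C(En n, ℂ) := Algebra.adjoin ℂ (range expo)

theorem expAlg_span : Subalgebra.toSubmodule (expAlg n) = Submodule.span ℂ (range expo) := by
  unfold expAlg
  rw [Algebra.adjoin_eq_span]
  congr 1
  have : range (expo (n := n)) = ((⟨⟨range expo, by
    rintro _ _ ⟨a, rfl⟩ ⟨b, rfl⟩
    refine ⟨a + b, ?_⟩
    ext z
    simp [expo, Complex.exp_add]⟩, ⟨0, by ext z; simp [expo]⟩⟩ : Submonoid C(En n, ℂ)) : Set _) := rfl
  rw [this, Submonoid.closure_eq]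

theorem nhds_of_unif' (f : C(En n, ℂ)) (U : Set C(En n, ℂ)) (hV : U ∈ 𝓝 f) :
    ∃ R ε : ℝ, 0 < R ∧ 0 < ε ∧ ∀ g : C(En n, ℂ), (∀ z ∈ closedBall (0 : En n) R, ‖g z - f z‖ ≤ ε) → g ∈ U := by
  rw [UniformSpace.mem_nhds_iff] at hV
  obtain ⟨X, hX, hXV⟩ := hV
  obtain ⟨K, V', hK, hV', h⟩ := (ContinuousMap.mem_compactConvergence_entourage_iff X).1 hX
  obtain ⟨ε, hε, hε'⟩ := Metric.mem_uniformity_dist.1 hV'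
  obtain ⟨R, hR⟩ := hK.isBounded.subset_closedBall 0
  refine ⟨max R 1, ε / 2, by positivity, by positivity, fun g hg => ?_⟩
  apply hXV
  apply h
  intro x hx
  apply hε'
  rw [dist_comm, dist_eq_norm]
  have := hg x (closedBall_subset_closedBall (le_max_left _ _) (hR hx))
  linarith

theorem mem_clos (s : Set C(En n, ℂ)) (f : C(En n, ℂ)) (h : ∀ R ε : ℝ, 0 < R → 0 < ε → ∃ g ∈ s,
    ∀ z ∈ closedBall (0 : En n) R, ‖g z - f z‖ ≤ ε) : f ∈ closure s := by
  rw [mem_closure_iff_nhds]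
  intro U hU
  obtain ⟨R, ε, hR, hε, hU'⟩ := nhds_of_unif' f U hU
  obtain ⟨g, hg, hg'⟩ := h R ε hR hε
  exact ⟨g, hU' g hg', hg⟩

theorem of_mem_clos (s : Set C(En n, ℂ)) (f : C(En n, ℂ)) (h : f ∈ closure s) (R ε : ℝ) (hε : 0 < ε) : ∃ g ∈ s,
    ∀ z ∈ closedBall (0 : En n) R, ‖g z - f z‖ ≤ ε := by
  rw [mem_closure_iff_nhds] at h
  have h2 := (ContinuousMap.tendsto_iff_forall_isCompact_tendstoUniformlyOn (f := f) (p := 𝓝 f)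
    (F := fun g : C(En n, ℂ) => g)).1 tendsto_id (closedBall 0 R) (isCompact_closedBall 0 R)
  rw [Metric.tendstoUniformlyOn_iff] at h2
  obtain ⟨g, hg, hgs⟩ := h _ (h2 ε hε)
  refine ⟨g, hgs, fun z hz => ?_⟩
  rw [← dist_eq_norm, dist_comm]
  exact (hg z hz).le

/-- the coordinate function -/
def coordC (a : Fin n) : C(En n, ℂ) := ⟨fun z => z a, by fun_prop⟩

theorem coord_mem (a : Fin n) : coordC a ∈ (expAlg n).topologicalClosure := by
  rw [← SetLike.mem_coe, Subalgebra.topologicalClosure_coe]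
  apply mem_clos
  intro R ε hR hε
  obtain ⟨t, ht0, ht1, ht2⟩ : ∃ t : ℝ, 0 < t ∧ t * R ≤ 1 ∧ t * R ^ 2 ≤ ε := by
    refine ⟨min (1 / R) (ε / R ^ 2), by positivity, ?_, ?_⟩
    · calc _ ≤ (1 / R) * R := by gcongr; exact min_le_left _ _
        _ = 1 := by field_simp
    · calc _ ≤ (ε / R ^ 2) * R ^ 2 := by gcongr; exact min_le_right _ _
        _ = ε := by field_simp
  refine ⟨(t : ℂ)⁻¹ • (expo ((t : ℂ) • (EuclideanSpace.proj a : En n →L[ℂ] ℂ)) - 1), ?_, ?_⟩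
  · apply Subalgebra.smul_mem
    apply Subalgebra.sub_mem _ _ (Subalgebra.one_mem _)
    exact Algebra.subset_adjoin ⟨_, rfl⟩
  · intro z hz
    rw [mem_closedBall, dist_zero_right] at hz
    have hza : ‖z a‖ ≤ R := (PiLp.norm_apply_le z a).trans hz
    have ht0' : (t : ℂ) ≠ 0 := by exact_mod_cast ht0.ne'
    have htn : ‖(t : ℂ)‖ = t := by simp [abs_of_pos ht0]
    have h1 : ‖(t : ℂ) * z a‖ ≤ 1 := by
      rw [norm_mul, htn]
      exact (by gcongr : t * ‖z a‖ ≤ t * R).trans ht1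
    have h2 := Complex.norm_exp_sub_one_sub_id_le h1
    have h3 : ((t : ℂ)⁻¹ • (expo ((t : ℂ) • (EuclideanSpace.proj a : En n →L[ℂ] ℂ)) - 1)) z - coordC a z
       = (t:ℂ)⁻¹ * (Complex.exp (t * z a) - 1 - t * z a) := by
      simp [expo, coordC]; field_simp
    rw [h3, norm_mul, norm_inv, htn, inv_mul_le_iff₀ ht0]
    refine h2.trans ?_
    rw [norm_mul, htn]
    calc (t * ‖z a‖) ^ 2 ≤ (t * R) ^ 2 := by gcongr
      _ = t * (t * R ^ 2) := by ring
      _ ≤ _ := by gcongr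

open Classical in
/-- zero out the coordinates outside S -/
def piS (S : Finset (Fin n)) (z : En n) : En n := ∑ a ∈ S, z a • eb a

theorem piS_diff (S : Finset (Fin n)) : Differentiable ℂ (piS S) := by
  unfold piS; fun_prop

theorem piS_univ (z : En n) : piS Finset.univ z = z := by
  unfold piS
  ext i
  simp [Finset.sum_apply, Pi.single_apply]

open Classical in
theorem exp_dense_aux (S : Finset (Fin n)) : ∀ (Q : En n → ℂ) (hQ : Differentiable ℂ Q),
    (⟨fun z => Q (piS S z), (hQ.comp (piS_diff S)).continuous⟩ : C(En n, ℂ)) ∈ (expAlg n).topologicalClosure := by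
  induction S using Finset.induction_on with
  | empty =>
    intro Q hQ
    have : (⟨fun z => Q (piS ∅ z), (hQ.comp (piS_diff ∅)).continuous⟩ : C(En n, ℂ)) = algebraMap ℂ _ (Q 0) := by
      ext z; simp [piS]
    rw [this]
    exact Subalgebra.algebraMap_mem _ _
  | insert a S ha ih =>
    intro Q hQ
    have hcl : ∀ f : C(En n, ℂ), f ∈ closure ((expAlg n).topologicalClosure : Set C(En n, ℂ)) →
        f ∈ (expAlg n).topologicalClosure := by
      intro f hf
      rwa [(Subalgebra.isClosed_topologicalClosure _).closure_eq] at hf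
    apply hcl
    apply mem_clos
    intro R ε hR hε
    have hins : ∀ z, piS (insert a S) z = piS S z + z a • eb a := by
      intro z; unfold piS; rw [Finset.sum_insert ha, add_comm]
    -- bound on Q
    have hcomp : IsCompact ((fun p : En n × ℂ => piS S p.1 + p.2 • eb a) '' (closedBall (0 : En n) R ×ˢ closedBall (0:ℂ) (2 * R))) := by
      apply ((isCompact_closedBall _ _).prod (isCompact_closedBall _ _)).image
      have := (piS_diff S).continuous
      fun_prop
    obtain ⟨B, hB⟩ := hcomp.exists_bound_of_continuousOn hQ.continuous.continuousOn
    have hlim : Tendsto (fun M : ℕ => 4 * B * (1/2 : ℝ) ^ M) atTop (𝓝 (4 * B * 0)) :=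
      (tendsto_pow_atTop_nhds_zero_of_lt_one (by norm_num) (by norm_num)).const_mul _
    rw [mul_zero] at hlim
    obtain ⟨M, hM1, hM2⟩ := ((hlim.eventually_le_const hε).and (eventually_gt_atTop 0)).exists
    let G : ℂ → C(En n, ℂ) := fun x => ⟨fun z => Q (piS S z + x • eb a),
      by have := (piS_diff S).continuous; have := hQ.continuous; fun_prop⟩
    have hG : ∀ x, G x ∈ (expAlg n).topologicalClosure := fun x =>
      ih (fun z => Q (z + x • eb a)) (by fun_prop)
    refine ⟨∑ j ∈ Finset.range M, (((R : ℂ)⁻¹) • coordC a) ^ j * ((M : ℂ)⁻¹ • ∑ i ∈ Finset.range M,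
      (((Complex.exp (2 * Real.pi * Complex.I / M))⁻¹) ^ (i * j)) •
        G (R * (Complex.exp (2 * Real.pi * Complex.I / M)) ^ i)), ?_, ?_⟩
    · apply Subalgebra.sum_mem
      intro j _
      apply Subalgebra.mul_mem
      · apply Subalgebra.pow_mem
        apply Subalgebra.smul_mem
        exact coord_mem a
      · apply Subalgebra.smul_mem
        apply Subalgebra.sum_mem
        intro i _
        apply Subalgebra.smul_mem
        exact hG _
    · intro z hz
      have hz' := hz
      rw [mem_closedBall, dist_zero_right] at hz
      have hza : ‖z a‖ ≤ R := (PiLp.norm_apply_le z a).trans hz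
      have := interp_err M hM2 R hR (fun x => Q (piS S z + x • eb a)) (by fun_prop) B (by
        intro w hw
        apply hB
        exact ⟨(z, w), ⟨hz', by simpa using hw⟩, rfl⟩) (z a) hza
      rw [norm_sub_rev]
      refine le_trans (le_of_eq ?_) (this.trans hM1)
      congr 2
      · simp [hins]
      · simp [interpM, G, coordC, div_eq_inv_mul, ContinuousMap.sum_apply]

theorem exp_dense (Q : En n → ℂ) (hQ : Differentiable ℂ Q) (R ε : ℝ) (hε : 0 < ε) :
    ∃ q ∈ Submodule.span ℂ (range (expo (n := n))), ∀ z ∈ closedBall (0 : En n) R, ‖q z - Q z‖ ≤ ε := by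
  have h := exp_dense_aux Finset.univ Q hQ
  rw [← SetLike.mem_coe, Subalgebra.topologicalClosure_coe] at h
  obtain ⟨q, hq, hq'⟩ := of_mem_clos _ _ h R ε hε
  refine ⟨q, ?_, ?_⟩
  · rw [← expAlg_span]; exact hq
  · intro z hz
    simpa [piS_univ] using hq' z hz
end dens

section ctx
variable {n : ℕ}

/-- derivative of the iterate -/
def Td (f : En n → En n) (l : ℕ) (x : En n) : En n →L[ℂ] En n := fderiv ℂ (f^[l]) x
/-- inverse of the derivative of the iterate -/
def Sd (f g : En n → En n) (l : ℕ) (x : En n) : En n →L[ℂ] En n := fderiv ℂ (g^[l]) (f^[l] x)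

structure BdCtx (f g : En n → En n) (x0 : En n) (s R C : ℝ) : Prop where
  hf : VA f
  hg : Differentiable ℂ g
  hgf : LeftInverse g f
  hfg : Function.RightInverse g f
  hs : 0 < s
  hs1 : s ≤ 1
  hC : 1 ≤ C
  hR : 0 ≤ R
  b0 : ∀ l, ∀ z ∈ closedBall x0 (3 * s), ‖f^[l] z‖ ≤ R
  b1 : ∀ l, ∀ z ∈ closedBall x0 (3 * s), ‖Td f l z‖ ≤ C
  b2 : ∀ l, ∀ z ∈ closedBall x0 (3 * s), ∀ w ∈ closedBall x0 (3 * s), ‖Td f l w - Td f l z‖ ≤ C * ‖w - z‖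
  b3 : ∀ l, ∀ z ∈ closedBall x0 (3 * s), ∀ w ∈ closedBall x0 (3 * s),
    ‖f^[l] w - f^[l] z - Td f l z (w - z)‖ ≤ C * ‖w - z‖ ^ 2
  b4 : ∀ l, ∀ z ∈ closedBall x0 (3 * s), ‖Sd f g l z‖ ≤ C

theorem Td_add {f : En n → En n} (hf : Differentiable ℂ f) (k l : ℕ) (x : En n) :
    Td f (k + l) x = (Td f k (f^[l] x)).comp (Td f l x) := by
  unfold Td
  rw [iterate_add, fderiv_comp x (hf.iterate k _) (hf.iterate l _)]

theorem Sd_Td {f g : En n → En n} (hf : Differentiable ℂ f) (hg : Differentiable ℂ g)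
    (hgf : LeftInverse g f) (l : ℕ) (x : En n) : (Sd f g l x) * (Td f l x) = 1 := by
  unfold Sd Td
  have h := fderiv_comp x (hg.iterate l (f^[l] x)) (hf.iterate l x)
  rw [(hgf.iterate l).comp_eq_id, fderiv_id] at h
  exact h.symm

theorem Td_Sd {f g : En n → En n} (hf : Differentiable ℂ f) (hg : Differentiable ℂ g)
    (hgf : LeftInverse g f) (hfg : Function.RightInverse g f) (l : ℕ) (x : En n) : (Td f l x) * (Sd f g l x) = 1 := by
  unfold Sd Td
  have h1 : g^[l] (f^[l] x) = x := hgf.iterate l x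
  have h := fderiv_comp (f^[l] x) (hf.iterate l (g^[l] (f^[l] x))) (hg.iterate l (f^[l] x))
  have h2 : f^[l] ∘ g^[l] = id := (LeftInverse.iterate (f := g) (g := f) hfg l).comp_eq_id
  rw [h2, fderiv_id, h1] at h
  exact h.symm

theorem mkCtx {f : En n → En n} (hf : VA f) {x0 : En n} {r R : ℝ} (hr : 0 < r)
    (hb : ∀ l, ∀ z ∈ ball x0 r, ‖f^[l] z‖ ≤ R) :
    ∃ g s C, BdCtx f g x0 s R C ∧ 4 * s < r := by
  obtain ⟨g, hg, hgf, hfg⟩ := hf.1.2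
  let s := min 1 (r / 8)
  have hs : 0 < s := by positivity
  have hs1 : s ≤ 1 := min_le_left _ _
  have hs2 : s ≤ r / 8 := min_le_right _ _
  have hR : 0 ≤ R := (norm_nonneg _).trans (hb 0 x0 (mem_ball_self hr))
  have hb' : ∀ l, ∀ z ∈ closedBall x0 (4 * s), ‖f^[l] z‖ ≤ R := fun l z hz =>
    hb l z (closedBall_subset_ball (by linarith) hz)
  have h34 : 3 * s = 4 * s - s := by ring
  obtain ⟨K, hK, hK'⟩ := inv_bound n (2 * R / s)
  have hd : ∀ l, Differentiable ℂ f^[l] := fun l => hf.diff.iterate l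
  refine ⟨g, s, max 1 (max K (max (2 * R / s) (16 * R / s ^ 2))), ⟨hf, hg, hgf, hfg, hs, hs1,
    le_max_left _ _, hR, ?_, ?_, ?_, ?_, ?_⟩, by linarith⟩
  · intro l z hz
    exact hb' l z (closedBall_subset_closedBall (by linarith) hz)
  · intro l z hz
    rw [h34] at hz
    exact (cauchy_fderiv' (hd l) hs (hb' l) hz).trans (by simp)
  · intro l z hz w hw
    rw [h34] at hz hw
    refine (cauchy_fderiv_lip (hd l) hs (hb' l) hz hw).trans ?_
    gcongr; simp
  · intro l z hz w hw
    rw [h34] at hz hw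
    refine (cauchy_taylor (hd l) hs (hb' l) hz hw).trans ?_
    gcongr; simp
  · intro l z hz
    rw [h34] at hz
    refine (hK' (Sd f g l z) (Td f l z) ((hf.iter l).2 z) (cauchy_fderiv' (hd l) hs (hb' l) hz)
      (Sd_Td hf.diff hg hgf l z)).trans ?_
    simp

end ctx

section avg
variable {n : ℕ} {f g : En n → En n} {x0 : En n} {s R C : ℝ}

def Persist (f : En n → En n) (x0 : En n) (s R : ℝ) : Prop := ∃ ε > 0, ∀ g : En n → En n, VA g →
  (∀ z ∈ closedBall (0 : En n) R, ‖g z - f z‖ ≤ ε) → ∀ x ∈ closedBall x0 (3 * s), ∀ m, ‖g^[m] x‖ ≤ R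

theorem avg_exp (h : BdCtx f g x0 s R C) (hp : Persist f x0 s R) {x : En n}
    (hx : x ∈ closedBall x0 (3 * s)) (l : En n →L[ℂ] ℂ) (v : En n) (hv : l v = 0) :
    ∃ K : ℝ, ∀ m, ‖∑ j ∈ Finset.range m, Sd f g j x (Complex.exp (l (f^[j] x)) • v)‖ ≤ K := by
  obtain ⟨ε, hε, hp⟩ := hp
  let G : ℂ → En n → En n := fun t z => f (z + (t * Complex.exp (l z)) • v)
  have hfc := h.hf.cont
  have hfd := h.hf.diff
  have hG : ∀ t, VA (G t) := fun t =>
    h.hf.comp (VA.shear (F := fun w => t * Complex.exp w) (by fun_prop) l v hv)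
  have hev : ∀ᶠ t in 𝓝 (0:ℂ), ∀ z ∈ closedBall (0 : En n) R, ‖G t z - f z‖ < ε := by
    apply (isCompact_closedBall (0 : En n) R).eventually_forall_of_forall_eventually
    intro z hz
    have hc : Continuous (fun p : ℂ × En n => ‖G p.1 p.2 - f p.2‖) := by
      simp only [G]; fun_prop
    apply hc.continuousAt.eventually_lt continuousAt_const
    simpa [G] using hε
  obtain ⟨t0, ht0, hball⟩ := Metric.eventually_nhds_iff_ball.1 hev
  have hbd : ∀ m, ∀ t ∈ ball (0:ℂ) t0, ‖(G t)^[m] x‖ ≤ R := fun m t ht =>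
    hp (G t) (hG t) (fun z hz => (hball t ht z hz).le) x hx m
  have hdiff : ∀ m, Differentiable ℂ (fun t => (G t)^[m] x) := by
    intro m
    induction m with
    | zero => simp
    | succ m ih =>
      simp only [iterate_succ_apply', G] at *
      fun_prop
  have hderiv : ∀ m, HasDerivAt (fun t => (G t)^[m] x)
      (Td f m x (∑ j ∈ Finset.range m, Sd f g j x (Complex.exp (l (f^[j] x)) • v))) 0 := by
    intro m
    induction m with
    | zero => simpa using hasDerivAt_const (0:ℂ) x
    | succ m ih =>
      have h0 : (G 0)^[m] x = f^[m] x := by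
        have : G 0 = f := by funext z; simp [G]
        rw [this]
      have h1 : HasDerivAt (fun t : ℂ => (t * Complex.exp (l ((G t)^[m] x))) • v)
          (Complex.exp (l (f^[m] x)) • v) 0 := by
        have e1 : HasDerivAt (fun t : ℂ => Complex.exp (l ((G t)^[m] x))) _ 0 :=
          (l.hasFDerivAt.comp_hasDerivAt (0:ℂ) ih).cexp
        have e2 := ((hasDerivAt_id (0:ℂ)).mul e1).smul_const v
        refine e2.congr_deriv ?_
        simp [h0]
      have h2 := ih.add h1
      have h3 : HasFDerivAt f (Td f 1 (f^[m] x)) ((G 0)^[m] x + (0 * Complex.exp (l ((G 0)^[m] x))) • v) := by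
        rw [zero_mul, zero_smul, add_zero, h0]
        exact (hfd _).hasFDerivAt
      have h4 := HasFDerivAt.comp_hasDerivAt (0:ℂ) (f := fun t => (G t)^[m] x + (t * Complex.exp (l ((G t)^[m] x))) • v) h3 h2
      have h5 : (fun t => (G t)^[m+1] x) = f ∘ fun t => (G t)^[m] x + (t * Complex.exp (l ((G t)^[m] x))) • v := by
        funext t
        rw [iterate_succ_apply']; rfl
      rw [h5]
      refine h4.congr_deriv ?_
      rw [Finset.sum_range_succ, add_comm m 1, Td_add hfd, ContinuousLinearMap.comp_apply]
      congr 1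
      rw [map_add]
      congr 1
      have := Td_Sd hfd h.hg h.hgf h.hfg m x
      exact (congrArg (fun A : En n →L[ℂ] En n => A (Complex.exp (l (f^[m] x)) • v)) this).symm
  refine ⟨C * (2 * R / t0), fun m => ?_⟩
  have h1 := cauchy_fderiv (hdiff m) ht0 (hbd m)
  have h2 := Sd_Td hfd h.hg h.hgf m x
  set D := ∑ j ∈ Finset.range m, Sd f g j x (Complex.exp (l (f^[j] x)) • v) with hD
  have h3 : ‖Td f m x D‖ ≤ 2 * R / t0 := by
    have := (fderiv ℂ (fun t => (G t)^[m] x) 0).le_opNorm 1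
    rw [(hderiv m).hasFDerivAt.fderiv] at this h1
    simp only [ContinuousLinearMap.toSpanSingleton_apply, one_smul, norm_one, mul_one] at this
    exact this.trans h1
  have h4 : D = Sd f g m x (Td f m x D) := by
    exact (congrArg (fun A : En n →L[ℂ] En n => A D) h2).symm
  rw [h4]
  exact (ContinuousLinearMap.le_opNorm _ _).trans (mul_le_mul (h.b4 m x hx) h3 (norm_nonneg _) (by linarith [h.hC]))

/-- Hamiltonian-type field -/
def XQ (i0 b : Fin n) (Q : En n → ℂ) (z : En n) : En n :=
  (fderiv ℂ Q z (eb b)) • eb i0 - (fderiv ℂ Q z (eb i0)) • eb b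

theorem expspan_diff {q : C(En n, ℂ)} (hq : q ∈ Submodule.span ℂ (range (expo (n := n)))) :
    Differentiable ℂ q := by
  induction hq using Submodule.span_induction with
  | mem q hq =>
    obtain ⟨l, rfl⟩ := hq
    exact l.differentiable.cexp
  | zero => exact differentiable_const 0
  | add a b _ _ ha hb => exact ha.add hb
  | smul c a _ ha => exact ha.const_smul c

theorem avg_span (h : BdCtx f g x0 s R C) (hp : Persist f x0 s R) {x : En n}
    (hx : x ∈ closedBall x0 (3 * s)) (i0 b : Fin n) {q : C(En n, ℂ)} (hq : q ∈ Submodule.span ℂ (range (expo (n := n)))) :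
    ∃ K : ℝ, ∀ m, ‖∑ j ∈ Finset.range m, Sd f g j x (XQ i0 b q (f^[j] x))‖ ≤ K := by
  induction hq using Submodule.span_induction with
  | mem q hq =>
    obtain ⟨l, rfl⟩ := hq
    have h1 : ∀ z, XQ i0 b (expo l) z = Complex.exp (l z) • (l (eb b) • eb i0 - l (eb i0) • eb b) := by
      intro z
      have : HasFDerivAt (expo l) (Complex.exp (l z) • l) z := l.hasFDerivAt.cexp
      simp only [XQ, this.fderiv]
      simp [smul_sub, smul_smul]
    simp only [h1]
    apply avg_exp h hp hx
    simp [mul_comm]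
  | zero =>
    refine ⟨0, fun m => ?_⟩
    have : ∀ z, XQ i0 b (0 : C(En n, ℂ)) z = 0 := by
      intro z
      have : fderiv ℂ (⇑(0 : C(En n, ℂ))) z = 0 := (hasFDerivAt_const (0:ℂ) z).fderiv
      simp only [XQ, this]
      simp
    simp only [this, map_zero, Finset.sum_const_zero, norm_zero, le_refl]
  | add q1 q2 hq1 hq2 ih1 ih2 =>
    obtain ⟨K1, hK1⟩ := ih1
    obtain ⟨K2, hK2⟩ := ih2
    refine ⟨K1 + K2, fun m => ?_⟩
    have : ∀ z, XQ i0 b (q1 + q2 : C(En n, ℂ)) z = XQ i0 b q1 z + XQ i0 b q2 z := by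
      intro z
      have : fderiv ℂ (⇑(q1 + q2 : C(En n, ℂ))) z = fderiv ℂ q1 z + fderiv ℂ q2 z :=
        fderiv_add (expspan_diff hq1 z) (expspan_diff hq2 z)
      simp only [XQ, this, add_apply, add_smul]
      abel
    simp only [this, map_add, Finset.sum_add_distrib]
    exact (norm_add_le _ _).trans (add_le_add (hK1 m) (hK2 m))
  | smul c q1 hq1 ih =>
    obtain ⟨K1, hK1⟩ := ih
    refine ⟨‖c‖ * K1, fun m => ?_⟩
    have : ∀ z, XQ i0 b (c • q1 : C(En n, ℂ)) z = c • XQ i0 b q1 z := by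
      intro z
      have : fderiv ℂ (⇑(c • q1 : C(En n, ℂ))) z = c • fderiv ℂ q1 z :=
        fderiv_const_smul (expspan_diff hq1 z) c
      simp only [XQ, this, smul_apply, smul_sub, smul_assoc]
    simp only [this, map_smul, ← Finset.smul_sum]
    rw [norm_smul]
    exact mul_le_mul_of_nonneg_left (hK1 m) (norm_nonneg _)

theorem avg_Q (h : BdCtx f g x0 s R C) (hp : Persist f x0 s R) {x : En n}
    (hx : x ∈ closedBall x0 (3 * s)) (i0 b : Fin n) {Q : En n → ℂ} (hQ : Differentiable ℂ Q) (ε : ℝ) (hε : 0 < ε) :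
    ∃ K : ℝ, ∀ m : ℕ, ‖∑ j ∈ Finset.range m, Sd f g j x (XQ i0 b Q (f^[j] x))‖ ≤ K + m * ε := by
  have hC : 0 < C := by linarith [h.hC]
  let ε' := ε / (4 * C)
  have hε' : 0 < ε' := by positivity
  obtain ⟨q, hq, hqQ⟩ := exp_dense Q hQ (R + 1) ε' hε'
  obtain ⟨K, hK⟩ := avg_span h hp hx i0 b hq
  refine ⟨K, fun m => ?_⟩
  have hqd := expspan_diff hq
  have hd : ∀ z ∈ closedBall (0 : En n) R, ‖fderiv ℂ q z - fderiv ℂ Q z‖ ≤ 2 * ε' := by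
    intro z hz
    rw [← fderiv_sub (hqd z) (hQ z)]
    have := cauchy_fderiv' (hqd.sub hQ) (x0 := 0) (R := R + 1) (M := ε') (d := 1) one_pos hqQ (z := z) (by simpa using hz)
    simpa using this
  have hX : ∀ z ∈ closedBall (0 : En n) R, ‖XQ i0 b q z - XQ i0 b Q z‖ ≤ 4 * ε' := by
    intro z hz
    have e : XQ i0 b q z - XQ i0 b Q z = ((fderiv ℂ q z - fderiv ℂ Q z) (eb b)) • eb i0
        - ((fderiv ℂ q z - fderiv ℂ Q z) (eb i0)) • eb b := by
      simp only [XQ, sub_apply, sub_smul]; abel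
    have h1 : ∀ i, ‖(fderiv ℂ q z - fderiv ℂ Q z) (eb i)‖ ≤ 2 * ε' := by
      intro i
      refine (ContinuousLinearMap.le_opNorm _ _).trans ?_
      simpa using hd z hz
    rw [e]
    refine (norm_sub_le _ _).trans ?_
    rw [norm_smul, norm_smul]
    simp only [PiLp.norm_single, norm_one, mul_one]
    linarith [h1 b, h1 i0]
  have e : ∑ j ∈ Finset.range m, Sd f g j x (XQ i0 b Q (f^[j] x)) =
      ∑ j ∈ Finset.range m, Sd f g j x (XQ i0 b q (f^[j] x)) -
      ∑ j ∈ Finset.range m, Sd f g j x (XQ i0 b q (f^[j] x) - XQ i0 b Q (f^[j] x)) := by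
    simp [map_sub, Finset.sum_sub_distrib]
  rw [e]
  refine (norm_sub_le _ _).trans (add_le_add (hK m) ?_)
  calc _ ≤ ∑ j ∈ Finset.range m, C * (4 * ε') := by
        apply norm_sum_le_of_le
        intro j _
        refine (ContinuousLinearMap.le_opNorm _ _).trans ?_
        exact mul_le_mul (h.b4 j x hx) (hX _ (by simpa using h.b0 j x hx)) (norm_nonneg _) hC.le
    _ = m * ε := by
        rw [Finset.sum_const, Finset.card_range, nsmul_eq_mul]; simp only [ε']; field_simp

end avg

section key
variable {n : ℕ} {f g : En n → En n} {x0 : En n} {s R C : ℝ}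

def XY (i0 : Fin n) (Y : En n → En n) (z : En n) : En n :=
  - Y z + ((Y z i0) • eb i0 - z i0 • (fderiv ℂ Y z (eb i0))) + (z i0 * ∑ b, (fderiv ℂ Y z (eb b)) b) • eb i0

theorem XY_eq (i0 : Fin n) {Y : En n → En n} (hY : Differentiable ℂ Y) (z : En n) :
    XY i0 Y z = ∑ b, XQ i0 b (fun z => z i0 * Y z b) z := by
  have h1 : ∀ b u, fderiv ℂ (fun z => z i0 * Y z b) z u = u i0 * Y z b + z i0 * (fderiv ℂ Y z u) b := by
    intro b u
    have e1 : HasFDerivAt (fun z : En n => z i0) (EuclideanSpace.proj i0 : En n →L[ℂ] ℂ) z :=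
      (EuclideanSpace.proj i0 : En n →L[ℂ] ℂ).hasFDerivAt
    have e2 : HasFDerivAt (fun z : En n => Y z b) ((EuclideanSpace.proj b : En n →L[ℂ] ℂ).comp (fderiv ℂ Y z)) z :=
      (EuclideanSpace.proj b : En n →L[ℂ] ℂ).hasFDerivAt.comp z (hY z).hasFDerivAt
    have e3 : HasFDerivAt (fun z : En n => z i0 * Y z b) _ z := e1.mul e2
    rw [e3.fderiv]
    simp; ring
  unfold XQ
  simp only [h1]
  rw [Finset.sum_sub_distrib, ← Finset.sum_smul]
  have h2 : ∑ b, ((eb b : En n) i0 * Y z b + z i0 * (fderiv ℂ Y z (eb b)) b) =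
      Y z i0 + z i0 * ∑ b, (fderiv ℂ Y z (eb b)) b := by
    rw [Finset.sum_add_distrib, Finset.mul_sum]
    congr 1
    simp [Pi.single_apply]
  have h3 : ∑ b, ((eb i0 : En n) i0 * Y z b + z i0 * (fderiv ℂ Y z (eb i0)) b) • (eb b : En n) =
      Y z + z i0 • fderiv ℂ Y z (eb i0) := by
    ext i
    simp [Pi.single_apply]
  rw [h2, h3, XY, add_smul]
  abel

theorem avg_Y (h : BdCtx f g x0 s R C) (hp : Persist f x0 s R) {x : En n}
    (hx : x ∈ closedBall x0 (3 * s)) (i0 : Fin n) {Y : En n → En n} (hY : Differentiable ℂ Y) (ε : ℝ) (hε : 0 < ε) :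
    ∃ K : ℝ, ∀ m : ℕ, ‖∑ j ∈ Finset.range m, Sd f g j x (XY i0 Y (f^[j] x))‖ ≤ K + m * ε := by
  have hn : 0 < n := i0.pos
  have hY' : ∀ b, Differentiable ℂ (fun z => z i0 * Y z b) := fun b => by fun_prop
  choose K hK using fun b => avg_Q h hp hx i0 b (hY' b) (ε / n) (by positivity)
  refine ⟨∑ b, K b, fun m => ?_⟩
  simp only [XY_eq i0 hY, map_sum]
  rw [Finset.sum_comm]
  refine (norm_sum_le _ _).trans ((Finset.sum_le_sum fun b _ => hK b m).trans (le_of_eq ?_))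
  rw [Finset.sum_add_distrib]
  congr 1
  simp
  field_simp

theorem lin_limit {δ a K : ℝ} (h : ∀ m : ℕ, m * δ ≤ K + m * a) : δ ≤ a := by
  by_contra hc
  push Not at hc
  obtain ⟨m, hm⟩ := exists_nat_gt (K / (δ - a))
  rw [div_lt_iff₀ (by linarith)] at hm
  have := h m
  nlinarith

theorem telesc {E : Type*} [NormedAddCommGroup E] (A : ℕ → E) (B : ℝ) (hA : ∀ j, ‖A j‖ ≤ B) (k m : ℕ) :
    ‖∑ j ∈ Finset.range m, (A (j + k) - A j)‖ ≤ 2 * k * B := by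
  have h1 := Finset.sum_range_add A k m
  have h2 := Finset.sum_range_add A m k
  rw [add_comm m k, h1] at h2
  have h3 : ∑ j ∈ Finset.range m, (A (j + k) - A j) = ∑ j ∈ Finset.range k, (A (m + j) - A j) := by
    rw [Finset.sum_sub_distrib, Finset.sum_sub_distrib]
    simp only [add_comm _ k] at *
    rw [sub_eq_sub_iff_add_eq_add, add_comm, h2, add_comm]
  rw [h3]
  calc _ ≤ ∑ j ∈ Finset.range k, (B + B) := by
        apply norm_sum_le_of_le
        intro j _
        exact (norm_sub_le _ _).trans (add_le_add (hA _) (hA _))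
    _ = _ := by simp; ring

theorem key (h : BdCtx f g x0 s R C) (hp : Persist f x0 s R) (i0 : Fin n) :
    ∃ C1 : ℝ, 1 ≤ C1 ∧ ∀ k x, x ∈ closedBall x0 (3 * s) → f^[k] x ∈ closedBall x0 (3 * s) → ∀ κ,
      ‖f^[k] x - x‖ + ‖Td f k x - 1‖ ≤ κ → C1 * κ ≤ 1 → ‖f^[k] x - x‖ ≤ C1 * κ ^ 2 := by
  obtain ⟨Kt, hKt, hKt'⟩ := trace_bound n
  have hC1 := h.hC
  have hC : 0 < C := by linarith
  have hR := h.hR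
  have hfd := h.hf.diff
  let E := C ^ 2 + C ^ 4 * (2 * C + R * C ^ 3) + C * (R * (Kt * (C ^ 3) ^ 2))
  have hE : 0 < E := by positivity
  refine ⟨E + 2 * C ^ 3 + 1, by linarith [hE, pow_pos hC 3], fun k x hx hkx κ hκ hκ1 => ?_⟩
  set v0 := f^[k] x - x with hv0
  have hκ0 : 0 ≤ κ := (by positivity : (0:ℝ) ≤ ‖v0‖ + ‖Td f k x - 1‖).trans hκ
  have hδκ : ‖v0‖ ≤ κ := by linarith [norm_nonneg (Td f k x - 1)]
  have hκle1 : κ ≤ 1 := by nlinarith [pow_pos hC 3]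
  have hκ2 : C ^ 3 * κ ≤ 1 / 2 := by nlinarith [pow_pos hC 3]
  suffices hfin : ‖v0‖ ≤ E * κ ^ 2 by
    refine hfin.trans ?_
    gcongr
    linarith [pow_pos hC 3]
  have hYd : Differentiable ℂ (fun z => f^[k] z - z) := (hfd.iterate k).sub differentiable_id
  have hYD : ∀ z, fderiv ℂ (fun z => f^[k] z - z) z = Td f k z - 1 := by
    intro z
    have e : HasFDerivAt (fun z => f^[k] z - z) (Td f k z - ContinuousLinearMap.id ℂ _) z :=
      (hfd.iterate k z).hasFDerivAt.sub (hasFDerivAt_id z)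
    exact e.fderiv
  let M : ℕ → (En n →L[ℂ] En n) := fun l => Td f k (f^[l] x) - 1
  have hMT : ∀ l, M l * Td f l x = (Td f l (f^[k] x) - Td f l x) * Td f k x + Td f l x * (Td f k x - 1) := by
    intro l
    have e1 : Td f (k + l) x = Td f k (f^[l] x) * Td f l x := Td_add hfd k l x
    have e2 : Td f (l + k) x = Td f l (f^[k] x) * Td f k x := Td_add hfd l k x
    rw [add_comm l k] at e2
    simp only [M, sub_mul, mul_sub, ← e1, ← e2, one_mul, mul_one]
    abel
  have hTS : ∀ l, Td f l x * Sd f g l x = 1 := fun l => Td_Sd hfd h.hg h.hgf h.hfg l x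
  have hM : ∀ l, ‖M l‖ ≤ C ^ 3 * κ := by
    intro l
    have e : M l = ((Td f l (f^[k] x) - Td f l x) * Td f k x + Td f l x * (Td f k x - 1)) * Sd f g l x := by
      rw [← hMT, mul_assoc, hTS, mul_one]
    have h1 : ‖(Td f l (f^[k] x) - Td f l x) * Td f k x‖ ≤ (C * ‖v0‖) * C :=
      (norm_mul_le _ _).trans (mul_le_mul (h.b2 l x hx _ hkx) (h.b1 k x hx) (norm_nonneg _) (by positivity))
    have h2 : ‖Td f l x * (Td f k x - 1)‖ ≤ C * ‖Td f k x - 1‖ :=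
      (norm_mul_le _ _).trans (mul_le_mul_of_nonneg_right (h.b1 l x hx) (norm_nonneg _))
    have h3 : ‖(Td f l (f^[k] x) - Td f l x) * Td f k x + Td f l x * (Td f k x - 1)‖ ≤ C ^ 2 * κ := by
      refine (norm_add_le _ _).trans ((add_le_add h1 h2).trans ?_)
      have : C * ‖Td f k x - 1‖ ≤ C ^ 2 * ‖Td f k x - 1‖ := by
        apply mul_le_mul_of_nonneg_right _ (norm_nonneg _)
        nlinarith
      calc _ ≤ C ^ 2 * (‖v0‖ + ‖Td f k x - 1‖) := by linarith
        _ ≤ _ := by gcongr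
    rw [e]
    calc _ ≤ _ := norm_mul_le _ _
      _ ≤ (C ^ 2 * κ) * C := mul_le_mul h3 (h.b4 l x hx) (norm_nonneg _) (by positivity)
      _ = _ := by ring
  have hS : ∀ l, Sd f g (l + k) x * (1 + M l) = Sd f g l x := by
    intro l
    have e1 : Td f (k + l) x = Td f k (f^[l] x) * Td f l x := Td_add hfd k l x
    have e2 := Sd_Td hfd h.hg h.hgf (l + k) x
    rw [add_comm l k, e1] at e2
    have e3 : (1 : En n →L[ℂ] En n) + M l = Td f k (f^[l] x) := by simp [M]
    rw [e3, add_comm l k]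
    calc _ = Sd f g (k + l) x * Td f k (f^[l] x) * (Td f l x * Sd f g l x) := by rw [hTS, mul_one]
      _ = (Sd f g (k + l) x * (Td f k (f^[l] x) * Td f l x)) * Sd f g l x := by simp only [mul_assoc]
      _ = _ := by rw [e2, one_mul]
  let v : ℕ → En n := fun l => f^[k] (f^[l] x) - f^[l] x
  have hvl : ∀ l, v l = f^[l] (f^[k] x) - f^[l] x := by
    intro l; simp only [v]; rw [← iterate_add_apply, add_comm, iterate_add_apply]
  have hv1 : ∀ l, ‖v l - Td f l x v0‖ ≤ C * κ ^ 2 := by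
    intro l
    rw [hvl]
    refine (h.b3 l x hx _ hkx).trans ?_
    gcongr
  have hv2 : ∀ l, ‖v l‖ ≤ 2 * C * κ := by
    intro l
    have e1 : ‖Td f l x v0‖ ≤ C * κ :=
      (ContinuousLinearMap.le_opNorm _ _).trans (mul_le_mul (h.b1 l x hx) hδκ (norm_nonneg _) hC.le)
    have e2 : C * κ ^ 2 ≤ C * κ := by
      gcongr; nlinarith
    calc ‖v l‖ = ‖(v l - Td f l x v0) + Td f l x v0‖ := by congr 1; abel
      _ ≤ _ := norm_add_le _ _
      _ ≤ _ := by linarith [hv1 l]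
  let A : ℕ → En n := fun l => Sd f g l x ((f^[l] x) i0 • eb i0)
  let w : ℕ → En n := fun l => (v l i0) • eb i0 - (f^[l] x) i0 • M l (eb i0)
  have hxl : ∀ l, ‖(f^[l] x) i0‖ ≤ R := fun l => (PiLp.norm_apply_le _ _).trans (h.b0 l x hx)
  have hAb : ∀ l, ‖A l‖ ≤ C * R := by
    intro l
    refine (ContinuousLinearMap.le_opNorm _ _).trans (mul_le_mul (h.b4 l x hx) ?_ (norm_nonneg _) hC.le)
    rw [norm_smul]; simpa using hxl l
  have hwA : ∀ l, Sd f g l x (w l) = (A (l + k) - A l) + Sd f g (l + k) x (M l (w l)) := by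
    intro l
    have e0 : ∀ u, Sd f g l x u = Sd f g (l + k) x (u + M l u) := by
      intro u; rw [← hS l]; rfl
    have e1 : w l = (f^[l + k] x) i0 • eb i0 - ((f^[l] x) i0 • eb i0 + M l ((f^[l] x) i0 • eb i0)) := by
      simp only [w, v, map_smul]
      rw [add_comm l k, iterate_add_apply, PiLp.sub_apply, sub_smul]
      abel
    have e2 : Sd f g (l + k) x (w l) = A (l + k) - A l := by
      rw [e1, map_sub, ← e0]
    rw [e0 (w l), map_add, e2]
  have hwb : ∀ l, ‖w l‖ ≤ (2 * C + R * C ^ 3) * κ := by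
    intro l
    have e1 : ‖(v l i0) • (eb i0 : En n)‖ ≤ 2 * C * κ := by
      rw [norm_smul]
      simpa using (PiLp.norm_apply_le _ _).trans (hv2 l)
    have e2 : ‖(f^[l] x) i0 • M l (eb i0)‖ ≤ R * (C ^ 3 * κ) := by
      rw [norm_smul]
      refine mul_le_mul (hxl l) ?_ (norm_nonneg _) hR
      refine (ContinuousLinearMap.le_opNorm _ _).trans ?_
      simpa using hM l
    calc _ ≤ _ := norm_sub_le _ _
      _ ≤ _ := add_le_add e1 e2
      _ = _ := by ring
  have hdet : ∀ l, (1 + M l).det = 1 := by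
    intro l
    have e3 : (1 : En n →L[ℂ] En n) + M l = Td f k (f^[l] x) := by simp [M]
    rw [e3]
    exact (h.hf.iter k).2 _
  have htr : ∀ l, ‖∑ b, (M l (eb b)) b‖ ≤ Kt * (C ^ 3 * κ) ^ 2 := by
    intro l
    refine (hKt' (M l) (hdet l) ((hM l).trans hκ2)).trans ?_
    gcongr
    exact hM l
  have herr : ∀ l, ‖Sd f g l x (XY i0 (fun z => f^[k] z - z) (f^[l] x)) + v0 - (A (l + k) - A l)‖ ≤ E * κ ^ 2 := by
    intro l
    have hX : XY i0 (fun z => f^[k] z - z) (f^[l] x) = - v l + w l +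
        ((f^[l] x) i0 * ∑ b, (M l (eb b)) b) • eb i0 := by
      simp only [XY, hYD, v, w, M]
    have e1 : Sd f g l x (XY i0 (fun z => f^[k] z - z) (f^[l] x)) + v0 - (A (l + k) - A l) =
        - (Sd f g l x (v l - Td f l x v0)) + Sd f g (l + k) x (M l (w l)) +
        Sd f g l x (((f^[l] x) i0 * ∑ b, (M l (eb b)) b) • eb i0) := by
      have : v0 = Sd f g l x (Td f l x v0) :=
        (congrArg (fun A : En n →L[ℂ] En n => A v0) (Sd_Td hfd h.hg h.hgf l x)).symm
      rw [hX, map_add, map_add, map_neg, hwA, map_sub (Sd f g l x) (v l) (Td f l x v0), ← this]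
      abel
    rw [e1]
    have n1 : ‖- (Sd f g l x (v l - Td f l x v0))‖ ≤ C * (C * κ ^ 2) := by
      rw [norm_neg]
      exact (ContinuousLinearMap.le_opNorm _ _).trans (mul_le_mul (h.b4 l x hx) (hv1 l) (norm_nonneg _) hC.le)
    have n2 : ‖Sd f g (l + k) x (M l (w l))‖ ≤ C * ((C ^ 3 * κ) * ((2 * C + R * C ^ 3) * κ)) := by
      refine (ContinuousLinearMap.le_opNorm _ _).trans (mul_le_mul (h.b4 _ x hx) ?_ (norm_nonneg _) hC.le)
      exact (ContinuousLinearMap.le_opNorm _ _).trans (mul_le_mul (hM l) (hwb l) (norm_nonneg _) (by positivity))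
    have n3 : ‖Sd f g l x (((f^[l] x) i0 * ∑ b, (M l (eb b)) b) • eb i0)‖ ≤ C * (R * (Kt * (C ^ 3 * κ) ^ 2)) := by
      refine (ContinuousLinearMap.le_opNorm _ _).trans (mul_le_mul (h.b4 _ x hx) ?_ (norm_nonneg _) hC.le)
      rw [norm_smul, norm_mul]
      simpa using mul_le_mul (hxl l) (htr l) (norm_nonneg _) hR
    calc _ ≤ _ := norm_add₃_le
      _ ≤ _ := add_le_add (add_le_add n1 n2) n3
      _ = _ := by simp only [E]; ring
  apply le_of_forall_pos_le_add
  intro ε hε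
  obtain ⟨K, hK⟩ := avg_Y h hp hx i0 hYd ε hε
  apply lin_limit (K := K + 2 * k * (C * R))
  intro m
  have hsum : (m : ℂ) • v0 = ∑ l ∈ Finset.range m, (Sd f g l x (XY i0 (fun z => f^[k] z - z) (f^[l] x)) + v0 - (A (l + k) - A l))
      - ∑ l ∈ Finset.range m, Sd f g l x (XY i0 (fun z => f^[k] z - z) (f^[l] x))
      + ∑ l ∈ Finset.range m, (A (l + k) - A l) := by
    simp only [Finset.sum_sub_distrib, Finset.sum_add_distrib, Finset.sum_const, Finset.card_range]
    rw [← Nat.cast_smul_eq_nsmul ℂ]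
    abel
  have hn1 : ‖(m : ℂ) • v0‖ = m * ‖v0‖ := by rw [norm_smul]; simp
  rw [← hn1, hsum]
  have e1 : ‖∑ l ∈ Finset.range m, (Sd f g l x (XY i0 (fun z => f^[k] z - z) (f^[l] x)) + v0 - (A (l + k) - A l))‖ ≤ m * (E * κ ^ 2) := by
    calc _ ≤ ∑ l ∈ Finset.range m, E * κ ^ 2 := norm_sum_le_of_le _ (fun l _ => herr l)
      _ = _ := by simp
  have e2 := hK m
  have e3 := telesc A (C * R) hAb k m
  refine (norm_add_le _ _).trans ?_
  have e4 := norm_sub_le (∑ l ∈ Finset.range m, (Sd f g l x (XY i0 (fun z => f^[k] z - z) (f^[l] x)) + v0 - (A (l + k) - A l)))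
    (∑ l ∈ Finset.range m, Sd f g l x (XY i0 (fun z => f^[k] z - z) (f^[l] x)))
  linarith
end key

section qs
theorem quant_surj {E : Type*} [NormedAddCommGroup E] [NormedSpace ℂ E] [CompleteSpace E]
    {f : E → E} {T S : E →L[ℂ] E} (hTS : T * S = 1) {C τ : ℝ}
    (hC : 0 < C) (hτ : 0 ≤ τ) (hS : ‖S‖ ≤ C) {b : E}
    (h : ∀ z ∈ closedBall b τ, ∀ w ∈ closedBall b τ, ‖f z - f w - T (z - w)‖ ≤ 1 / (2 * C) * ‖z - w‖)
    (y : E) (hy : ‖y - f b‖ ≤ τ / (2 * C)) : ∃ x ∈ closedBall b τ, f x = y := by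
  let c : NNReal := ⟨1 / (2 * C), by positivity⟩
  have ha : ApproximatesLinearOn f T (closedBall b τ) c := fun z hz w hw => h z hz w hw
  let N : T.NonlinearRightInverse := ⟨S, ⟨C, hC.le⟩, fun y => (S.le_opNorm y).trans
    (mul_le_mul_of_nonneg_right hS (norm_nonneg _)),
    fun y => congrArg (fun A : E →L[ℂ] E => A y) hTS⟩
  have := ha.surjOn_closedBall_of_nonlinearRightInverse N hτ (Subset.refl _)
  obtain ⟨x, hx, hxy⟩ := this (show y ∈ _ by
    rw [mem_closedBall, dist_eq_norm]
    refine hy.trans (le_of_eq ?_)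
    show τ / (2 * C) = (C⁻¹ - 1 / (2 * C)) * τ
    field_simp; ring)
  exact ⟨x, hx, hxy⟩
end qs

section expl
variable {n : ℕ} {f g : En n → En n} {x0 : En n} {s R C : ℝ}

theorem BdCtx.lip (h : BdCtx f g x0 s R C) (l : ℕ) {z w : En n} (hz : z ∈ closedBall x0 (3 * s))
    (hw : w ∈ closedBall x0 (3 * s)) : ‖f^[l] w - f^[l] z‖ ≤ C * ‖w - z‖ :=
  (convex_closedBall x0 (3 * s)).norm_image_sub_le_of_norm_fderiv_le
    (fun x _ => h.hf.diff.iterate l x) (fun x hx => h.b1 l x hx) hz hw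

theorem BdCtx.recur (h : BdCtx f g x0 s R C) {μ : ℝ} (hμ : 0 < μ) :
    ∃ i j, i < j ∧ ∀ z ∈ closedBall x0 (3 * s), ‖f^[j] z - f^[i] z‖ ≤ μ := by
  have hC : 0 < C := by linarith [h.hC]
  obtain ⟨t, hts, htf, htc⟩ := finite_cover_balls_of_compact (isCompact_closedBall x0 (3 * s))
    (show 0 < μ / (4 * C) by positivity)
  have : Fintype t := htf.fintype
  let X : ℕ → (t → En n) := fun l p => f^[l] p
  have hX : ∀ l, X l ∈ closedBall (0 : t → En n) R := by
    intro l
    rw [mem_closedBall, dist_zero_right, pi_norm_le_iff_of_nonneg h.hR]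
    exact fun p => h.b0 l p (hts p.2)
  obtain ⟨a, -, φ, hφ, hlim⟩ := tendsto_subseq_of_bounded isBounded_closedBall hX
  obtain ⟨N, hN⟩ := (Metric.tendsto_atTop.1 hlim) (μ / 4) (by positivity)
  refine ⟨φ N, φ (N + 1), hφ (Nat.lt_succ_self N), fun z hz => ?_⟩
  obtain ⟨p, hp, hzp⟩ := mem_iUnion₂.1 (htc hz)
  rw [mem_ball, dist_eq_norm] at hzp
  have e1 := (norm_le_pi_norm (X (φ N) - a) ⟨p, hp⟩)
  have e2 := (norm_le_pi_norm (X (φ (N+1)) - a) ⟨p, hp⟩)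
  have e3 := hN N le_rfl
  have e4 := hN (N+1) (Nat.le_succ N)
  rw [dist_eq_norm] at e3 e4
  simp only [X, Pi.sub_apply, comp_apply] at e1 e2 e3 e4
  have e5 := h.lip (φ N) (hts hp) hz
  have e6 := h.lip (φ (N+1)) (hts hp) hz
  have e7 : C * ‖z - p‖ ≤ μ / 4 := by
    calc _ ≤ C * (μ / (4 * C)) := by gcongr
      _ = _ := by field_simp
  have : f^[φ (N+1)] z - f^[φ N] z = (f^[φ (N+1)] z - f^[φ (N+1)] p) + (f^[φ (N+1)] p - a ⟨p, hp⟩)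
    - (f^[φ N] p - a ⟨p, hp⟩) - (f^[φ N] z - f^[φ N] p) := by abel
  rw [this]
  refine (norm_sub_le _ _).trans ?_
  refine (add_le_add_left (norm_sub_le _ _) _).trans ?_
  refine (add_le_add_left (add_le_add_left (norm_add_le _ _) _) _).trans ?_
  linarith

theorem BdCtx.near_id (h : BdCtx f g x0 s R C) {τ : ℝ} (hτ : 0 < τ) (hτs : τ ≤ s) (hτC : 6 * C ^ 2 * τ ≤ 1) :
    ∃ k, 1 ≤ k ∧ ∀ z ∈ closedBall x0 (2 * s), ‖f^[k] z - z‖ ≤ τ := by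
  have hC : 0 < C := by linarith [h.hC]
  obtain ⟨i, j, hij, hr⟩ := h.recur (show 0 < τ / (2 * C) by positivity)
  refine ⟨j - i, by omega, fun z hz => ?_⟩
  have hsub : closedBall z τ ⊆ closedBall x0 (3 * s) :=
    closedBall_subset_closedBall' (by rw [mem_closedBall] at hz; linarith)
  have hz3 : z ∈ closedBall x0 (3 * s) := hsub (mem_closedBall_self hτ.le)
  obtain ⟨x, hx, hxy⟩ := quant_surj (f := f^[i]) (Td_Sd h.hf.diff h.hg h.hgf h.hfg i z) hC hτ.le (h.b4 i z hz3)
    (b := z) (by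
      intro a ha b hb
      have e1 := h.b3 i b (hsub hb) a (hsub ha)
      have e2 := h.b2 i z hz3 b (hsub hb)
      have e3 : ‖(Td f i b - Td f i z) (a - b)‖ ≤ C * τ * ‖a - b‖ := by
        refine ((Td f i b - Td f i z).le_opNorm _).trans (mul_le_mul_of_nonneg_right (e2.trans ?_) (norm_nonneg _))
        rw [mem_closedBall, dist_eq_norm] at hb
        gcongr
      have e4 : ‖a - b‖ ≤ 2 * τ := by
        rw [← dist_eq_norm]
        rw [mem_closedBall] at ha hb
        linarith [dist_triangle_right a b z]
      have : f^[i] a - f^[i] b - Td f i z (a - b) = (f^[i] a - f^[i] b - Td f i b (a - b)) +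
          (Td f i b - Td f i z) (a - b) := by
        rw [sub_apply]; abel
      rw [this]
      refine (norm_add_le _ _).trans ((add_le_add e1 e3).trans ?_)
      have e5 : C * ‖a - b‖ ^ 2 ≤ C * (2 * τ) * ‖a - b‖ := by
        rw [sq, ← mul_assoc]
        gcongr
      have e6 : 3 * C * τ ≤ 1 / (2 * C) := by
        rw [le_div_iff₀ (by positivity)]
        linarith
      calc _ ≤ (3 * C * τ) * ‖a - b‖ := by linarith
        _ ≤ _ := by gcongr) _ (hr z hz3)
  have : x = f^[j - i] z := by
    apply (h.hf.iter i).inj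
    rw [hxy, ← iterate_add_apply]
    congr 2; omega
  rw [this, mem_closedBall, dist_eq_norm] at hx
  exact hx

theorem newton {C1 m0 : ℝ} (hC1 : 1 ≤ C1) (hm0 : 0 ≤ m0) (hs : 0 < s) (hs1 : s ≤ 1) (hm : 144 * C1 * m0 ≤ s ^ 2)
    {h : En n → En n} (hd : Differentiable ℂ h)
    (hk : ∀ x ∈ closedBall x0 (2 * s), ∀ κ,
      ‖h x - x‖ + ‖fderiv ℂ h x - 1‖ ≤ κ → C1 * κ ≤ 1 → ‖h x - x‖ ≤ C1 * κ ^ 2)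
    (h0 : ∀ z ∈ closedBall x0 (2 * s), ‖h z - z‖ ≤ m0) : ∀ z ∈ closedBall x0 s, h z = z := by
  have hy : Differentiable ℂ (fun z => h z - z) := hd.sub differentiable_id
  have hyD : ∀ z, fderiv ℂ (fun z => h z - z) z = fderiv ℂ h z - 1 := by
    intro z
    have e : HasFDerivAt (fun z => h z - z) (fderiv ℂ h z - ContinuousLinearMap.id ℂ _) z :=
      (hd z).hasFDerivAt.sub (hasFDerivAt_id z)
    exact e.fderiv
  have H : ∀ i : ℕ, ∀ z ∈ closedBall x0 (s + s / 2 ^ i), ‖h z - z‖ ≤ m0 / 4 ^ i := by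
    intro i
    induction i with
    | zero => simpa [two_mul] using h0
    | succ i ih =>
      intro z hz
      set p : ℝ := 2 ^ i with hp
      have hp1 : 1 ≤ p := one_le_pow₀ (by norm_num)
      have hp4 : (4 : ℝ) ^ i = p ^ 2 := by rw [hp, ← pow_mul, mul_comm, pow_mul]; norm_num
      have hp2 : (2 : ℝ) ^ (i + 1) = 2 * p := by rw [pow_succ]; ring
      rw [hp2] at hz
      rw [hp4] at ih
      rw [pow_succ, hp4]
      have hdpos : 0 < s / (2 * p) := by positivity
      have hz' : z ∈ closedBall x0 (s + s / p - s / (2 * p)) := by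
        convert hz using 2; field_simp; ring
      have h1 := cauchy_fderiv' hy hdpos ih hz'
      rw [hyD] at h1
      have hz2 : z ∈ closedBall x0 (s + s / p) := closedBall_subset_closedBall (by linarith) hz'
      have h2 := ih z hz2
      have hz3 : z ∈ closedBall x0 (2 * s) := by
        refine closedBall_subset_closedBall ?_ hz2
        have : s / p ≤ s := div_le_self hs.le hp1
        linarith
      have h3 : ‖h z - z‖ + ‖fderiv ℂ h z - 1‖ ≤ 6 * m0 / (s * p) := by
        refine (add_le_add h2 h1).trans ?_
        have e1 : 2 * (m0 / p ^ 2) / (s / (2 * p)) = 4 * m0 / (s * p) := by field_simp; ring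
        have e2 : m0 / p ^ 2 ≤ 2 * m0 / (s * p) := by
          apply div_le_div₀ (by linarith) (by linarith) (by positivity)
          nlinarith
        rw [e1]
        calc _ ≤ 2 * m0 / (s * p) + 4 * m0 / (s * p) := by linarith
          _ = _ := by ring
      have h4 : C1 * (6 * m0 / (s * p)) ≤ 1 := by
        rw [← mul_div_assoc, div_le_one (by positivity)]
        nlinarith [mul_nonneg hs.le (sub_nonneg.2 hp1), mul_nonneg hs.le (sub_nonneg.2 hs1), mul_nonneg (zero_le_one.trans hC1) hm0]
      refine (hk z hz3 _ h3 h4).trans ?_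
      have : C1 * (6 * m0 / (s * p)) ^ 2 = 144 * C1 * m0 * (m0 / (4 * (s * p) ^ 2)) := by field_simp; ring
      rw [this]
      calc _ ≤ s ^ 2 * (m0 / (4 * (s * p) ^ 2)) := by gcongr
        _ = _ := by field_simp
  intro z hz
  have hlim : Tendsto (fun i : ℕ => m0 / 4 ^ i) atTop (𝓝 0) := by
    have := (tendsto_pow_atTop_nhds_zero_of_lt_one (r := (1/4:ℝ)) (by norm_num) (by norm_num)).const_mul m0
    simpa [div_eq_mul_inv] using this
  have : ‖h z - z‖ ≤ 0 := ge_of_tendsto' hlim fun i => H i z (closedBall_subset_closedBall (by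
    have : 0 < s / 2 ^ i := by positivity
    linarith) hz)
  exact sub_eq_zero.1 (norm_le_zero_iff.1 this)

theorem ident {h : En n → En n} (hd : Differentiable ℂ h) (hs : 0 < s) (hz : ∀ z ∈ closedBall x0 s, h z = z) :
    h = id := by
  funext z
  let u := z - x0
  have hl : Differentiable ℂ (fun t : ℂ => x0 + t • u) := by fun_prop
  have h1 : AnalyticOnNhd ℂ (fun t : ℂ => h (x0 + t • u)) univ := fun t _ => (hd.comp hl).analyticAt t
  have h2 : AnalyticOnNhd ℂ (fun t : ℂ => x0 + t • u) univ := fun t _ => hl.analyticAt t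
  have h3 : (fun t : ℂ => h (x0 + t • u)) =ᶠ[𝓝 0] (fun t : ℂ => x0 + t • u) := by
    have : Tendsto (fun t : ℂ => x0 + t • u) (𝓝 0) (𝓝 x0) := by
      have := hl.continuous.tendsto 0; simpa using this
    filter_upwards [this (closedBall_mem_nhds x0 hs)] with t ht
    exact hz _ ht
  have := congrFun (h1.eq_of_eventuallyEq h2 h3) 1
  simpa [u] using this

theorem expel (hn : 0 < n) {f : En n → En n} (hf : VA f) (hid : ∀ k, 1 ≤ k → f^[k] ≠ id) (R ε : ℝ) (hε : 0 < ε)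
    (x0 : En n) (r : ℝ) (hr : 0 < r) :
    ∃ g, VA g ∧ (∀ z ∈ closedBall (0 : En n) R, ‖g z - f z‖ ≤ ε) ∧ ∃ x ∈ ball x0 r, ∃ m, R < ‖g^[m] x‖ := by
  by_contra hcon
  push Not at hcon
  obtain ⟨g, s, C, h, hsr⟩ := mkCtx hf hr (fun l z hz => hcon f hf (fun z _ => by simp [hε.le]) z hz l)
  have hs := h.hs
  have hp : Persist f x0 s R := ⟨ε, hε, fun g hg hgf x hx m => hcon g hg hgf x
    (closedBall_subset_ball (by linarith) hx) m⟩
  obtain ⟨C1, hC1, hkey⟩ := key h hp ⟨0, hn⟩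
  have hC : 0 < C := by linarith [h.hC]
  let τ := min s (min (1 / (6 * C ^ 2)) (s ^ 2 / (144 * C1)))
  have hτ : 0 < τ := by positivity
  have t1 : τ ≤ s := min_le_left _ _
  have t2 : 6 * C ^ 2 * τ ≤ 1 := by
    have : τ ≤ 1 / (6 * C ^ 2) := (min_le_right _ _).trans (min_le_left _ _)
    rw [le_div_iff₀ (by positivity)] at this; linarith
  have t3 : 144 * C1 * τ ≤ s ^ 2 := by
    have : τ ≤ s ^ 2 / (144 * C1) := (min_le_right _ _).trans (min_le_right _ _)
    rw [le_div_iff₀ (by positivity)] at this; linarith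
  obtain ⟨k, hk1, hk⟩ := h.near_id hτ t1 t2
  refine hid k hk1 (ident (hf.diff.iterate k) hs (newton hC1 hτ.le hs h.hs1 t3 (hf.diff.iterate k) ?_ hk))
  intro x hx κ
  refine hkey k x (closedBall_subset_closedBall (by linarith) hx) ?_ κ
  have := hk x hx
  rw [← dist_eq_norm] at this
  rw [mem_closedBall] at hx ⊢
  linarith [dist_triangle (f^[k] x) x x0]

end expl

section hyp
variable {n : ℕ}

def pc (i0 : Fin n) : En n →L[ℂ] ℂ := EuclideanSpace.proj i0
def Ps (i0 : Fin n) : En n →L[ℂ] En n := (pc i0).smulRight (eb i0)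
def Pu (i0 : Fin n) : En n →L[ℂ] En n := ContinuousLinearMap.id ℂ _ - Ps i0
def LL (i0 : Fin n) (β : ℂ) : En n →L[ℂ] En n := β • Ps i0 + (4 : ℂ) • Pu i0

variable (i0 : Fin n)
theorem pc_apply (z : En n) : pc i0 z = z i0 := rfl
theorem Ps_apply (z : En n) : Ps i0 z = pc i0 z • eb i0 := rfl
theorem Pu_apply (z : En n) : Pu i0 z = z - Ps i0 z := rfl
theorem pc_eb : pc i0 (eb i0) = 1 := by simp [pc]
theorem norm_eb : ‖(eb i0 : En n)‖ = 1 := by simp [eb, PiLp.norm_single]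
theorem pc_le (z : En n) : ‖pc i0 z‖ ≤ ‖z‖ := PiLp.norm_apply_le z i0
theorem norm_Ps (z : En n) : ‖Ps i0 z‖ = ‖pc i0 z‖ := by rw [Ps_apply, norm_smul, norm_eb, mul_one]
theorem Ps_le (z : En n) : ‖Ps i0 z‖ ≤ ‖z‖ := by rw [norm_Ps]; exact pc_le i0 z
theorem Pu_le (z : En n) : ‖Pu i0 z‖ ≤ ‖z‖ := by
  rw [EuclideanSpace.norm_eq, EuclideanSpace.norm_eq]
  apply Real.sqrt_le_sqrt
  apply Finset.sum_le_sum
  intro i _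
  gcongr
  rw [Pu_apply, Ps_apply, pc_apply]
  by_cases h : i = i0
  · subst h; simp
  · simp [h]
theorem pc_Ps (z : En n) : pc i0 (Ps i0 z) = pc i0 z := by rw [Ps_apply, map_smul, pc_eb]; simp
theorem pc_Pu (z : En n) : pc i0 (Pu i0 z) = 0 := by rw [Pu_apply, map_sub, pc_Ps, sub_self]
theorem Ps_Ps (z : En n) : Ps i0 (Ps i0 z) = Ps i0 z := by rw [Ps_apply i0 (Ps i0 z), pc_Ps]; rfl
theorem Ps_Pu (z : En n) : Ps i0 (Pu i0 z) = 0 := by rw [Ps_apply, pc_Pu, zero_smul]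
theorem Pu_Ps (z : En n) : Pu i0 (Ps i0 z) = 0 := by rw [Pu_apply, Ps_Ps, sub_self]
theorem Pu_Pu (z : En n) : Pu i0 (Pu i0 z) = Pu i0 z := by rw [Pu_apply i0 (Pu i0 z), Ps_Pu, sub_zero]
theorem Ps_add_Pu (z : En n) : Ps i0 z + Pu i0 z = z := by rw [Pu_apply]; abel
theorem norm_le_su (z : En n) : ‖z‖ ≤ ‖Ps i0 z‖ + ‖Pu i0 z‖ := by
  conv_lhs => rw [← Ps_add_Pu i0 z]
  exact norm_add_le _ _
theorem LL_apply (β : ℂ) (z : En n) : LL i0 β z = β • Ps i0 z + (4 : ℂ) • Pu i0 z := rfl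
theorem Ps_LL (β : ℂ) (z : En n) : Ps i0 (LL i0 β z) = β • Ps i0 z := by
  rw [LL_apply, map_add, map_smul, map_smul, Ps_Ps, Ps_Pu, smul_zero, add_zero]
theorem Pu_LL (β : ℂ) (z : En n) : Pu i0 (LL i0 β z) = (4 : ℂ) • Pu i0 z := by
  rw [LL_apply, map_add, map_smul, map_smul, Pu_Pu, Pu_Ps, smul_zero, zero_add]

/-- local hyperbolicity condition on a ball -/
structure InW (i0 : Fin n) (β : ℂ) (c : En n) (r : ℝ) (f : En n → En n) : Prop where
  lip : ∃ η < (1 / 16 : ℝ), ∀ z ∈ closedBall c r, ∀ w ∈ closedBall c r,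
    ‖f z - f w - LL i0 β (z - w)‖ ≤ η * ‖z - w‖
  cen : ‖f c - c‖ < r / 16

variable {i0} {β : ℂ} {c : En n} {r : ℝ} {f f' : En n → En n}

theorem InW.lip' (h : InW i0 β c r f) {z w : En n} (hz : z ∈ closedBall c r) (hw : w ∈ closedBall c r) :
    ‖f z - f w - LL i0 β (z - w)‖ ≤ 1 / 16 * ‖z - w‖ := by
  obtain ⟨η, hη, h1⟩ := h.lip
  exact (h1 z hz w hw).trans (by gcongr)

/-- core one-step estimate -/
theorem core_succ (hβ : ‖β‖ ≤ 1 / 4) {a a' e : En n} {D E : ℝ} (ha : ‖Ps i0 a‖ ≤ D) (he : ‖e‖ ≤ E)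
    (hs : a' = LL i0 β a + e) : ‖Ps i0 a'‖ ≤ 1 / 4 * D + E := by
  rw [hs, map_add, Ps_LL]
  refine (norm_add_le _ _).trans ?_
  rw [norm_smul]
  refine add_le_add (mul_le_mul hβ ha (norm_nonneg _) (by norm_num)) ((Ps_le _ _).trans he)

theorem core_pred {a a' e : En n} {D E : ℝ} (ha : ‖a'‖ ≤ D) (he : ‖e‖ ≤ E)
    (hs : a' = LL i0 β a + e) : ‖Pu i0 a‖ ≤ 1 / 4 * (D + E) := by
  have h1 : (4 : ℂ) • Pu i0 a = Pu i0 (a' - e) := by rw [hs, add_sub_cancel_right, Pu_LL]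
  have h2 : ‖(4 : ℂ) • Pu i0 a‖ ≤ D + E := by
    rw [h1]; exact (Pu_le _ _).trans ((norm_sub_le _ _).trans (add_le_add ha he))
  rw [norm_smul] at h2
  norm_num at h2
  linarith

theorem compare1 (hβ : ‖β‖ ≤ 1 / 4) (h : InW i0 β c r f) {ε : ℝ} (hε : ∀ z ∈ closedBall c r, ‖f' z - f z‖ ≤ ε)
    {z z' : ℕ → En n} (hz : ∀ k, z k ∈ closedBall c r) (hz' : ∀ k, z' k ∈ closedBall c r)
    (ho : ∀ k, z (k + 1) = f (z k)) (ho' : ∀ k, z' (k + 1) = f' (z' k)) {D : ℝ} (hD : ∀ k, ‖z k - z' k‖ ≤ D) (k : ℕ) :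
    ‖z k - z' k‖ ≤ ‖pc i0 (z 0 - z' 0)‖ + 2 * ε + 37 / 64 * D := by
  have hD0 : 0 ≤ D := (norm_nonneg _).trans (hD 0)
  have hε0 : 0 ≤ ε := (norm_nonneg _).trans (hε _ (hz 0))
  let e : ℕ → En n := fun k => (f (z k) - f (z' k) - LL i0 β (z k - z' k)) - (f' (z' k) - f (z' k))
  have he : ∀ k, ‖e k‖ ≤ 1 / 16 * D + ε := by
    intro k
    refine (norm_sub_le _ _).trans (add_le_add ((h.lip' (hz k) (hz' k)).trans ?_) (hε _ (hz' k)))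
    have := hD k
    gcongr
  have hs : ∀ k, z (k + 1) - z' (k + 1) = LL i0 β (z k - z' k) + e k := by
    intro k; rw [ho, ho']; simp only [e]; abel
  have h2 := core_pred (hD (k + 1)) (he k) (hs k)
  refine (norm_le_su i0 _).trans ?_
  cases k with
  | zero => rw [norm_Ps]; linarith
  | succ k =>
    have h1 := core_succ hβ ((Ps_le i0 _).trans (hD k)) (he k) (hs k)
    have := norm_nonneg (pc i0 (z 0 - z' 0))
    linarith

theorem compare (hβ : ‖β‖ ≤ 1 / 4) (h : InW i0 β c r f) {ε : ℝ} (hε : ∀ z ∈ closedBall c r, ‖f' z - f z‖ ≤ ε)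
    {z z' : ℕ → En n} (hz : ∀ k, z k ∈ closedBall c r) (hz' : ∀ k, z' k ∈ closedBall c r)
    (ho : ∀ k, z (k + 1) = f (z k)) (ho' : ∀ k, z' (k + 1) = f' (z' k)) (k : ℕ) :
    ‖z k - z' k‖ ≤ 64 / 27 * (‖pc i0 (z 0 - z' 0)‖ + 2 * ε) := by
  set K := 64 / 27 * (‖pc i0 (z 0 - z' 0)‖ + 2 * ε) with hK
  have hε0 : 0 ≤ ε := (norm_nonneg _).trans (hε _ (hz 0))
  have hK0 : 0 ≤ K := by positivity
  have H : ∀ N : ℕ, ∀ k, ‖z k - z' k‖ ≤ K + (37 / 64) ^ N * (2 * r) := by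
    intro N
    induction N with
    | zero =>
      intro k
      have h1 := hz k; have h2 := hz' k
      rw [mem_closedBall] at h1 h2
      rw [← dist_eq_norm]
      simp only [pow_zero, one_mul]
      linarith [dist_triangle_right (z k) (z' k) c]
    | succ N ih =>
      intro k
      refine (compare1 hβ h hε hz hz' ho ho' ih k).trans (le_of_eq ?_)
      rw [hK, pow_succ]; ring
  have hlim : Tendsto (fun N : ℕ => K + (37 / 64 : ℝ) ^ N * (2 * r)) atTop (𝓝 (K + 0 * (2 * r))) :=
    ((tendsto_pow_atTop_nhds_zero_of_lt_one (by norm_num) (by norm_num)).mul_const _).const_add _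
  have := ge_of_tendsto' hlim fun N => H N k
  simpa using this

/-- staying orbits -/
def Stay (f : En n → En n) (c : En n) (r : ℝ) (z : En n) : Prop := ∀ k, f^[k] z ∈ closedBall c r

theorem Stay.iter {z : En n} (h : Stay f c r z) (l : ℕ) : Stay f c r (f^[l] z) := fun k => by
  rw [← iterate_add_apply]; exact h _

theorem stay_cmp (hβ : ‖β‖ ≤ 1 / 4) (h : InW i0 β c r f) {ε : ℝ} (hε : ∀ z ∈ closedBall c r, ‖f' z - f z‖ ≤ ε)
    {z z' : En n} (hz : Stay f c r z) (hz' : Stay f' c r z') :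
    ‖z - z'‖ ≤ 64 / 27 * (‖pc i0 (z - z')‖ + 2 * ε) :=
  compare hβ h hε hz hz' (fun k => iterate_succ_apply' f k z) (fun k => iterate_succ_apply' f' k z') 0

theorem stay_cmp' (hβ : ‖β‖ ≤ 1 / 4) (h : InW i0 β c r f)
    {z z' : En n} (hz : Stay f c r z) (hz' : Stay f c r z') :
    ‖z - z'‖ ≤ 64 / 27 * ‖pc i0 (z - z')‖ := by
  have := stay_cmp hβ h (ε := 0) (f' := f) (fun z _ => by simp) hz hz'
  simpa using this

theorem stay_uniq (hβ : ‖β‖ ≤ 1 / 4) (h : InW i0 β c r f)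
    {z z' : En n} (hz : Stay f c r z) (hz' : Stay f c r z') (he : pc i0 z = pc i0 z') : z = z' := by
  have := stay_cmp' hβ h hz hz'
  rw [map_sub, he, sub_self, norm_zero, mul_zero] at this
  exact sub_eq_zero.1 (norm_le_zero_iff.1 this)

theorem stay_contr (hβ : ‖β‖ ≤ 1 / 4) (h : InW i0 β c r f)
    {z z' : En n} (hz : Stay f c r z) (hz' : Stay f c r z') (k : ℕ) :
    ‖f^[k] z - f^[k] z'‖ ≤ 64 / 27 * (2 * r) / 2 ^ k := by
  have hP : ‖pc i0 (f^[k] z - f^[k] z')‖ ≤ 2 * r / 2 ^ k := by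
    induction k with
    | zero =>
      refine (pc_le _ _).trans ?_
      have h1 := hz 0; have h2 := hz' 0
      rw [mem_closedBall] at h1 h2
      rw [← dist_eq_norm]
      simp only [pow_zero, div_one]
      linarith [dist_triangle_right (f^[0] z) (f^[0] z') c]
    | succ k ih =>
      have h1 := stay_cmp' hβ h (hz.iter k) (hz'.iter k)
      have h2 := h.lip' (hz k) (hz' k)
      have h3 := core_succ (i0 := i0) hβ (a := f^[k] z - f^[k] z') (a' := f^[k+1] z - f^[k+1] z') (le_of_eq (norm_Ps i0 _)) (h2)
        (by rw [iterate_succ_apply', iterate_succ_apply']; abel)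
      rw [norm_Ps] at h3
      rw [pow_succ]
      have : 2 * r / (2 ^ k * 2) = (2 * r / 2 ^ k) / 2 := by field_simp
      rw [this]
      have := norm_nonneg (pc i0 (f^[k] z - f^[k] z'))
      linarith
  refine (stay_cmp' hβ h (hz.iter k) (hz'.iter k)).trans ?_
  rw [mul_div_assoc]
  gcongr

theorem stay_tendsto (hβ : ‖β‖ ≤ 1 / 4) (h : InW i0 β c r f)
    {z p : En n} (hz : Stay f c r z) (hp : Stay f c r p) (hpp : f p = p) :
    Tendsto (fun k => f^[k] z) atTop (𝓝 p) := by
  rw [tendsto_iff_norm_sub_tendsto_zero]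
  have h1 : Tendsto (fun k : ℕ => 64 / 27 * (2 * r) / 2 ^ k) atTop (𝓝 0) :=
    tendsto_const_nhds.div_atTop (tendsto_pow_atTop_atTop_of_one_lt (by norm_num))
  refine squeeze_zero (fun _ => norm_nonneg _) (fun k => ?_) h1
  have := stay_contr hβ h hz hp k
  rwa [(iterate_fixed hpp k : f^[k] p = p)] at this

theorem stay_of_fix {p : En n} (hp : f p = p) (hpc : p ∈ closedBall c r) : Stay f c r p := fun k => by
  rw [iterate_fixed hp]; exact hpc

theorem exists_fix (hβ : ‖β‖ ≤ 1 / 4) (h : InW i0 β c r f) (hf : Continuous f) {z : En n} (hz : Stay f c r z) :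
    ∃ p, f p = p ∧ p ∈ closedBall c r := by
  have hC : CauchySeq (fun k => f^[k] z) := by
    apply cauchySeq_of_le_geometric_two (C := 2 * (64 / 27 * (2 * r)))
    intro k
    rw [dist_eq_norm]
    have := stay_contr hβ h hz (hz.iter 1) k
    rw [← iterate_add_apply] at this
    refine this.trans (le_of_eq ?_)
    field_simp
  obtain ⟨p, hp⟩ := cauchySeq_tendsto_of_complete hC
  refine ⟨p, ?_, isClosed_closedBall.mem_of_tendsto hp (Eventually.of_forall hz)⟩
  have h1 : Tendsto (fun k => f^[k+1] z) atTop (𝓝 (f p)) := by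
    simp only [iterate_succ_apply']
    exact (hf.tendsto p).comp hp
  exact tendsto_nhds_unique h1 (hp.comp (tendsto_add_atTop_nat 1))

theorem Rest_le (h : InW i0 β c r f) {z : En n} (hz : z ∈ closedBall c r) :
    ‖f z - c - LL i0 β (z - c)‖ ≤ r / 8 := by
  have hr : 0 ≤ r := by
    rw [mem_closedBall] at hz; exact dist_nonneg.trans hz
  have h1 := h.lip' hz (mem_closedBall_self hr)
  have : f z - c - LL i0 β (z - c) = (f z - f c - LL i0 β (z - c)) + (f c - c) := by abel
  rw [this]
  rw [mem_closedBall, dist_eq_norm] at hz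
  refine (norm_add_le _ _).trans ?_
  linarith [h.cen]

theorem fix_bounds (hβ : ‖β‖ ≤ 1 / 4) (h : InW i0 β c r f) {p : En n} (hp : f p = p) (hpc : p ∈ closedBall c r) :
    ‖pc i0 (p - c)‖ ≤ 3 / 8 * r ∧ ‖p - c‖ ≤ 21 / 32 * r := by
  have h1 := Rest_le h hpc
  rw [hp] at h1
  have hs : p - c = LL i0 β (p - c) + (p - c - LL i0 β (p - c)) := by abel
  have h0 : ‖p - c‖ ≤ r := by rwa [mem_closedBall, dist_eq_norm] at hpc
  have h2 := core_succ hβ ((Ps_le i0 _).trans h0) h1 hs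
  have h3 := core_pred (i0 := i0) (β := β) h0 h1 hs
  refine ⟨by rw [norm_Ps] at h2; linarith, (norm_le_su i0 _).trans (by linarith)⟩

theorem hyp_fix (hβ : ‖β‖ ≤ 1 / 4) (h : InW i0 β c r f) (hr : 0 < r) (hf : Differentiable ℂ f) {p : En n} (hp : f p = p)
    (hpc : p ∈ closedBall c r) : HypFixedPt f p := by
  refine ⟨hp, fun μ hμ hμ1 => ?_⟩
  obtain ⟨v, hv⟩ := hμ.exists_hasEigenvector
  have hv0 := hv.2
  have hv1 : fderiv ℂ f p v = μ • v := hv.apply_eq_smul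
  have hb := (fix_bounds hβ h hp hpc).2
  have hD : HasFDerivAt (fun z => f z - LL i0 β z) (fderiv ℂ f p - LL i0 β) p :=
    (hf p).hasFDerivAt.sub (LL i0 β).hasFDerivAt
  have hn : ‖fderiv ℂ f p - LL i0 β‖ ≤ 1 / 16 := by
    apply hD.le_of_lip' (by norm_num)
    have : ball c r ∈ 𝓝 p := isOpen_ball.mem_nhds (by rw [mem_ball, dist_eq_norm]; linarith)
    filter_upwards [this] with x hx
    have := h.lip' (ball_subset_closedBall hx) hpc
    rw [map_sub] at this
    have e2 : (f x - LL i0 β x) - (f p - LL i0 β p) = f x - f p - (LL i0 β x - LL i0 β p) := by abel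
    rw [e2]; exact this
  set e := (fderiv ℂ f p - LL i0 β) v with he
  have hev : ‖e‖ ≤ 1 / 16 * ‖v‖ := (ContinuousLinearMap.le_opNorm _ _).trans (by gcongr)
  have hs : μ • v = LL i0 β v + e := by rw [he, sub_apply, hv1]; abel
  have h1 := congrArg (Ps i0) hs
  have h2 := congrArg (Pu i0) hs
  rw [map_add, Ps_LL, map_smul] at h1
  rw [map_add, Pu_LL, map_smul] at h2
  have h3 : ‖Ps i0 v‖ ≤ 1 / 4 * ‖Ps i0 v‖ + 1 / 16 * ‖v‖ := by
    calc ‖Ps i0 v‖ = ‖μ • Ps i0 v‖ := by rw [norm_smul, hμ1, one_mul]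
      _ ≤ _ := by
        rw [h1]
        refine (norm_add_le _ _).trans (add_le_add ?_ ((Ps_le _ _).trans hev))
        rw [norm_smul]; gcongr
  have h4 : 4 * ‖Pu i0 v‖ ≤ ‖Pu i0 v‖ + 1 / 16 * ‖v‖ := by
    have : (4 : ℂ) • Pu i0 v = μ • Pu i0 v - Pu i0 e := by rw [h2]; abel
    have h5 := congrArg norm this
    rw [norm_smul] at h5
    norm_num at h5
    rw [h5]
    refine (norm_sub_le _ _).trans (add_le_add ?_ ((Pu_le _ _).trans hev))
    rw [norm_smul, hμ1, one_mul]
  have := norm_le_su i0 v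
  have : 0 < ‖v‖ := norm_pos_iff.2 hv0
  linarith

end hyp

section exst
variable {n : ℕ}

def Rm (i0 : Fin n) (β : ℂ) (c : En n) (f : En n → En n) (u : En n) : En n := f (c + u) - c - LL i0 β u

def Tp (i0 : Fin n) (β : ℂ) (c : En n) (f : En n → En n) (ξ : ℂ) (u : ℕ → En n) : ℕ → En n
  | 0 => ξ • eb i0 + (1 / 4 : ℂ) • Pu i0 (u 1 - Rm i0 β c f (u 0))
  | k + 1 => β • Ps i0 (u k) + Ps i0 (Rm i0 β c f (u k)) + (1 / 4 : ℂ) • Pu i0 (u (k + 2) - Rm i0 β c f (u (k + 1)))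

variable {i0 : Fin n} {β : ℂ} {c : En n} {r : ℝ} {f : En n → En n}

theorem mem_cb {u : En n} (h : ‖u‖ ≤ r) : c + u ∈ closedBall c r := by
  rw [mem_closedBall, dist_eq_norm, add_sub_cancel_left]; exact h

theorem Rm_le (h : InW i0 β c r f) {u : En n} (hu : ‖u‖ ≤ r) : ‖Rm i0 β c f u‖ ≤ r / 8 := by
  have := Rest_le h (mem_cb (c := c) hu)
  rwa [add_sub_cancel_left] at this

theorem Rm_lip (h : InW i0 β c r f) {u v : En n} (hu : ‖u‖ ≤ r) (hv : ‖v‖ ≤ r) :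
    ‖Rm i0 β c f u - Rm i0 β c f v‖ ≤ 1 / 16 * ‖u - v‖ := by
  have := h.lip' (mem_cb (c := c) hu) (mem_cb (c := c) hv)
  rw [add_sub_add_left_eq_sub, map_sub] at this
  have e : Rm i0 β c f u - Rm i0 β c f v = f (c + u) - f (c + v) - (LL i0 β u - LL i0 β v) := by
    unfold Rm; abel
  rw [e]; exact this

theorem nquarter (u : En n) : ‖(1 / 4 : ℂ) • Pu i0 u‖ ≤ 1 / 4 * ‖u‖ := by
  rw [norm_smul]
  have := Pu_le i0 u
  norm_num
  exact this

theorem Tp_ball (hβ : ‖β‖ ≤ 1 / 4) (h : InW i0 β c r f) {ξ : ℂ} (hξ : ‖ξ‖ ≤ r / 2) {u : ℕ → En n} (hu : ∀ k, ‖u k‖ ≤ r)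
    (k : ℕ) : ‖Tp i0 β c f ξ u k‖ ≤ r := by
  have hr : 0 ≤ r := (norm_nonneg _).trans (hu 0)
  have h1 : ∀ k, ‖(1 / 4 : ℂ) • Pu i0 (u (k + 1) - Rm i0 β c f (u k))‖ ≤ 1 / 4 * (r + r / 8) := fun k =>
    (nquarter _).trans (by
      have := (norm_sub_le _ _).trans (add_le_add (hu (k + 1)) (Rm_le h (hu k)))
      gcongr)
  cases k with
  | zero =>
    refine (norm_add_le _ _).trans ((add_le_add_right (h1 0) _).trans ?_)
    rw [norm_smul, norm_eb]; linarith
  | succ k =>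
    refine (norm_add_le _ _).trans ((add_le_add (norm_add_le _ _) (h1 (k+1))).trans ?_)
    have h2 : ‖β • Ps i0 (u k)‖ ≤ 1 / 4 * r := by
      rw [norm_smul]; exact mul_le_mul hβ ((Ps_le _ _).trans (hu k)) (norm_nonneg _) (by norm_num)
    have h3 := (Ps_le i0 _).trans (Rm_le h (hu k))
    linarith

theorem Tp_contr (hβ : ‖β‖ ≤ 1 / 4) (h : InW i0 β c r f) {ξ : ℂ} {u v : ℕ → En n} (hu : ∀ k, ‖u k‖ ≤ r)
    (hv : ∀ k, ‖v k‖ ≤ r) {D : ℝ} (hD : ∀ k, ‖u k - v k‖ ≤ D) (k : ℕ) :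
    ‖Tp i0 β c f ξ u k - Tp i0 β c f ξ v k‖ ≤ 37 / 64 * D := by
  have hD0 : 0 ≤ D := (norm_nonneg _).trans (hD 0)
  have hR : ∀ k, ‖Rm i0 β c f (u k) - Rm i0 β c f (v k)‖ ≤ 1 / 16 * D := fun k =>
    (Rm_lip h (hu k) (hv k)).trans (by have := hD k; gcongr)
  have h1 : ∀ k, ‖(1 / 4 : ℂ) • Pu i0 (u (k + 1) - Rm i0 β c f (u k)) - (1 / 4 : ℂ) • Pu i0 (v (k + 1) - Rm i0 β c f (v k))‖
      ≤ 1 / 4 * (D + 1 / 16 * D) := fun k => by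
    rw [← smul_sub, ← map_sub]
    refine (nquarter _).trans ?_
    have e : u (k + 1) - Rm i0 β c f (u k) - (v (k + 1) - Rm i0 β c f (v k)) =
      (u (k+1) - v (k+1)) - (Rm i0 β c f (u k) - Rm i0 β c f (v k)) := by abel
    rw [e]
    have := (norm_sub_le _ _).trans (add_le_add (hD (k + 1)) (hR k))
    gcongr
  cases k with
  | zero =>
    have : Tp i0 β c f ξ u 0 - Tp i0 β c f ξ v 0 = (1 / 4 : ℂ) • Pu i0 (u (0 + 1) - Rm i0 β c f (u 0)) - (1 / 4 : ℂ) • Pu i0 (v (0 + 1) - Rm i0 β c f (v 0)) := by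
      simp only [Tp]; abel
    rw [this]
    linarith [h1 0]
  | succ k =>
    have : Tp i0 β c f ξ u (k+1) - Tp i0 β c f ξ v (k+1) = β • Ps i0 (u k - v k) + Ps i0 (Rm i0 β c f (u k) - Rm i0 β c f (v k)) + ((1 / 4 : ℂ) • Pu i0 (u (k + 1 + 1) - Rm i0 β c f (u (k+1))) - (1 / 4 : ℂ) • Pu i0 (v (k + 1 + 1) - Rm i0 β c f (v (k+1)))) := by
      simp only [Tp, map_sub, smul_sub]; abel
    rw [this]
    refine (norm_add_le _ _).trans ((add_le_add (norm_add_le _ _) (h1 (k+1))).trans ?_)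
    have h2 : ‖β • Ps i0 (u k - v k)‖ ≤ 1 / 4 * D := by
      rw [norm_smul]; exact mul_le_mul hβ ((Ps_le _ _).trans (hD k)) (norm_nonneg _) (by norm_num)
    have h3 := (Ps_le i0 _).trans (hR k)
    linarith

/-- Picard iterates -/
def Pic (i0 : Fin n) (β : ℂ) (c : En n) (f : En n → En n) : ℕ → ℂ → ℕ → En n
  | 0, _ => fun _ => 0
  | N + 1, ξ => Tp i0 β c f ξ (Pic i0 β c f N ξ)

theorem Pic_diff (hf : Differentiable ℂ f) (N k : ℕ) : Differentiable ℂ (fun ξ => Pic i0 β c f N ξ k) := by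
  have hR : Differentiable ℂ (Rm i0 β c f) := by unfold Rm; fun_prop
  induction N generalizing k with
  | zero => simp only [Pic]; fun_prop
  | succ N ih =>
    have hRk : ∀ k, Differentiable ℂ (fun ξ => Rm i0 β c f (Pic i0 β c f N ξ k)) := fun k => hR.comp (ih k)
    have h1 : ∀ k, Differentiable ℂ (fun ξ => (1 / 4 : ℂ) • Pu i0 (Pic i0 β c f N ξ (k + 1) - Rm i0 β c f (Pic i0 β c f N ξ k))) :=
      fun k => by have a1 := ih (k+1); have a2 := hRk k; fun_prop
    cases k with
    | zero =>
      simp only [Pic, Tp]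
      exact (differentiable_id.smul_const _).add (h1 0)
    | succ k =>
      simp only [Pic, Tp]
      have a1 := ih k; have a2 := hRk k; have a3 := h1 (k+1)
      fun_prop

theorem Pic_ball (hβ : ‖β‖ ≤ 1 / 4) (h : InW i0 β c r f) (hr : 0 ≤ r) {ξ : ℂ} (hξ : ‖ξ‖ ≤ r / 2) (N k : ℕ) :
    ‖Pic i0 β c f N ξ k‖ ≤ r := by
  induction N generalizing k with
  | zero => simpa [Pic] using hr
  | succ N ih => exact Tp_ball hβ h hξ ih k

theorem Pic_succ (hβ : ‖β‖ ≤ 1 / 4) (h : InW i0 β c r f) (hr : 0 ≤ r) {ξ : ℂ} (hξ : ‖ξ‖ ≤ r / 2) (N k : ℕ) :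
    ‖Pic i0 β c f N ξ k - Pic i0 β c f (N + 1) ξ k‖ ≤ r * (37 / 64) ^ N := by
  induction N generalizing k with
  | zero =>
    have := Pic_ball hβ h hr hξ 1 k
    have e : Pic i0 β c f 0 ξ k = 0 := rfl
    rw [e, zero_sub, norm_neg]
    simpa using this
  | succ N ih =>
    have := Tp_contr hβ h (ξ := ξ) (Pic_ball hβ h hr hξ N) (Pic_ball hβ h hr hξ (N+1)) ih k
    refine this.trans (le_of_eq ?_)
    rw [pow_succ]; ring

/-- the local stable manifold as a graph -/
theorem exists_graph (hβ : ‖β‖ ≤ 1 / 4) (h : InW i0 β c r f) (hr : 0 < r) (hf : Differentiable ℂ f) :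
    ∃ w : ℂ → En n, DifferentiableOn ℂ w (ball 0 (r / 2)) ∧ ∀ ξ, ‖ξ‖ ≤ r / 2 →
      Stay f c r (w ξ) ∧ pc i0 (w ξ - c) = ξ := by
  have hC : ∀ ξ, ‖ξ‖ ≤ r / 2 → ∀ k, CauchySeq (fun N => Pic i0 β c f N ξ k) := fun ξ hξ k =>
    cauchySeq_of_le_geometric (37 / 64) r (by norm_num) (fun N => by
      rw [dist_eq_norm]; exact Pic_succ hβ h hr.le hξ N k)
  have hL : ∀ ξ : ℂ, ∃ u : ℕ → En n, ‖ξ‖ ≤ r / 2 → ∀ k, Tendsto (fun N => Pic i0 β c f N ξ k) atTop (𝓝 (u k)) := by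
    intro ξ
    by_cases hξ : ‖ξ‖ ≤ r / 2
    · choose u hu using fun k => cauchySeq_tendsto_of_complete (hC ξ hξ k)
      exact ⟨u, fun _ => hu⟩
    · exact ⟨0, fun h => absurd h hξ⟩
  choose u hu using hL
  refine ⟨fun ξ => c + u ξ 0, ?_, ?_⟩
  · have hlu : TendstoUniformlyOn (fun N ξ => Pic i0 β c f N ξ 0) (fun ξ => u ξ 0) atTop (ball 0 (r / 2)) := by
      rw [Metric.tendstoUniformlyOn_iff]
      intro ε hε
      have hlim : Tendsto (fun N : ℕ => r * (37 / 64 : ℝ) ^ N / (1 - 37 / 64)) atTop (𝓝 (r * 0 / (1 - 37 / 64))) :=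
        ((tendsto_pow_atTop_nhds_zero_of_lt_one (by norm_num) (by norm_num)).const_mul _).div_const _
      simp only [mul_zero, zero_div] at hlim
      filter_upwards [hlim.eventually_lt_const hε] with N hN ξ hξ
      have hξ' : ‖ξ‖ ≤ r / 2 := by rw [mem_ball_zero_iff] at hξ; exact hξ.le
      rw [dist_comm]
      refine lt_of_le_of_lt ?_ hN
      exact dist_le_of_le_geometric_of_tendsto (37 / 64) r (by norm_num) (fun N => by
        rw [dist_eq_norm]; exact Pic_succ hβ h hr.le hξ' N 0) (hu ξ hξ' 0) N
    have := hlu.tendstoLocallyUniformlyOn.differentiableOn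
      (Eventually.of_forall fun N => (Pic_diff hf N 0).differentiableOn) isOpen_ball
    exact (differentiableOn_const c).add this
  · intro ξ hξ
    have hub : ∀ k, ‖u ξ k‖ ≤ r := fun k => le_of_tendsto (hu ξ hξ k).norm
      (Eventually.of_forall fun N => Pic_ball hβ h hr.le hξ N k)
    have hRc : Continuous (Rm i0 β c f) := by
      have := hf.continuous
      unfold Rm; fun_prop
    have hRt : ∀ k, Tendsto (fun N => Rm i0 β c f (Pic i0 β c f N ξ k)) atTop (𝓝 (Rm i0 β c f (u ξ k))) := fun k =>
      (hRc.tendsto _).comp (hu ξ hξ k)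
    have hq : ∀ k, Tendsto (fun N => (1 / 4 : ℂ) • Pu i0 (Pic i0 β c f N ξ (k + 1) - Rm i0 β c f (Pic i0 β c f N ξ k))) atTop
        (𝓝 ((1 / 4 : ℂ) • Pu i0 (u ξ (k + 1) - Rm i0 β c f (u ξ k)))) := fun k =>
      (((Pu i0).continuous.tendsto _).comp ((hu ξ hξ (k+1)).sub (hRt k))).const_smul _
    have e0 : u ξ 0 = ξ • eb i0 + (1 / 4 : ℂ) • Pu i0 (u ξ 1 - Rm i0 β c f (u ξ 0)) :=
      tendsto_nhds_unique ((hu ξ hξ 0).comp (tendsto_add_atTop_nat 1)) ((hq 0).const_add _)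
    have e1 : ∀ k, u ξ (k+1) = β • Ps i0 (u ξ k) + Ps i0 (Rm i0 β c f (u ξ k)) + (1 / 4 : ℂ) • Pu i0 (u ξ (k + 2) - Rm i0 β c f (u ξ (k + 1))) := fun k =>
      tendsto_nhds_unique ((hu ξ hξ (k+1)).comp (tendsto_add_atTop_nat 1))
        (((((Ps i0).continuous.tendsto _).comp (hu ξ hξ k)).const_smul β |>.add
          (((Ps i0).continuous.tendsto _).comp (hRt k))).add (hq (k+1)))
    have f0 : pc i0 (u ξ 0) = ξ := by
      have := congrArg (pc i0) e0
      rw [map_add, map_smul, map_smul, pc_eb, pc_Pu] at this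
      simpa using this
    have f1 : ∀ k, (4 : ℂ) • Pu i0 (u ξ k) = Pu i0 (u ξ (k + 1)) - Pu i0 (Rm i0 β c f (u ξ k)) := by
      intro k
      have : Pu i0 (u ξ k) = (1 / 4 : ℂ) • Pu i0 (u ξ (k + 1) - Rm i0 β c f (u ξ k)) := by
        cases k with
        | zero =>
          conv_lhs => rw [e0]
          have : Pu i0 (eb i0 : En n) = 0 := by
            rw [Pu_apply, Ps_apply, pc_eb, one_smul, sub_self]
          rw [map_add, map_smul, map_smul, Pu_Pu, this, smul_zero, zero_add]
        | succ k =>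
          conv_lhs => rw [e1 k]
          rw [map_add, map_add, map_smul, map_smul, Pu_Pu, Pu_Ps, Pu_Ps, smul_zero, zero_add, zero_add]
      rw [this, smul_smul, map_sub]
      norm_num
    have f2 : ∀ k, Ps i0 (u ξ (k+1)) = β • Ps i0 (u ξ k) + Ps i0 (Rm i0 β c f (u ξ k)) := by
      intro k
      conv_lhs => rw [e1 k]
      rw [map_add, map_add, map_smul, map_smul, Ps_Ps, Ps_Ps, Ps_Pu, smul_zero, add_zero]
    have f3 : ∀ k, c + u ξ (k + 1) = f (c + u ξ k) := by
      intro k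
      have : u ξ (k+1) = LL i0 β (u ξ k) + Rm i0 β c f (u ξ k) := by
        rw [← Ps_add_Pu i0 (u ξ (k+1)), f2, LL_apply, f1]
        have e := Ps_add_Pu i0 (Rm i0 β c f (u ξ k))
        calc _ = β • Ps i0 (u ξ k) + (Pu i0 (u ξ (k + 1)) - Pu i0 (Rm i0 β c f (u ξ k))) +
              (Ps i0 (Rm i0 β c f (u ξ k)) + Pu i0 (Rm i0 β c f (u ξ k))) := by abel
          _ = _ := by rw [e]
      rw [this, Rm]; abel
    have f4 : ∀ k, f^[k] (c + u ξ 0) = c + u ξ k := by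
      intro k
      induction k with
      | zero => rfl
      | succ k ih => rw [iterate_succ_apply', ih, f3]
    refine ⟨fun k => ?_, ?_⟩
    · rw [f4]; exact mem_cb (hub k)
    · rw [add_sub_cancel_left, f0]

/-- the fixed point -/
theorem exists_p (hβ : ‖β‖ ≤ 1 / 4) (h : InW i0 β c r f) (hr : 0 < r) (hf : Differentiable ℂ f) :
    ∃ p, f p = p ∧ p ∈ closedBall c r ∧ ∀ z, Stay f c r z → z ∈ StableSet f p := by
  obtain ⟨w, -, hw⟩ := exists_graph hβ h hr hf
  obtain ⟨p, hp, hpc⟩ := exists_fix hβ h hf.continuous (hw 0 (by simpa using by positivity)).1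
  exact ⟨p, hp, hpc, fun z hz => stay_tendsto hβ h hz (stay_of_fix hp hpc) hp⟩

theorem stable_stay (hβ : ‖β‖ ≤ 1 / 4) (h : InW i0 β c r f) (hr : 0 < r) {p q : En n} (hp : f p = p)
    (hpc : p ∈ closedBall c r) (hq : q ∈ StableSet f p) :
    ∃ N0, ∀ N ≥ N0, f^[N] q ∈ ball c r ∧ ‖pc i0 (f^[N] q - c)‖ < r / 2 := by
  obtain ⟨b1, b2⟩ := fix_bounds hβ h hp hpc
  have h1 : ∀ᶠ N in atTop, f^[N] q ∈ ball c r := hq (isOpen_ball.mem_nhds (by rw [mem_ball, dist_eq_norm]; linarith))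
  have h2 : Tendsto (fun N => ‖pc i0 (f^[N] q - c)‖) atTop (𝓝 ‖pc i0 (p - c)‖) :=
    (((pc i0).continuous.tendsto _).comp (Tendsto.sub_const hq c)).norm
  exact eventually_atTop.1 (h1.and (h2.eventually_lt_const (by linarith)))

theorem stable_unbdd (hβ : ‖β‖ ≤ 1 / 4) (h : InW i0 β c r f) (hr : 0 < r) (hf : VA f) {p : En n} (hp : f p = p)
    (hpc : p ∈ closedBall c r) (B : ℝ) : ∃ q ∈ StableSet f p, B < ‖q‖ := by
  by_contra hcon
  push Not at hcon
  obtain ⟨g, hg, hgf, hfg⟩ := hf.1.2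
  obtain ⟨w, hwd, hw⟩ := exists_graph hβ h hr hf.diff
  obtain ⟨b1, b2⟩ := fix_bounds hβ h hp hpc
  have hps := stay_of_fix hp hpc
  have hst : ∀ ξ, ‖ξ‖ ≤ r / 2 → ∀ l, g^[l] (w ξ) ∈ StableSet f p := by
    intro ξ hξ l
    have h1 : Tendsto (fun k => f^[k] (w ξ)) atTop (𝓝 p) := stay_tendsto hβ h (hw ξ hξ).1 hps hp
    show Tendsto _ _ _
    rw [← tendsto_add_atTop_iff_nat l]
    refine h1.congr fun k => ?_
    rw [iterate_add_apply, (hfg.iterate l) (w ξ)]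
  set ξs := pc i0 (p - c) with hξs
  have hball : ball ξs (r / 8) ⊆ ball 0 (r / 2) := ball_subset_ball' (by rw [dist_zero_right]; linarith)
  have hns : ∀ ξ ∈ ball ξs (r / 8), ‖ξ‖ ≤ r / 2 := fun ξ hξ => by
    have := hball hξ; rw [mem_ball_zero_iff] at this; exact this.le
  have hwξ : w ξs = p := by
    refine stay_uniq hβ h (hw ξs (by linarith)).1 hps ?_
    have := (hw ξs (by linarith)).2
    rw [hξs, map_sub, map_sub] at this
    exact sub_left_injective this
  have hB : 0 ≤ B := (norm_nonneg _).trans (hcon p (by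
    show Tendsto _ _ _
    simp only [iterate_fixed hp]; exact tendsto_const_nhds))
  have hgp : ∀ l, g^[l] p = p := fun l => iterate_fixed (by rw [← hp, hgf, hp]) l
  let ξ0 := ξs + r / 16
  have hξ0n : ‖ξ0‖ ≤ r / 2 := by
    apply hns
    rw [mem_ball, dist_eq_norm]
    simp only [ξ0, add_sub_cancel_left]
    rw [norm_div, Complex.norm_real, Real.norm_of_nonneg hr.le]
    norm_num
    linarith
  let ξl : ℕ → ℂ := fun l => pc i0 (f^[l] (w ξ0) - c)
  have hlim : Tendsto (fun l => f^[l] (w ξ0)) atTop (𝓝 p) := stay_tendsto hβ h (hw ξ0 hξ0n).1 hps hp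
  have hξl : Tendsto ξl atTop (𝓝 ξs) := ((pc i0).continuous.tendsto _).comp (hlim.sub_const c)
  have hest : ∀ᶠ l in atTop, dist (w ξ0) p ≤ (2 * B + 1) / (r / 8) * dist (ξl l) ξs := by
    filter_upwards [hξl (ball_mem_nhds ξs (show 0 < r / 8 by positivity))] with l hl
    have hl : ξl l ∈ ball ξs (r / 8) := hl
    have hd : DifferentiableOn ℂ (fun ξ => g^[l] (w ξ)) (ball ξs (r / 8)) :=
      (hg.iterate l).comp_differentiableOn (hwd.mono hball)
    have hm : MapsTo (fun ξ => g^[l] (w ξ)) (ball ξs (r / 8)) (ball (g^[l] (w ξs)) (2 * B + 1)) := by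
      intro ξ hξ
      have a1 := hcon _ (hst ξ (hns ξ hξ) l)
      have a2 := hcon _ (hst ξs (by linarith) l)
      rw [mem_ball, dist_eq_norm]
      refine (norm_sub_le _ _).trans_lt ?_
      linarith
    have := Complex.dist_le_div_mul_dist_of_mapsTo_ball hd (hm.mono_right ball_subset_closedBall) hl
    have hwl : w (ξl l) = f^[l] (w ξ0) := by
      refine stay_uniq hβ h (hw _ (hns _ hl)).1 ((hw ξ0 hξ0n).1.iter l) ?_
      have e := (hw _ (hns _ hl)).2
      have e' : pc i0 (w (ξl l) - c) = pc i0 (f^[l] (w ξ0) - c) := e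
      rw [map_sub, map_sub] at e'
      exact sub_left_injective e'
    rw [hwl, hwξ, (hgf.iterate l) (w ξ0), hgp] at this
    exact this
  have hz : Tendsto (fun l => (2 * B + 1) / (r / 8) * dist (ξl l) ξs) atTop (𝓝 ((2 * B + 1) / (r / 8) * 0)) :=
    (tendsto_iff_dist_tendsto_zero.1 hξl).const_mul _
  rw [mul_zero] at hz
  have hd0 : dist (w ξ0) p ≤ 0 := ge_of_tendsto hz hest
  have : w ξ0 = p := dist_le_zero.1 hd0
  have e := (hw ξ0 hξ0n).2
  rw [this, ← hξs] at e
  simp [ξ0] at e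
  exact hr.ne' e

theorem iter_ne_id (hβ : ‖β‖ ≤ 1 / 4) (h : InW i0 β c r f) (hr : 0 < r) (hf : VA f) (k : ℕ) (hk : 1 ≤ k) : f^[k] ≠ id := by
  intro he
  obtain ⟨p, hp, hpc, -⟩ := exists_p hβ h hr hf.diff
  obtain ⟨q, hq, hqB⟩ := stable_unbdd hβ h hr hf hp hpc ‖p‖
  have h1 : Tendsto (fun l => f^[k * l] q) atTop (𝓝 p) :=
    Tendsto.comp hq (tendsto_id.const_mul_atTop' hk)
  have h2 : ∀ l, f^[k * l] q = q := fun l => by rw [iterate_mul, he, iterate_id]; rfl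
  simp only [h2] at h1
  have := tendsto_nhds_unique h1 tendsto_const_nhds
  rw [this] at hqB
  exact lt_irrefl _ hqB

end exst

section conn
open Matrix in
theorem diag2n_dec {n : ℕ} {i j : Fin n} (h : i ≠ j) (c : ℂ) (hc : c ≠ 0) :
    SpecialLinearGroup.diag2n h c hc = SpecialLinearGroup.transvection h c *
      (SpecialLinearGroup.transvection h.symm (- c⁻¹) *
      (SpecialLinearGroup.transvection h c *
      (SpecialLinearGroup.transvection h (-1) *
      (SpecialLinearGroup.transvection h.symm 1 *
      SpecialLinearGroup.transvection h (-1))))) := by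
  have key : ∀ i j : Fin n, ∀ a : ℂ, ∀ x : Fin n → ℂ, ((1 + single i j a : Matrix (Fin n) (Fin n) ℂ) *ᵥ x) = fun p => if p = i then x p + a * x j else x p := by
    intro i j a x
    ext p
    simp [add_mulVec, single_mulVec, Function.update_apply]
    split_ifs <;> simp [*]
  apply Subtype.ext
  change diagonal (fun k => if k = i then c else if k = j then c⁻¹ else 1) = (1 + single i j c) *
    ((1 + single j i (-c⁻¹)) * ((1 + single i j c) * ((1 + single i j (-1)) * ((1 + single j i 1) * (1 + single i j (-1))))))
  apply Matrix.ext_of_mulVec_single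
  intro q
  simp only [← mulVec_mulVec, key]
  ext p
  rw [mulVec_diagonal]
  generalize (Pi.single q 1 : Fin n → ℂ) = x
  by_cases hp : p = i
  · subst hp; simp [h, h.symm]; field_simp; ring
  · by_cases hq : p = j
    · subst hq; simp [h, h.symm]; field_simp; ring
    · simp [hp, hq]

variable {n : ℕ}

def Conn (R0 : ℝ) (a b : En n) (M : En n →L[ℂ] En n) : Prop :=
  ∀ R < R0, ∃ ρ > 0, ∀ ε > 0, ∃ φ : En n → En n, VA φ ∧ (∀ z ∈ closedBall (0 : En n) R, ‖φ z - z‖ ≤ ε) ∧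
    (∀ z ∈ closedBall a ρ, ‖φ z - (b + M (z - a))‖ ≤ ε)

theorem Conn.trans {R0 : ℝ} {a b c : En n} {M N : En n →L[ℂ] En n} (h1 : Conn R0 a b M) (h2 : Conn R0 b c N) :
    Conn R0 a c (N * M) := by
  intro R hR
  obtain ⟨ρ1, hρ1, h1⟩ := h1 R hR
  obtain ⟨ρ2, hρ2, h2⟩ := h2 ((R + R0) / 2) (by linarith)
  refine ⟨min ρ1 (ρ2 / (2 * (‖M‖ + 1))), by positivity, fun ε hε => ?_⟩
  obtain ⟨φ, hφ, hφ1, hφ2⟩ := h1 (min (min ((R0 - R) / 2) (ρ2 / 2)) (min (ε / (2 * (‖N‖ + 1))) (ε / 2)))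
    (by have : 0 < R0 - R := by linarith
        positivity)
  obtain ⟨ψ, hψ, hψ1, hψ2⟩ := h2 (ε / 2) (by positivity)
  refine ⟨ψ ∘ φ, hψ.comp hφ, fun z hz => ?_, fun z hz => ?_⟩
  · have h3 := hφ1 z hz
    simp only [le_min_iff] at h3
    obtain ⟨⟨h3, h4⟩, h5, h6⟩ := h3
    have h7 := hψ1 (φ z) (by
      rw [mem_closedBall, dist_zero_right] at *
      calc ‖φ z‖ = ‖(φ z - z) + z‖ := by congr 1; abel
        _ ≤ ‖φ z - z‖ + ‖z‖ := norm_add_le _ _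
        _ ≤ _ := by linarith)
    calc ‖(ψ ∘ φ) z - z‖ = ‖(ψ (φ z) - φ z) + (φ z - z)‖ := by simp
      _ ≤ ‖ψ (φ z) - φ z‖ + ‖φ z - z‖ := norm_add_le _ _
      _ ≤ ε := by linarith
  · have hz1 : z ∈ closedBall a ρ1 := closedBall_subset_closedBall (min_le_left _ _) hz
    have hz2 : ‖z - a‖ ≤ ρ2 / (2 * (‖M‖ + 1)) := by
      rw [← dist_eq_norm]; exact closedBall_subset_closedBall (min_le_right _ _) hz
    have h3 := hφ2 z hz1
    simp only [le_min_iff] at h3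
    obtain ⟨⟨h3, h4⟩, h5, h6⟩ := h3
    have hM : ‖M (z - a)‖ ≤ ρ2 / 2 := by
      calc ‖M (z - a)‖ ≤ ‖M‖ * ‖z - a‖ := M.le_opNorm _
        _ ≤ (‖M‖ + 1) * (ρ2 / (2 * (‖M‖ + 1))) := by gcongr; linarith
        _ = ρ2 / 2 := by have : ‖M‖ + 1 ≠ 0 := by positivity
                         field_simp
    have h7 := hψ2 (φ z) (by
      rw [mem_closedBall, dist_eq_norm]
      calc ‖φ z - b‖ = ‖(φ z - (b + M (z - a))) + M (z - a)‖ := by congr 1; abel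
        _ ≤ ‖φ z - (b + M (z - a))‖ + ‖M (z - a)‖ := norm_add_le _ _
        _ ≤ ρ2 := by linarith)
    have hN : ‖N (φ z - (b + M (z - a)))‖ ≤ ε / 2 := by
      calc ‖N (φ z - (b + M (z - a)))‖ ≤ ‖N‖ * ‖φ z - (b + M (z - a))‖ := N.le_opNorm _
        _ ≤ (‖N‖ + 1) * (ε / (2 * (‖N‖ + 1))) := by gcongr; linarith
        _ = ε / 2 := by have : ‖N‖ + 1 ≠ 0 := by positivity
                        field_simp
    have e : (ψ ∘ φ) z - (c + (N * M) (z - a)) = (ψ (φ z) - (c + N (φ z - b))) + N (φ z - (b + M (z - a))) := by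
      simp only [comp_apply, ContinuousLinearMap.mul_apply, map_sub, map_add]
      abel
    rw [e]
    exact (norm_add_le _ _).trans (by linarith)

/-- the smoothing polynomial -/
def Pw (w : ℂ) : ℂ := 3 * w ^ 2 - 2 * w ^ 3

theorem Pw_small {w : ℂ} (h : ‖w‖ ≤ 1 / 10) : ‖Pw w‖ ≤ ‖w‖ / 2 := by
  have e : Pw w = w * (w * (3 - 2 * w)) := by unfold Pw; ring
  have h1 : ‖3 - 2 * w‖ ≤ 4 := by
    calc ‖3 - 2 * w‖ ≤ ‖(3 : ℂ)‖ + ‖2 * w‖ := norm_sub_le _ _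
      _ = 3 + 2 * ‖w‖ := by simp
      _ ≤ 4 := by linarith
  rw [e, norm_mul, norm_mul]
  have : ‖w‖ * ‖3 - 2 * w‖ ≤ 1 / 10 * 4 := by gcongr
  nlinarith [norm_nonneg w]

theorem Pw_iter {w : ℂ} (h : ‖w‖ ≤ 1 / 10) (k : ℕ) : ‖Pw^[k] w‖ ≤ (1 / 2) ^ k * ‖w‖ := by
  induction k with
  | zero => simp
  | succ k ih =>
    rw [iterate_succ_apply']
    have h1 : ‖Pw^[k] w‖ ≤ 1 / 10 := by
      have : ((1 : ℝ) / 2) ^ k ≤ 1 := pow_le_one₀ (by norm_num) (by norm_num)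
      nlinarith [norm_nonneg w]
    have := Pw_small h1
    rw [pow_succ]; linarith

theorem Pw_iter_one (w : ℂ) (k : ℕ) : Pw^[k] (1 - w) = 1 - Pw^[k] w := by
  induction k with
  | zero => simp
  | succ k ih =>
    rw [iterate_succ_apply', iterate_succ_apply', ih]; unfold Pw; ring

theorem Pw_iter_diff (k : ℕ) : Differentiable ℂ (Pw^[k]) := by
  induction k with
  | zero => exact differentiable_id
  | succ k ih => rw [iterate_succ']; refine Differentiable.comp ?_ ih; unfold Pw; fun_prop

theorem conn_basic {R0 : ℝ} (hR0 : 0 < R0) {a v : En n} (l : En n →L[ℂ] ℂ) (hl : l v = 0) (ha : l a ≠ 0)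
    (hla : R0 * ‖l‖ ≤ ‖l a‖) (s t : ℂ) : Conn R0 a (a + s • v) (1 + t • l.smulRight v) := by
  intro R hR
  set q := max R 0 / R0 with hq
  have hq0 : 0 ≤ q := by positivity
  have hq1 : q < 1 := by rw [hq, div_lt_one hR0]; exact max_lt hR hR0
  obtain ⟨m, hm⟩ := exists_pow_lt_of_lt_one (show (0:ℝ) < 1 / 10 by norm_num) hq1
  have hcont : Continuous (fun z : En n => (l z / l a) ^ m) := by fun_prop
  obtain ⟨ρ, hρ, hρ'⟩ := Metric.continuous_iff.1 hcont a (1/10) (by norm_num)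
  refine ⟨ρ / 2, by positivity, fun ε hε => ?_⟩
  set K := (‖s‖ + ‖t‖ * (‖l‖ * (|R| + ‖a‖ + ρ))) * ‖v‖ with hK
  have hK0 : 0 ≤ K := by positivity
  obtain ⟨k, hk⟩ := exists_pow_lt_of_lt_one (show 0 < ε / (K + 1) by positivity) (show (1/2:ℝ) < 1 by norm_num)
  have hkK : (1/2:ℝ)^k * K ≤ ε := by
    rw [lt_div_iff₀ (by positivity)] at hk
    have : (0:ℝ) < (1/2)^k := by positivity
    nlinarith
  let F : ℂ → ℂ := fun ζ => Pw^[k] ((ζ / l a) ^ m) * (s + t * (ζ - l a))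
  have hF : Differentiable ℂ F := by
    have h1 : Differentiable ℂ (fun ζ : ℂ => Pw^[k] ((ζ / l a) ^ m)) :=
      (Pw_iter_diff k).comp (by fun_prop : Differentiable ℂ (fun ζ : ℂ => (ζ / l a) ^ m))
    exact h1.mul (by fun_prop)
  have hlin : ∀ z : En n, ‖z - a‖ ≤ |R| + ‖a‖ + ρ → ‖(s + t * (l z - l a)) • v‖ ≤ K := by
    intro z hz
    rw [norm_smul, hK]
    gcongr
    refine (norm_add_le _ _).trans ?_
    rw [norm_mul, ← map_sub]
    gcongr
    exact (l.le_opNorm _).trans (by gcongr)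
  refine ⟨fun z => z + F (l z) • v, VA.shear hF l v hl, fun z hz => ?_, fun z hz => ?_⟩
  · rw [mem_closedBall, dist_zero_right] at hz
    have hR' : R = |R| := (abs_of_nonneg ((norm_nonneg z).trans hz)).symm
    have h1 : ‖(l z / l a) ^ m‖ ≤ 1 / 10 := by
      rw [norm_pow]
      refine le_trans ?_ hm.le
      gcongr
      rw [norm_div, div_le_iff₀ (norm_pos_iff.2 ha), hq, div_mul_eq_mul_div, le_div_iff₀ hR0]
      calc ‖l z‖ * R0 ≤ ‖l‖ * ‖z‖ * R0 := by gcongr; exact l.le_opNorm _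
        _ = ‖z‖ * (R0 * ‖l‖) := by ring
        _ ≤ max R 0 * ‖l a‖ := by gcongr; exact hz.trans (le_max_left _ _)
    have h2 := Pw_iter h1 k
    have h3 := hlin z (by
      calc ‖z - a‖ ≤ ‖z‖ + ‖a‖ := norm_sub_le _ _
        _ ≤ _ := by linarith)
    rw [add_sub_cancel_left]
    simp only [F]
    rw [mul_smul, norm_smul]
    refine le_trans ?_ hkK
    gcongr
    refine h2.trans ?_
    have : (0:ℝ) < (1/2)^k := by positivity
    nlinarith
  · rw [mem_closedBall, dist_eq_norm] at hz
    have h1 : ‖1 - (l z / l a) ^ m‖ ≤ 1 / 10 := by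
      have := hρ' z (by rw [dist_eq_norm]; linarith)
      rw [div_self ha, one_pow, dist_eq_norm] at this
      rw [norm_sub_rev]; exact this.le
    have h2 := Pw_iter h1 k
    rw [Pw_iter_one] at h2
    have h3 := hlin z (by linarith [abs_nonneg R, norm_nonneg a])
    have e : z + F (l z) • v - (a + s • v + (1 + t • l.smulRight v) (z - a)) =
        (-(1 - Pw^[k] ((l z / l a) ^ m))) • ((s + t * (l z - l a)) • v) := by
      simp only [F, add_apply, smul_apply, ContinuousLinearMap.one_apply, ContinuousLinearMap.smulRight_apply, map_sub]
      module
    rw [e, norm_smul, norm_neg]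
    refine le_trans ?_ hkK
    gcongr
    refine h2.trans ?_
    have : (0:ℝ) < (1/2)^k := by positivity
    nlinarith
end conn

section conn2
variable {n : ℕ}

theorem conn_move {R0 : ℝ} (hR0 : 0 < R0) {a b d : En n} (hd : R0 ≤ ‖d‖)
    (h1 : inner ℂ d a = (‖d‖ : ℂ) ^ 2) (h2 : inner ℂ d b = (‖d‖ : ℂ) ^ 2) : Conn R0 a b 1 := by
  have h := conn_basic hR0 (a := a) (v := b - a) (innerSL ℂ d)
    (by simp [h1, h2, inner_sub_right])
    (by rw [innerSL_apply_apply, h1]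
        have : (‖d‖ : ℂ) ≠ 0 := by
          norm_cast; linarith
        positivity)
    (by rw [innerSL_apply_apply, h1, innerSL_apply_norm, norm_pow, Complex.norm_real, norm_norm, sq]; gcongr) 1 0
  have e : (1 + (0 : ℂ) • (innerSL ℂ d).smulRight (b - a) : En n →L[ℂ] En n) = 1 := by
    ext x; simp
  rw [one_smul, e, add_sub_cancel] at h
  exact h

theorem inner_self_c (a : En n) : inner ℂ a a = (‖a‖ : ℂ) ^ 2 := by
  exact inner_self_eq_norm_sq_to_K a

theorem conn_perp {R0 : ℝ} (hR0 : 0 < R0) {a d : En n} (ha : R0 ≤ ‖a‖) (hd : R0 ≤ ‖d‖)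
    (h : inner ℂ a d = 0) : Conn R0 a d 1 := by
  have h' : inner ℂ d a = 0 := inner_eq_zero_symm.1 h
  have h1 : Conn R0 a (a + d) 1 := conn_move hR0 ha (inner_self_c a) (by rw [inner_add_right, h, inner_self_c, add_zero])
  have h2 : Conn R0 (a + d) d 1 := conn_move hR0 hd (by rw [inner_add_right, h', inner_self_c, zero_add]) (inner_self_c d)
  simpa using h1.trans h2

theorem exists_perp (hn : 2 ≤ n) {R0 : ℝ} (hR0 : 0 < R0) (a : En n) : ∃ d : En n, inner ℂ a d = 0 ∧ ‖d‖ = R0 := by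
  have h := LinearMap.ker_ne_bot_of_finrank_lt (f := (innerSL ℂ a).toLinearMap) (by simp; omega)
  obtain ⟨d, hd, hd0⟩ := (Submodule.ne_bot_iff _).1 h
  have hd' : inner ℂ a d = 0 := hd
  refine ⟨((R0 / ‖d‖ : ℝ) : ℂ) • d, by rw [inner_smul_right, hd', mul_zero], ?_⟩
  have : 0 < ‖d‖ := norm_pos_iff.2 hd0
  rw [norm_smul, Complex.norm_real, Real.norm_of_nonneg (by positivity)]
  field_simp

theorem conn_any (hn : 2 ≤ n) {R0 : ℝ} (hR0 : 0 < R0) {a b : En n} (ha : R0 ≤ ‖a‖) (hb : R0 ≤ ‖b‖) :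
    Conn R0 a b 1 := by
  have ha0 : (‖a‖ : ℂ) ≠ 0 := by norm_cast; linarith
  set α : ℂ := inner ℂ a b / (‖a‖ : ℂ) ^ 2 with hα
  set b' := b - α • a with hb'
  have hab' : inner ℂ a b' = 0 := by
    rw [hb', inner_sub_right, inner_smul_right, inner_self_c, hα]; field_simp; ring
  by_cases h0 : b' = 0
  · obtain ⟨d, hd, hd'⟩ := exists_perp hn hR0 a
    have h1 := conn_perp hR0 ha hd'.ge hd
    have h2 : Conn R0 d b 1 := by
      apply conn_perp hR0 hd'.ge hb
      rw [show b = α • a from sub_eq_zero.1 h0, inner_smul_right, inner_eq_zero_symm.1 hd, mul_zero]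
    simpa using h1.trans h2
  · have hb0 : (‖b'‖ : ℂ) ≠ 0 := by norm_cast; exact (norm_pos_iff.2 h0).ne'
    have hbb : inner ℂ b b' = (‖b'‖ : ℂ) ^ 2 := by
      have : b = b' + α • a := by rw [hb']; abel
      conv_lhs => rw [this]
      rw [inner_add_left, inner_smul_left, hab', inner_self_c]; simp
    set τ : ℂ := ((‖b‖ : ℂ) ^ 2 - inner ℂ b a) / (‖b'‖ : ℂ) ^ 2 with hτ
    have h1 : Conn R0 a (a + τ • b') 1 := conn_move hR0 ha (inner_self_c a)
      (by rw [inner_add_right, inner_smul_right, hab', inner_self_c]; simp)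
    have h2 : Conn R0 (a + τ • b') b 1 := conn_move hR0 hb
      (by rw [inner_add_right, inner_smul_right, hbb, hτ]; field_simp; ring) (inner_self_c b)
    simpa using h1.trans h2

open Matrix in
theorem conn_mat (hn : 2 ≤ n) {R0 : ℝ} (hR0 : 0 < R0) (A : SpecialLinearGroup (Fin n) ℂ) :
    Conn R0 (WithLp.toLp 2 (fun _ => (R0 : ℂ)) : En n) (WithLp.toLp 2 (fun _ => (R0 : ℂ)))
      (Matrix.toEuclideanCLM (n := Fin n) (𝕜 := ℂ) A.1) := by
  have : Nontrivial (Fin n) := Fin.nontrivial_iff_two_le.2 hn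
  have hmul : ∀ A B : SpecialLinearGroup (Fin n) ℂ, Conn R0 (WithLp.toLp 2 (fun _ => (R0 : ℂ)) : En n) (WithLp.toLp 2 (fun _ => (R0 : ℂ)))
      (Matrix.toEuclideanCLM (n := Fin n) (𝕜 := ℂ) A.1) → Conn R0 (WithLp.toLp 2 (fun _ => (R0 : ℂ)) : En n) (WithLp.toLp 2 (fun _ => (R0 : ℂ)))
      (Matrix.toEuclideanCLM (n := Fin n) (𝕜 := ℂ) B.1) → Conn R0 (WithLp.toLp 2 (fun _ => (R0 : ℂ)) : En n) (WithLp.toLp 2 (fun _ => (R0 : ℂ)))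
      (Matrix.toEuclideanCLM (n := Fin n) (𝕜 := ℂ) (A * B).1) := by
    intro A B hA hB
    have := hB.trans hA
    rw [← map_mul] at this
    exact this
  have htr : ∀ (i j : Fin n) (h : i ≠ j) (c : ℂ), Conn R0 (WithLp.toLp 2 (fun _ => (R0 : ℂ)) : En n) (WithLp.toLp 2 (fun _ => (R0 : ℂ)))
      (Matrix.toEuclideanCLM (n := Fin n) (𝕜 := ℂ) (SpecialLinearGroup.transvection h c).1) := by
    intro i j h c
    have h1 := conn_basic hR0 (a := (WithLp.toLp 2 (fun _ => (R0 : ℂ)) : En n)) (v := eb i) (pc j)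
      (by simp [pc_apply, h.symm]) (by simp [pc_apply, hR0.ne'])
      (by
        have : ‖(pc j : En n →L[ℂ] ℂ)‖ ≤ 1 := ContinuousLinearMap.opNorm_le_bound _ zero_le_one (fun x => by rw [one_mul]; exact pc_le j x)
        simp only [pc_apply, Complex.norm_real, Real.norm_of_nonneg hR0.le]
        nlinarith) 0 c
    rw [zero_smul, add_zero] at h1
    have e : (Matrix.toEuclideanCLM (n := Fin n) (𝕜 := ℂ) (SpecialLinearGroup.transvection h c).1) = 1 + c • (pc j).smulRight (eb i) := by
      change Matrix.toEuclideanCLM (n := Fin n) (𝕜 := ℂ) (1 + single i j c) = _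
      rw [map_add, map_one]
      congr 1
      ext x p
      have : x = WithLp.toLp 2 (fun q => x q) := rfl
      rw [this, Matrix.toEuclideanCLM_toLp]
      simp [pc_apply, single_mulVec, Function.update_apply, Pi.single_apply]
    rw [e]; exact h1
  refine SpecialLinearGroup.diagonal_transvection_induction' (fun A => Conn R0 (WithLp.toLp 2 (fun _ => (R0 : ℂ)) : En n) (WithLp.toLp 2 (fun _ => (R0 : ℂ)))
      (Matrix.toEuclideanCLM (n := Fin n) (𝕜 := ℂ) A.1)) A ?_ htr hmul
  · intro i j hij c hc
    rw [diag2n_dec]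
    exact hmul _ _ (htr _ _ _ _) (hmul _ _ (htr _ _ _ _) (hmul _ _ (htr _ _ _ _) (hmul _ _ (htr _ _ _ _) (hmul _ _ (htr _ _ _ _) (htr _ _ _ _)))))

theorem conn_all (hn : 2 ≤ n) {R0 : ℝ} (hR0 : 0 < R0) {a b : En n} (ha : R0 ≤ ‖a‖) (hb : R0 ≤ ‖b‖)
    (M : En n →L[ℂ] En n) (hM : M.det = 1) : Conn R0 a b M := by
  set A := (Matrix.toEuclideanCLM (n := Fin n) (𝕜 := ℂ)).symm M with hA
  have hMA : M = Matrix.toEuclideanCLM (n := Fin n) (𝕜 := ℂ) A := by rw [hA]; simp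
  have hdet : A.det = 1 := by
    rw [← hM, hMA, ContinuousLinearMap.det, Matrix.coe_toEuclideanCLM_eq_toEuclideanLin, Matrix.toEuclideanLin_eq_toLin_orthonormal,
      LinearMap.det_toLin]
  set o : En n := WithLp.toLp 2 (fun _ => (R0 : ℂ)) with ho
  have hoR : R0 ≤ ‖o‖ := by
    have := PiLp.norm_apply_le o ⟨0, by omega⟩
    simp only [ho, Complex.norm_real, Real.norm_of_nonneg hR0.le] at this
    exact this
  have h1 := conn_mat hn hR0 ⟨A, hdet⟩
  have h2 := ((conn_any hn hR0 ha hoR).trans h1).trans (conn_any hn hR0 hoR hb)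
  rw [mul_one, one_mul, ← hMA] at h2
  exact h2
end conn2

section densW
variable {n : ℕ}

theorem unifc {f : En n → En n} (hf : Continuous f) (B : ℝ) {ε : ℝ} (hε : 0 < ε) :
    ∃ δ > 0, ∀ z ∈ closedBall (0 : En n) B, ∀ w ∈ closedBall (0 : En n) B, ‖z - w‖ ≤ δ → ‖f z - f w‖ ≤ ε := by
  have h := (isCompact_closedBall (0 : En n) B).uniformContinuousOn_of_continuous hf.continuousOn
  obtain ⟨δ, hδ, h⟩ := Metric.uniformContinuousOn_iff.1 h ε hε
  refine ⟨δ / 2, by positivity, fun z hz w hw hzw => ?_⟩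
  have := h z hz w hw (by rw [dist_eq_norm]; linarith)
  rw [dist_eq_norm] at this
  exact this.le

theorem strict_small {G : En n → En n} (hG : Differentiable ℂ G) (p : En n) {η : ℝ} (hη : 0 < η) :
    ∃ s > 0, ∀ z ∈ closedBall p s, ∀ w ∈ closedBall p s, ‖G z - G w - fderiv ℂ G p (z - w)‖ ≤ η * ‖z - w‖ := by
  obtain ⟨M, hM⟩ := (isCompact_closedBall p 2).exists_bound_of_continuousOn hG.continuous.continuousOn
  have hM0 : 0 ≤ M := (norm_nonneg _).trans (hM p (by simp))
  refine ⟨min 1 (η / (16 * (M + 1))), by positivity, fun z hz w hw => ?_⟩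
  let _ : NormedSpace ℝ (En n) := NormedSpace.restrictScalars ℝ ℂ (En n)
  refine Convex.norm_image_sub_le_of_norm_fderiv_le' (𝕜 := ℂ) (s := closedBall p (min 1 (η / (16 * (M + 1)))))
    (fun x _ => hG x) (fun x hx => ?_) (convex_closedBall _ _) hw hz
  have hx1 : x ∈ closedBall p (2 - 1) := by
    norm_num; exact closedBall_subset_closedBall (min_le_left _ _) hx
  have hx2 : ‖x - p‖ ≤ η / (16 * (M + 1)) := by
    rw [← dist_eq_norm]; exact closedBall_subset_closedBall (min_le_right _ _) hx
  have h := cauchy_fderiv_lip hG (x0 := p) (R := 2) (M := M) (d := 1) one_pos hM (z := p) (w := x)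
    (by simp) hx1
  refine h.trans ?_
  calc 16 * M / 1 ^ 2 * ‖x - p‖ ≤ 16 * (M + 1) * (η / (16 * (M + 1))) := by
        rw [one_pow, div_one]; gcongr; linarith
    _ = η := by field_simp

theorem InW.pert {i0 : Fin n} {β : ℂ} {c : En n} {r : ℝ} {f : En n → En n} (h : InW i0 β c r f)
    (hf : Differentiable ℂ f) {d : ℝ} (hd : 0 < d) (hr : 0 < r) :
    ∃ δ > 0, ∀ g : En n → En n, Differentiable ℂ g → (∀ z ∈ closedBall c (r + d), ‖g z - f z‖ ≤ δ) →
      InW i0 β c r g := by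
  obtain ⟨η, hη, h1⟩ := h.lip
  have h2 := h.cen
  refine ⟨min ((1 / 16 - η) * d / 4) ((r / 16 - ‖f c - c‖) / 2), lt_min (by nlinarith) (by linarith), fun g hg hgf => ⟨?_, ?_⟩⟩
  · refine ⟨η + (1 / 16 - η) / 2, by linarith, fun z hz w hw => ?_⟩
    have h3 := cauchy_lip (f := fun z => g z - f z) (hg.sub hf) (x0 := c) (R := r + d) hd
      (M := (1 / 16 - η) * d / 4) (fun z hz => (hgf z hz).trans (min_le_left _ _)) (z := w) (w := z)
      (by simpa using hw) (by simpa using hz)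
    have h4 := h1 z hz w hw
    have e : g z - g w - LL i0 β (z - w) = (g z - f z - (g w - f w)) + (f z - f w - LL i0 β (z - w)) := by abel
    rw [e]
    refine (norm_add_le _ _).trans ?_
    have e2 : 2 * ((1 / 16 - η) * d / 4) / d = (1 / 16 - η) / 2 := by field_simp; ring
    rw [e2] at h3
    rw [add_mul]
    linarith
  · have h3 := (hgf c (by simp; linarith)).trans (min_le_right _ _)
    have e : g c - c = (g c - f c) + (f c - c) := by abel
    rw [e]
    exact (norm_add_le _ _).trans_lt (by linarith)

theorem W_open (i0 : Fin n) (β : ℂ) (c : En n) {r : ℝ} (hr : 0 < r) : IsOpen {f : AutOmega n | InW i0 β c r f.1} := by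
  rw [isOpen_iff_mem_nhds]
  intro f hf
  obtain ⟨δ, hδ, h⟩ := InW.pert hf (AutVA f).diff one_pos hr
  have h1 := unif_isOpen (n := n) f.1 f.1.continuous (closedBall c (r + 1)) (isCompact_closedBall _ _) δ
  filter_upwards [h1.mem_nhds (show f ∈ _ by simp [hδ])] with g hg
  exact h g.1 (AutVA g).diff (fun z hz => (hg z hz).le)

open Matrix in
theorem LL_det (i0 : Fin n) (β : ℂ) : (LL i0 β).det = β * 4 ^ (n - 1) := by
  have e : LL i0 β = Matrix.toEuclideanCLM (n := Fin n) (𝕜 := ℂ) (Matrix.diagonal (fun i => if i = i0 then β else 4)) := by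
    ext x p
    have : x = WithLp.toLp 2 (fun q => x q) := rfl
    rw [this, Matrix.toEuclideanCLM_toLp]
    simp only [mulVec_diagonal, LL, _root_.add_apply, _root_.smul_apply, Pu_apply, Ps_apply, pc_apply]
    by_cases h : p = i0
    · subst h; simp
    · simp [h]
  rw [e, ContinuousLinearMap.det, Matrix.coe_toEuclideanCLM_eq_toEuclideanLin, Matrix.toEuclideanLin_eq_toLin_orthonormal,
      LinearMap.det_toLin, det_diagonal]
  rw [← Finset.mul_prod_erase Finset.univ _ (Finset.mem_univ i0), if_pos rfl]
  congr 1
  rw [Finset.prod_congr rfl (g := fun _ => (4 : ℂ)) (fun x hx => if_neg (Finset.ne_of_mem_erase hx))]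
  simp

theorem W_dense (hn : 2 ≤ n) (i0 : Fin n) {β : ℂ} (hβ : β * 4 ^ (n - 1) = 1) {f : En n → En n} (hf : VA f)
    {R ε : ℝ} (hR : 0 < R) (hε : 0 < ε) (D : Set (En n)) (hD : Dense D) :
    ∃ g, VA g ∧ (∀ z ∈ closedBall (0 : En n) R, ‖g z - f z‖ ≤ ε) ∧ ∃ c ∈ D, ∃ N : ℕ, InW i0 β c (1 / (N + 1)) g := by
  have hR0 : 0 < R + 1 := by linarith
  obtain ⟨B, hB⟩ := (isCompact_closedBall (0 : En n) (R + 1)).exists_bound_of_continuousOn hf.cont.continuousOn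
  obtain ⟨p, hp⟩ : ∃ p : En n, ‖p‖ = |B| + R + 1 := by
    refine ⟨((|B| + R + 1 : ℝ) : ℂ) • eb i0, ?_⟩
    rw [norm_smul, norm_eb, Complex.norm_real, mul_one, Real.norm_of_nonneg (by positivity)]
  obtain ⟨b, hb⟩ := hf.surj p
  have hbR : R + 1 ≤ ‖b‖ := by
    by_contra hcon
    have := hB b (by rw [mem_closedBall, dist_zero_right]; linarith)
    rw [hb, hp] at this
    linarith [le_abs_self B]
  have hpR : R + 1 ≤ ‖p‖ := by rw [hp]; linarith [abs_nonneg B]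
  obtain ⟨u, hu⟩ := det_isUnit _ (hf.2 b)
  set S : En n →L[ℂ] En n := ↑u⁻¹ with hS
  have hTS : fderiv ℂ f b * S = 1 := by rw [← hu, hS]; simp
  have hdm : ∀ A B : En n →L[ℂ] En n, (A * B).det = A.det * B.det := by
    intro A B
    simp only [ContinuousLinearMap.det]
    rw [← LinearMap.det_comp]; rfl
  have hSd : S.det = 1 := by
    have := hdm (fderiv ℂ f b) S
    rw [hTS, hf.2 b, one_mul] at this
    rw [← this]; simp [ContinuousLinearMap.det]
  set M := S * LL i0 β with hM
  have hMd : M.det = 1 := by rw [hM, hdm, hSd, LL_det, hβ, one_mul]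
  obtain ⟨ρ, hρ, hconn⟩ := conn_all hn hR0 hpR hbR M hMd R (by linarith)
  let G : En n → En n := fun z => f (b + M (z - p))
  have hG : Differentiable ℂ G := hf.diff.comp (by fun_prop)
  have hGp : G p = p := by simp [G, hb]
  have hG' : fderiv ℂ G p = LL i0 β := by
    have h1 : HasFDerivAt (fun z => b + M (z - p)) M p := by
      have := (M.hasFDerivAt.comp p ((hasFDerivAt_id p).sub_const p)).const_add b
      exact this
    have h2 : HasFDerivAt f (fderiv ℂ f b) (b + M (p - p)) := by
      simp only [sub_self, map_zero, add_zero]; exact (hf.diff b).hasFDerivAt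
    have h3 : HasFDerivAt G (fderiv ℂ f b ∘L M) p := h2.comp p h1
    rw [h3.fderiv]
    change fderiv ℂ f b * M = _
    rw [hM, ← mul_assoc, hTS, one_mul]
  obtain ⟨s, hs, hs'⟩ := strict_small hG p (η := 1 / 64) (by norm_num)
  rw [hG'] at hs'
  obtain ⟨N, hN⟩ := exists_nat_one_div_lt (show 0 < min (s / 3) (ρ / 3) by positivity)
  set r : ℝ := 1 / ((N : ℝ) + 1) with hr
  have hr0 : 0 < r := by positivity
  rw [lt_min_iff] at hN
  obtain ⟨c, hcD, hc⟩ := hD.exists_dist_lt p (show 0 < r / (64 * (‖LL i0 β‖ + 2)) by positivity)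
  rw [dist_comm, dist_eq_norm] at hc
  have hcr : ‖c - p‖ ≤ r := by
    refine hc.le.trans (div_le_self hr0.le ?_)
    linarith [norm_nonneg (LL i0 β)]
  have hsub : ∀ z ∈ closedBall c (r + r), z ∈ closedBall p (3 * r) := by
    intro z hz
    rw [mem_closedBall, dist_eq_norm] at *
    calc ‖z - p‖ = ‖(z - c) + (c - p)‖ := by congr 1; abel
      _ ≤ ‖z - c‖ + ‖c - p‖ := norm_add_le _ _
      _ ≤ _ := by linarith
  have hcc : closedBall c r ⊆ closedBall c (r + r) := closedBall_subset_closedBall (by linarith)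
  have hWG : InW i0 β c r G := by
    refine ⟨⟨1 / 64, by norm_num, fun z hz w hw => hs' z ?_ w ?_⟩, ?_⟩
    · exact closedBall_subset_closedBall (by linarith) (hsub z (hcc hz))
    · exact closedBall_subset_closedBall (by linarith) (hsub w (hcc hw))
    · have h1 := hs' c (closedBall_subset_closedBall (by linarith) (hsub c (by simp; linarith))) p (by simp [hs.le])
      rw [hGp] at h1
      have h2 := (LL i0 β).le_opNorm (c - p)
      have e : G c - c = (G c - p - LL i0 β (c - p)) + LL i0 β (c - p) - (c - p) := by abel
      rw [e]
      have h3 := norm_sub_le ((G c - p - LL i0 β (c - p)) + LL i0 β (c - p)) (c - p)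
      have h4 := norm_add_le (G c - p - LL i0 β (c - p)) (LL i0 β (c - p))
      rw [lt_div_iff₀ (by positivity)] at hc
      nlinarith [norm_nonneg (c - p)]
  obtain ⟨δ, hδ, hpert⟩ := hWG.pert hG hr0 hr0
  obtain ⟨δ', hδ', hun⟩ := unifc hf.cont (R + 1 + (‖b‖ + ‖M‖ * ρ) + 1) (show 0 < min ε δ by positivity)
  obtain ⟨φ, hφ, hφ1, hφ2⟩ := hconn (min δ' 1) (by positivity)
  refine ⟨f ∘ φ, hf.comp hφ, fun z hz => ?_, c, hcD, N, hpert _ (hf.comp hφ).diff fun z hz => ?_⟩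
  · have h1 := hφ1 z hz
    rw [le_min_iff] at h1
    rw [mem_closedBall, dist_zero_right] at hz
    have h0 : 0 ≤ ‖b‖ + ‖M‖ * ρ := by positivity
    refine (hun (φ z) ?_ z ?_ h1.1).trans (min_le_left _ _)
    · rw [mem_closedBall, dist_zero_right]
      calc ‖φ z‖ = ‖(φ z - z) + z‖ := by congr 1; abel
        _ ≤ ‖φ z - z‖ + ‖z‖ := norm_add_le _ _
        _ ≤ _ := by linarith
    · rw [mem_closedBall, dist_zero_right]; linarith
  · have hz2 := hsub z hz
    have hz' : z ∈ closedBall p ρ := closedBall_subset_closedBall (by linarith) hz2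
    have h1 := hφ2 z hz'
    rw [le_min_iff] at h1
    rw [mem_closedBall, dist_eq_norm] at hz'
    have h2 : ‖b + M (z - p)‖ ≤ ‖b‖ + ‖M‖ * ρ := (norm_add_le _ _).trans (by gcongr; exact (M.le_opNorm _).trans (by gcongr))
    refine (hun (φ z) ?_ (b + M (z - p)) ?_ h1.1).trans (min_le_right _ _)
    · rw [mem_closedBall, dist_zero_right]
      calc ‖φ z‖ = ‖(φ z - (b + M (z - p))) + (b + M (z - p))‖ := by congr 1; abel
        _ ≤ ‖φ z - (b + M (z - p))‖ + ‖b + M (z - p)‖ := norm_add_le _ _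
        _ ≤ _ := by linarith
    · rw [mem_closedBall, dist_zero_right]; linarith
end densW

section reach
variable {n : ℕ}

def Good (Φ : ℕ → En n → En n) (Φ0 : En n → En n) (y : En n) : Prop :=
  ∃ s > 0, ∀ η > 0, ∀ᶠ k in atTop, ∀ z ∈ closedBall y s, ‖Φ k z - Φ0 z‖ ≤ η

theorem Good.comp {Φ Θ : ℕ → En n → En n} {Φ0 Θ0 : En n → En n} {y y' : En n} (h1 : Good Θ Θ0 y')
    (h2 : Good Φ Φ0 y) (hy : Φ0 y = y') (c1 : Continuous Θ0) (c2 : Continuous Φ0) :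
    Good (fun k => Θ k ∘ Φ k) (Θ0 ∘ Φ0) y := by
  subst hy
  obtain ⟨s2, hs2, h1⟩ := h1
  obtain ⟨s1, hs1, h2⟩ := h2
  obtain ⟨s, hs, hs'⟩ := Metric.continuous_iff.1 c2 y (s2 / 2) (by positivity)
  refine ⟨min s1 (s / 2), by positivity, fun η hη => ?_⟩
  obtain ⟨δ, hδ, hun⟩ := unifc c1 (‖Φ0 y‖ + s2) (show 0 < η / 2 by positivity)
  filter_upwards [h1 (η / 2) (by positivity), h2 (min δ (s2 / 2)) (by positivity)] with k hk1 hk2 z hz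
  have e1 := hk2 z (closedBall_subset_closedBall (min_le_left _ _) hz)
  rw [le_min_iff] at e1
  have e2 := hs' z (lt_of_le_of_lt (closedBall_subset_closedBall (min_le_right _ _) hz) (by linarith))
  rw [dist_eq_norm] at e2
  have e3 : ‖Φ k z - Φ0 y‖ ≤ s2 := by
    calc ‖Φ k z - Φ0 y‖ = ‖(Φ k z - Φ0 z) + (Φ0 z - Φ0 y)‖ := by congr 1; abel
      _ ≤ ‖Φ k z - Φ0 z‖ + ‖Φ0 z - Φ0 y‖ := norm_add_le _ _
      _ ≤ s2 := by linarith
  have hb : ∀ u : En n, ‖u - Φ0 y‖ ≤ s2 → u ∈ closedBall (0 : En n) (‖Φ0 y‖ + s2) := by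
    intro u hu
    rw [mem_closedBall, dist_zero_right]
    calc ‖u‖ = ‖Φ0 y + (u - Φ0 y)‖ := by congr 1; abel
      _ ≤ ‖Φ0 y‖ + ‖u - Φ0 y‖ := norm_add_le _ _
      _ ≤ _ := by linarith
  have e4 := hk1 (Φ k z) (by rw [mem_closedBall, dist_eq_norm]; exact e3)
  have e5 := hun (Φ k z) (hb _ e3) (Φ0 z) (hb _ (by linarith)) e1.1
  calc ‖(Θ k ∘ Φ k) z - (Θ0 ∘ Φ0) z‖ = ‖(Θ k (Φ k z) - Θ0 (Φ k z)) + (Θ0 (Φ k z) - Θ0 (Φ0 z))‖ := by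
        congr 1; simp
    _ ≤ _ := norm_add_le _ _
    _ ≤ η := by linarith

theorem Good.iter {g : ℕ → En n → En n} {f : En n → En n} (hf : Continuous f) {x : En n} {l : ℕ}
    (h : ∀ j < l, Good g f (f^[j] x)) : Good (fun k => (g k)^[l]) (f^[l]) x := by
  induction l with
  | zero => exact ⟨1, one_pos, fun η hη => Eventually.of_forall fun k z _ => by simp [hη.le]⟩
  | succ l ih =>
    have := (h l (by omega)).comp (ih fun j hj => h j (by omega)) rfl hf (hf.iterate l)
    simp only [iterate_succ']
    exact this

theorem VA.transl (a b : En n) : VA (fun z : En n => b + (z - a)) := by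
  refine ⟨⟨by fun_prop, fun z => a + (z - b), by fun_prop, fun z => ?_, fun z => ?_⟩, fun z => ?_⟩
  · simp
  · simp
  · have : HasFDerivAt (fun z : En n => b + (z - a)) (ContinuousLinearMap.id ℂ (En n)) z :=
      ((hasFDerivAt_id z).sub_const a).const_add b
    rw [this.fderiv]; simp [ContinuousLinearMap.det]

theorem reach {i0 : Fin n} {β : ℂ} (hβ : ‖β‖ ≤ 1 / 4) {c : En n} {r : ℝ} (hr : 0 < r) {f : En n → En n} (hf : VA f)
    (hW : InW i0 β c r f) {x b : En n} {m N : ℕ} {R ρ σ : ℝ} (hσ : 0 < σ) (hρ : 0 < ρ) (hR : ‖c‖ + r + 1 ≤ R)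
    (hx : ∀ l < m, ‖f^[l] x‖ < R) (hb : ∀ l < N, ‖f^[l] (f b)‖ < R) (hst : Stay f c r (f^[N] (f b)))
    (hpc : ‖pc i0 (f^[N] (f b) - c)‖ < r / 2) (g : ℕ → En n → En n) (hg : ∀ k, VA (g k))
    (hg1 : ∀ η > 0, ∀ᶠ k in atTop, ∀ z ∈ closedBall (0 : En n) R, ‖g k z - f z‖ ≤ η)
    (hg2 : ∀ η > 0, ∀ᶠ k in atTop, ∀ z ∈ closedBall (f^[m] x) ρ, ‖g k z - f (b + (z - f^[m] x))‖ ≤ η) :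
    ∀ᶠ k in atTop, InW i0 β c r (g k) ∧ ∃ x' ∈ ball x σ, ∃ M, Stay (g k) c r ((g k)^[M] x') := by
  have hG : ∀ y : En n, ‖y‖ < R → Good g f y := by
    intro y hy
    refine ⟨R - ‖y‖, by linarith, fun η hη => ?_⟩
    filter_upwards [hg1 η hη] with k hk z hz
    apply hk
    rw [mem_closedBall, dist_eq_norm] at hz
    rw [mem_closedBall, dist_zero_right]
    calc ‖z‖ = ‖y + (z - y)‖ := by congr 1; abel
      _ ≤ ‖y‖ + ‖z - y‖ := norm_add_le _ _
      _ ≤ R := by linarith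
  have G1 : Good (fun k => (g k)^[m]) (f^[m]) x := Good.iter hf.cont fun j hj => hG _ (hx j hj)
  have G2 : Good g (f ∘ (fun z => b + (z - f^[m] x))) (f^[m] x) := ⟨ρ, hρ, hg2⟩
  have G3 : Good (fun k => (g k)^[N]) (f^[N]) (f b) := Good.iter hf.cont fun j hj => hG _ (hb j hj)
  have hτ := VA.transl (f^[m] x) b
  have G4 := G3.comp (G2.comp G1 rfl (hf.comp hτ).cont (hf.iter m).cont) (by simp) (hf.iter N).cont
    ((hf.comp hτ).comp (hf.iter m)).cont
  set Ψ0 := f^[N] ∘ (f ∘ (fun z => b + (z - f^[m] x))) ∘ f^[m] with hΨ0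
  have hΨ : VA Ψ0 := (hf.iter N).comp ((hf.comp hτ).comp (hf.iter m))
  have hΨx : Ψ0 x = f^[N] (f b) := by simp [hΨ0]
  obtain ⟨u, hu⟩ := det_isUnit _ (hΨ.2 x)
  set S : En n →L[ℂ] En n := ↑u⁻¹ with hS
  have hTS : fderiv ℂ Ψ0 x * S = 1 := by rw [← hu, hS]; simp
  set C := ‖S‖ + 1 with hC
  have hC0 : 0 < C := by positivity
  obtain ⟨s1, hs1, hst1⟩ := strict_small hΨ.diff x (η := 1 / (4 * C)) (by positivity)
  obtain ⟨s2, hs2, G4⟩ := G4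
  set τ := min (min s1 (s2 / 2)) (σ / 2) with hτd
  have hτ0 : 0 < τ := by positivity
  have hτ1 : τ ≤ s1 := (min_le_left _ _).trans (min_le_left _ _)
  have hτ2 : τ ≤ s2 / 2 := (min_le_left _ _).trans (min_le_right _ _)
  have hτ3 : τ ≤ σ / 2 := min_le_right _ _
  obtain ⟨δ, hδ, hpert⟩ := hW.pert hf.diff one_pos hr
  have hsub : ∀ z ∈ closedBall c (r + 1), z ∈ closedBall (0 : En n) R := by
    intro z hz
    rw [mem_closedBall, dist_eq_norm] at hz
    rw [mem_closedBall, dist_zero_right]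
    calc ‖z‖ = ‖c + (z - c)‖ := by congr 1; abel
      _ ≤ ‖c‖ + ‖z - c‖ := norm_add_le _ _
      _ ≤ R := by linarith
  filter_upwards [G4 (min (s2 / (16 * C)) (τ / (4 * C))) (by positivity), hg1 δ hδ,
    hg1 (τ / (4 * C) / 5) (by positivity)] with k k1 k2 k3
  have hWk : InW i0 β c r (g k) := hpert _ (hg k).diff fun z hz => k2 z (hsub z hz)
  refine ⟨hWk, ?_⟩
  obtain ⟨w, -, hw⟩ := exists_graph hβ hWk hr (hg k).diff
  obtain ⟨hw1, hw2⟩ := hw (pc i0 (f^[N] (f b) - c)) hpc.le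
  set y := w (pc i0 (f^[N] (f b) - c)) with hy
  have hcmp := stay_cmp hβ hW (fun z hz => k3 z (hsub z (closedBall_subset_closedBall (by linarith) hz))) hst hw1
  have hpc0 : pc i0 (f^[N] (f b) - y) = 0 := by
    have e : f^[N] (f b) - y = (f^[N] (f b) - c) - (y - c) := by abel
    rw [e, map_sub, hw2, sub_self]
  rw [hpc0, norm_zero, zero_add] at hcmp
  set Ψ := (g k)^[N] ∘ g k ∘ (g k)^[m] with hΨd
  have hΨk : VA Ψ := ((hg k).iter N).comp ((hg k).comp ((hg k).iter m))
  have hA : ∀ z ∈ closedBall x τ, ∀ w ∈ closedBall x τ, ‖Ψ z - Ψ w - fderiv ℂ Ψ0 x (z - w)‖ ≤ 1 / (2 * C) * ‖z - w‖ := by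
    intro z hz w hw
    have h1 := hst1 z (closedBall_subset_closedBall hτ1 hz) w (closedBall_subset_closedBall hτ1 hw)
    have h2 := cauchy_lip (f := fun z => Ψ z - Ψ0 z) (hΨk.diff.sub hΨ.diff) (x0 := x) (R := s2) (d := s2 / 2) (by positivity)
      (M := s2 / (16 * C)) (fun z hz => (k1 z hz).trans (min_le_left _ _)) (z := w) (w := z)
      (closedBall_subset_closedBall (by linarith) hw) (closedBall_subset_closedBall (by linarith) hz)
    have e2 : 2 * (s2 / (16 * C)) / (s2 / 2) = 1 / (4 * C) := by field_simp; norm_num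
    rw [e2] at h2
    have e : Ψ z - Ψ w - fderiv ℂ Ψ0 x (z - w) = (Ψ z - Ψ0 z - (Ψ w - Ψ0 w)) + (Ψ0 z - Ψ0 w - fderiv ℂ Ψ0 x (z - w)) := by abel
    rw [e]
    refine (norm_add_le _ _).trans ((add_le_add h2 h1).trans (le_of_eq ?_))
    field_simp; ring
  have hB : ‖y - Ψ x‖ ≤ τ / (2 * C) := by
    have h1 := (k1 x (by simp [hs2.le])).trans (min_le_right _ _)
    have e : y - Ψ x = -(f^[N] (f b) - y) - (Ψ x - Ψ0 x) := by rw [hΨx]; abel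
    rw [e]
    refine (norm_sub_le _ _).trans ?_
    rw [norm_neg]
    have h1' : ‖Ψ x - Ψ0 x‖ ≤ τ / (4 * C) := h1
    have e3 : τ / (2 * C) = τ / (4 * C) + τ / (4 * C) := by field_simp; ring
    have : 0 < τ / (4 * C) := by positivity
    rw [e3]
    linarith
  obtain ⟨x', hx', hx''⟩ := quant_surj (f := Ψ) (τ := τ) hTS hC0 hτ0.le (by linarith) (b := x) hA y hB
  refine ⟨x', ?_, N + (1 + m), ?_⟩
  · rw [mem_closedBall] at hx'
    rw [mem_ball]; linarith
  · have e : (g k)^[N + (1 + m)] x' = Ψ x' := by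
      rw [iterate_add_apply, iterate_add_apply]; rfl
    rw [e, hx'']; exact hw1
end reach

section fin
variable {n : ℕ}

def AA (i0 : Fin n) (β : ℂ) (c : En n) (r : ℝ) (x0 : En n) (σ : ℝ) : Set (AutOmega n) :=
  {f | InW i0 β c r f.1 ∧ ∃ x' ∈ ball x0 σ, ∃ M, Stay f.1 c r ((f.1)^[M] x')}

theorem A_step (hn : 2 ≤ n) {i0 : Fin n} {β : ℂ} (hβ : ‖β‖ ≤ 1 / 4) {c : En n} {r : ℝ} (hr : 0 < r) {f : En n → En n} (hf : VA f)
    (hW : InW i0 β c r f) {x b : En n} {m N : ℕ} {R0 R σ : ℝ} (hσ : 0 < σ) (hRR : R < R0) (hR : ‖c‖ + r + 1 ≤ R)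
    (hx : ∀ l < m, ‖f^[l] x‖ < R) (hxm : R0 ≤ ‖f^[m] x‖) (hb0 : R0 ≤ ‖b‖)
    (hb : ∀ l < N, ‖f^[l] (f b)‖ < R) (hst : Stay f c r (f^[N] (f b)))
    (hpc : ‖pc i0 (f^[N] (f b) - c)‖ < r / 2) {ε : ℝ} (hε : 0 < ε) :
    ∃ g : AutOmega n, (∀ z ∈ closedBall (0 : En n) R, ‖g.1 z - f z‖ ≤ ε) ∧ g ∈ interior (AA i0 β c r x σ) := by
  have hR0 : 0 < R := by linarith [norm_nonneg c]
  obtain ⟨ρ, hρ, hconn⟩ := conn_any hn (hR0.trans hRR) hxm hb0 R hRR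
  have hτ := VA.transl (f^[m] x) b
  let V : ℝ → Set (AutOmega n) := fun e =>
    {g | ∀ z ∈ closedBall (0 : En n) R, ‖g.1 z - f z‖ < e} ∩
    {g | ∀ z ∈ closedBall (f^[m] x) ρ, ‖g.1 z - (f ∘ (fun z => b + (z - f^[m] x))) z‖ < e}
  have hV : ∀ e, IsOpen (V e) := fun e =>
    (unif_isOpen _ hf.cont _ (isCompact_closedBall _ _) e).inter
      (unif_isOpen _ (hf.comp hτ).cont _ (isCompact_closedBall _ _) e)
  have hex : ∃ e > 0, V e ⊆ AA i0 β c r x σ := by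
    by_contra hcon
    push Not at hcon
    have h1 : ∀ k : ℕ, ∃ g ∈ V (1 / ((k : ℝ) + 1)), g ∉ AA i0 β c r x σ := fun k =>
      not_subset.1 (hcon _ (by positivity))
    choose G hG hGA using h1
    have hlim : ∀ η > (0 : ℝ), ∀ᶠ k : ℕ in atTop, 1 / ((k : ℝ) + 1) < η := fun η hη =>
      tendsto_one_div_add_atTop_nhds_zero_nat.eventually_lt_const hη
    have := reach hβ hr hf hW hσ hρ hR hx hb hst hpc (fun k => (G k).1) (fun k => AutVA _)
      (fun η hη => by
        filter_upwards [hlim η hη] with k hk z hz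
        exact ((hG k).1 z hz).le.trans hk.le)
      (fun η hη => by
        filter_upwards [hlim η hη] with k hk z hz
        exact ((hG k).2 z hz).le.trans hk.le)
    obtain ⟨k, hk⟩ := this.exists
    exact hGA k hk
  obtain ⟨e, he, heA⟩ := hex
  obtain ⟨δ, hδ, hun⟩ := unifc hf.cont (R + (‖b‖ + ρ) + 1) (show 0 < min ε (e / 2) by positivity)
  obtain ⟨φ, hφ, hφ1, hφ2⟩ := hconn (min δ 1) (by positivity)
  have hbρ : 0 ≤ ‖b‖ + ρ := by positivity
  have k1 : ∀ z ∈ closedBall (0 : En n) R, ‖f (φ z) - f z‖ ≤ min ε (e / 2) := by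
    intro z hz
    have h1 := hφ1 z hz
    rw [le_min_iff] at h1
    rw [mem_closedBall, dist_zero_right] at hz
    refine hun (φ z) ?_ z ?_ h1.1
    · rw [mem_closedBall, dist_zero_right]
      calc ‖φ z‖ = ‖(φ z - z) + z‖ := by congr 1; abel
        _ ≤ ‖φ z - z‖ + ‖z‖ := norm_add_le _ _
        _ ≤ _ := by linarith
    · rw [mem_closedBall, dist_zero_right]; linarith
  have k2 : ∀ z ∈ closedBall (f^[m] x) ρ, ‖f (φ z) - f (b + (z - f^[m] x))‖ ≤ e / 2 := by
    intro z hz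
    have h1 := hφ2 z hz
    rw [le_min_iff] at h1
    have h1a : ‖φ z - (b + (z - f^[m] x))‖ ≤ δ := h1.1
    have h1b : ‖φ z - (b + (z - f^[m] x))‖ ≤ 1 := h1.2
    rw [mem_closedBall, dist_eq_norm] at hz
    have h2 : ‖b + (z - f^[m] x)‖ ≤ ‖b‖ + ρ := (norm_add_le _ _).trans (by linarith)
    refine (hun (φ z) ?_ (b + (z - f^[m] x)) ?_ h1a).trans (min_le_right _ _)
    · rw [mem_closedBall, dist_zero_right]
      calc ‖φ z‖ = ‖(φ z - (b + (z - f^[m] x))) + (b + (z - f^[m] x))‖ := by congr 1; abel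
        _ ≤ ‖φ z - (b + (z - f^[m] x))‖ + ‖b + (z - f^[m] x)‖ := norm_add_le _ _
        _ ≤ _ := by linarith
    · rw [mem_closedBall, dist_zero_right]; linarith
  refine ⟨(hf.comp hφ).toAut, fun z hz => (k1 z hz).trans (min_le_left _ _), ?_⟩
  refine interior_maximal heA (hV e) ⟨fun z hz => ?_, fun z hz => ?_⟩
  · exact ((k1 z hz).trans (min_le_right _ _)).trans_lt (by linarith)
  · exact (k2 z hz).trans_lt (by linarith)

theorem A_dense (hn : 2 ≤ n) {i0 : Fin n} {β : ℂ} (hβ : ‖β‖ ≤ 1 / 4) {c : En n} {r : ℝ} (hr : 0 < r) {f : En n → En n} (hf : VA f)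
    (hW : InW i0 β c r f) (x0 : En n) {σ : ℝ} (hσ : 0 < σ) (R : ℝ) {ε : ℝ} (hε : 0 < ε) :
    ∃ g : AutOmega n, (∀ z ∈ closedBall (0 : En n) R, ‖g.1 z - f z‖ ≤ ε) ∧ g ∈ interior (AA i0 β c r x0 σ) := by
  set R1 := max R (‖c‖ + r + 1) with hR1
  obtain ⟨δ, hδ, hpert⟩ := hW.pert hf.diff one_pos hr
  obtain ⟨f1, hf1, hff1, x, hx, m', hm'⟩ := expel (by omega) hf (fun k hk => iter_ne_id hβ hW hr hf k hk) (R1 + 1)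
    (min (ε / 2) δ) (by positivity) x0 σ hσ
  have hsub : ∀ s, ∀ z ∈ closedBall c s, ‖z‖ ≤ ‖c‖ + s := by
    intro s z hz
    rw [mem_closedBall, dist_eq_norm] at hz
    calc ‖z‖ = ‖c + (z - c)‖ := by congr 1; abel
      _ ≤ ‖c‖ + ‖z - c‖ := norm_add_le _ _
      _ ≤ _ := by linarith
  have hcR : ‖c‖ + r + 1 ≤ R1 := le_max_right _ _
  have hW1 : InW i0 β c r f1 := hpert f1 hf1.diff fun z hz => (hff1 z (by
    rw [mem_closedBall, dist_zero_right]
    linarith [hsub _ z hz])).trans (min_le_right _ _)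
  obtain ⟨p, hp, hpc, -⟩ := exists_p hβ hW1 hr hf1.diff
  obtain ⟨q, hq, hqR⟩ := stable_unbdd hβ hW1 hr hf1 hp hpc (R1 + 1)
  -- choose a generic radius
  obtain ⟨R0, hR0, hR0m⟩ : ∃ R0 ∈ Ioo R1 (R1 + 1), R0 ∈ (range (fun l => ‖f1^[l] x‖) ∪ range (fun l => ‖f1^[l] q‖))ᶜ := by
    have hd := ((countable_range (fun l => ‖f1^[l] x‖)).union (countable_range (fun l => ‖f1^[l] q‖))).dense_compl ℝ
    exact hd.inter_open_nonempty _ isOpen_Ioo (nonempty_Ioo.2 (by linarith))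
  have gx : ∀ l, ‖f1^[l] x‖ ≠ R0 := fun l h => hR0m (Or.inl ⟨l, h⟩)
  have gq : ∀ l, ‖f1^[l] q‖ ≠ R0 := fun l h => hR0m (Or.inr ⟨l, h⟩)
  -- first exit of x
  have hexm : ∃ m, R0 < ‖f1^[m] x‖ := ⟨m', by linarith [hR0.2]⟩
  classical
  obtain ⟨m, hm, hmin⟩ : ∃ m, R0 < ‖f1^[m] x‖ ∧ ∀ l < m, ‖f1^[l] x‖ < R0 :=
    ⟨Nat.find hexm, Nat.find_spec hexm, fun l hl => lt_of_le_of_ne (not_lt.1 (Nat.find_min hexm hl)) (gx l)⟩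
  -- last exit of q
  obtain ⟨N0, hN0⟩ := stable_stay hβ hW1 hr hp hpc hq
  have hexq : ∃ N, ∀ l ≥ N, ‖f1^[l] q‖ < R0 := ⟨N0, fun l hl => by
    have := hsub r _ (ball_subset_closedBall (hN0 l hl).1)
    linarith [hR0.1]⟩
  obtain ⟨L, hL, hLmin⟩ : ∃ L, R0 ≤ ‖f1^[L] q‖ ∧ ∀ l > L, ‖f1^[l] q‖ < R0 := by
    have h1 := Nat.find_spec hexq
    have h0 : Nat.find hexq ≠ 0 := by
      intro h0
      have := h1 0 (by omega)
      simp only [iterate_zero, id] at this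
      linarith [hR0.2]
    refine ⟨Nat.find hexq - 1, ?_, fun l hl => h1 l (by omega)⟩
    by_contra hcon
    refine Nat.find_min hexq (m := Nat.find hexq - 1) (by omega) fun l hl => ?_
    rcases eq_or_lt_of_le hl with h | h
    · rw [← h]; exact not_le.1 hcon
    · exact h1 l (by omega)
  have hiter : ∀ l, f1^[l] (f1 (f1^[L] q)) = f1^[l + 1 + L] q := fun l => by
    rw [iterate_add_apply, iterate_add_apply]; rfl
  -- slightly smaller radius
  obtain ⟨R', hR', h1, h2, h3⟩ : ∃ R' < R0, R1 < R' ∧ (∀ l ∈ Finset.range m, ‖f1^[l] x‖ < R') ∧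
      (∀ l ∈ Finset.range N0, ‖f1^[l] (f1 (f1^[L] q))‖ < R') := by
    have e1 : ∀ᶠ R' in 𝓝[<] R0, R' < R0 := self_mem_nhdsWithin
    have e2 : ∀ t < R0, ∀ᶠ R' in 𝓝[<] R0, t < R' := fun t ht => nhdsWithin_le_nhds (lt_mem_nhds ht)
    have e3 : ∀ᶠ R' in 𝓝[<] R0, ∀ l ∈ Finset.range m, ‖f1^[l] x‖ < R' :=
      (eventually_all_finset _).2 fun l hl => e2 _ (hmin l (Finset.mem_range.1 hl))
    have e4 : ∀ᶠ R' in 𝓝[<] R0, ∀ l ∈ Finset.range N0, ‖f1^[l] (f1 (f1^[L] q))‖ < R' :=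
      (eventually_all_finset _).2 fun l hl => e2 _ (by rw [hiter]; exact hLmin _ (by omega))
    obtain ⟨R', a1, a2, a3, a4⟩ := (e1.and ((e2 R1 hR0.1).and (e3.and e4))).exists
    exact ⟨R', a1, a2, a3, a4⟩
  have hσ' : 0 < σ - dist x x0 := by rw [mem_ball] at hx; linarith
  obtain ⟨g, hg, hgA⟩ := A_step hn hβ hr hf1 hW1 (x := x) (b := f1^[L] q) (m := m) (N := N0) (σ := σ - dist x x0) hσ' hR'
    (by linarith) (fun l hl => h2 l (Finset.mem_range.2 hl)) hm.le hL (fun l hl => h3 l (Finset.mem_range.2 hl))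
    (fun k => by rw [← iterate_add_apply, hiter]; exact ball_subset_closedBall (hN0 _ (by omega)).1)
    (by rw [hiter]; exact (hN0 _ (by omega)).2) (show 0 < ε / 2 by positivity)
  refine ⟨g, fun z hz => ?_, interior_mono ?_ hgA⟩
  · have hRR : R ≤ R1 := le_max_left _ _
    have b1 := hg z (closedBall_subset_closedBall (by linarith) hz)
    have b2 := (hff1 z (closedBall_subset_closedBall (by linarith) hz)).trans (min_le_left _ _)
    calc ‖g.1 z - f z‖ = ‖(g.1 z - f1 z) + (f1 z - f z)‖ := by congr 1; abel
      _ ≤ ‖g.1 z - f1 z‖ + ‖f1 z - f z‖ := norm_add_le _ _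
      _ ≤ ε := by linarith
  · rintro g ⟨k1, x', hx', k2⟩
    refine ⟨k1, x', ?_, k2⟩
    rw [mem_ball] at *
    linarith [dist_triangle x' x x0]

theorem main_thm (n : ℕ) (hn : 2 ≤ n) : ∃ S : ℕ → Set ↥(AutOmega n), (∀ k, IsOpen (S k) ∧ Dense (S k)) ∧
    (⋂ k, S k) ⊆ {f | ∃ p, HypFixedPt (⇑f.1) p ∧ Dense (StableSet (⇑f.1) p)} := by
  let i0 : Fin n := ⟨0, by omega⟩
  let β : ℂ := ((4 : ℂ) ^ (n - 1))⁻¹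
  have hβ1 : β * 4 ^ (n - 1) = 1 := inv_mul_cancel₀ (pow_ne_zero _ (by norm_num))
  have hβ : ‖β‖ ≤ 1 / 4 := by
    simp only [β, norm_inv, norm_pow, Complex.norm_ofNat]
    rw [one_div]
    apply inv_anti₀ (by norm_num)
    exact le_self_pow₀ (by norm_num) (by omega)
  let D := TopologicalSpace.denseSeq (En n)
  have hD : DenseRange D := TopologicalSpace.denseRange_denseSeq _
  let ra : ℕ → ℝ := fun N => 1 / ((N : ℝ) + 1)
  have hra : ∀ N, 0 < ra N := fun N => by positivity
  let W : ℕ → ℕ → Set (AutOmega n) := fun i N => {f | InW i0 β (D i) (ra N) f.1}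
  have hWo : ∀ i N, IsOpen (W i N) := fun i N => W_open i0 β (D i) (hra N)
  let T : Option (ℕ × ℕ × ℕ × ℕ) → Set (AutOmega n) := fun o => match o with
    | none => ⋃ i, ⋃ N, W i N
    | some (i, N, j, M) => interior (AA i0 β (D i) (ra N) (D j) (ra M)) ∪ (closure (W i N))ᶜ
  have hT : ∀ o, IsOpen (T o) ∧ Dense (T o) := by
    intro o
    match o with
    | none =>
      refine ⟨isOpen_iUnion fun i => isOpen_iUnion fun N => hWo i N, ?_⟩
      intro f
      rw [mem_closure_iff_nhds]
      intro U hU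
      obtain ⟨R, ε, hR, hε, hUU⟩ := nhds_of_unif f U hU
      obtain ⟨g, hg, hgf, c, ⟨i, rfl⟩, N, hgW⟩ := W_dense hn i0 hβ1 (AutVA f) hR hε (range D) hD
      refine ⟨hg.toAut, hUU _ hgf, ?_⟩
      exact mem_iUnion.2 ⟨i, mem_iUnion.2 ⟨N, hgW⟩⟩
    | some (i, N, j, M) =>
      refine ⟨isOpen_interior.union isClosed_closure.isOpen_compl, ?_⟩
      have hsub : W i N ⊆ closure (interior (AA i0 β (D i) (ra N) (D j) (ra M))) := by
        intro f hf
        rw [mem_closure_iff_nhds]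
        intro U hU
        obtain ⟨R, ε, hR, hε, hUU⟩ := nhds_of_unif f U hU
        obtain ⟨g, hgf, hgA⟩ := A_dense hn hβ (hra N) (AutVA f) hf (D j) (hra M) R hε
        exact ⟨g, hUU _ hgf, hgA⟩
      intro f
      change f ∈ closure (_ ∪ _)
      rw [closure_union]
      by_cases hf : f ∈ closure (W i N)
      · exact Or.inl (closure_minimal hsub isClosed_closure hf)
      · exact Or.inr (subset_closure hf)
  refine ⟨fun k => T ((Denumerable.eqv (Option (ℕ × ℕ × ℕ × ℕ))).symm k), fun k => hT _, fun f hf => ?_⟩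
  have hfT : ∀ o, f ∈ T o := fun o => by
    have := mem_iInter.1 hf (Denumerable.eqv (Option (ℕ × ℕ × ℕ × ℕ)) o)
    simpa using this
  obtain ⟨i, hi⟩ := mem_iUnion.1 (hfT none)
  obtain ⟨N, hN⟩ := mem_iUnion.1 hi
  have hW : InW i0 β (D i) (ra N) f.1 := hN
  have hf' := AutVA f
  obtain ⟨p, hp, hpc, hps⟩ := exists_p hβ hW (hra N) hf'.diff
  refine ⟨p, hyp_fix hβ hW (hra N) hf'.diff hp hpc, ?_⟩
  rw [Metric.dense_iff]
  intro x s hs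
  obtain ⟨M, hM⟩ := exists_nat_one_div_lt (show 0 < s / 2 by positivity)
  have hM' : ra M < s / 2 := hM
  obtain ⟨j, hj⟩ := hD.exists_dist_lt x (show 0 < s / 2 by positivity)
  have hA : f ∈ AA i0 β (D i) (ra N) (D j) (ra M) := by
    rcases hfT (some (i, N, j, M)) with h | h
    · exact interior_subset h
    · exact absurd (subset_closure hN) h
  obtain ⟨-, x', hx', l, hl⟩ := hA
  refine ⟨x', ?_, ?_⟩
  · rw [mem_ball] at *
    rw [dist_comm] at hj
    linarith [dist_triangle x' (D j) x]
  · have := hps _ hl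
    have h2 : Tendsto (fun k => (f.1)^[k] ((f.1)^[l] x')) atTop (𝓝 p) := this
    simp only [← iterate_add_apply] at h2
    exact (tendsto_add_atTop_iff_nat (f := fun k => (f.1)^[k] x') l).1 h2
end fin

/-- For n ≥ 2, the set of f ∈ Aut_{ω₀}(ℂⁿ) admitting a hyperbolic fixed point
whose stable manifold is dense in ℂⁿ is comeagre in Aut_{ω₀}(ℂⁿ). -/
theorem stmt_2 (n : ℕ) (hn : 2 ≤ n) :
    ∃ S : ℕ → Set ↥(AutOmega n),
      (∀ k, IsOpen (S k) ∧ Dense (S k)) ∧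
      (⋂ k, S k) ⊆
        {f : ↥(AutOmega n) | ∃ p : En n, HypFixedPt ⇑f.1 p ∧ Dense (StableSet ⇑f.1 p)} := by
  exact main_thm n hn
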